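/- arXiv:1012.0207 — 4 statements merged into one kernel-verified Lean document; each statement's English description precedes it below -/
import Mathlib

section
/- There exist absolute constants B ≥ 0 and K > 0 such that, for all reals x ≥ 3 and all integers k ≥ 2 and 1 ≤ W ≤ k−1: Σ_{p ≤ x prime} Σ_{q ≤ p prime} Σ_{m ≤ x², m squarefree, ω(m) = 2W} #{(a,b) ∈ S_{p,k,x}² : s(ab) = m} · #{(c,d) ∈ S_{q,k,x}² : s(cd) = m} ≤ K · (x²/(log²x · (k−W−1)!²)) · Σ_{j=0}^{W−1} [ (2j−2)!(2k−2W−2)!(log log x + B)^{2W−2j−2}/((W−j−1)!²(j−1)!²) + (2j−2)!(2W−2j−2)!(log log x + B)^{2k−2W−2}/((W−j−1)!²(j−1)!²) + (2W−2j−2)!(2k−2W−2)!(log log x + B)^{2j−2}/((W−j−1)!²(j−1)!²) ], with the conventions that (−1)! = (−2)! = 1 and that the third summand inside the sum over j is omitted when j = 0. -/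
open Finset

/-- The squarefree kernel `s(m)`: `m` divided by its largest square divisor,
i.e. the product of the primes dividing `m` to an odd power. -/
def sqKernel (m : ℕ) : ℕ :=
  ∏ p ∈ m.primeFactors.filter fun p => Odd (m.factorization p), p

/-- `S_{p,k,x} = {n ≤ x : ω(n) = Ω(n) = k, P(n) = p}`. -/
noncomputable def Spkx (p k : ℕ) (x : ℝ) : Finset ℕ :=
  (Finset.Icc 1 ⌊x⌋₊).filter fun n =>
    Squarefree n ∧ n.primeFactors.card = k ∧ n.primeFactors.sup id = p

/-- Extended factorial, with the conventions `(-1)! = (-2)! = 1`. -/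
noncomputable def efact (n : ℤ) : ℝ := if n < 0 then 1 else (n.toNat).factorial

theorem sum_log_div_primesBelow_two_pow_le (M : ℕ) :
    ∑ p ∈ Nat.primesBelow (2 ^ M), Real.log p / p ≤ 2 * Real.log 4 * M := by
  induction M with
  | zero => simp [Nat.primesBelow, filter_singleton, Nat.not_prime_zero]
  | succ M ih =>
    have hsub : Nat.primesBelow (2 ^ M) ⊆ Nat.primesBelow (2 ^ (M + 1)) := by
      intro p hp
      rw [Nat.mem_primesBelow] at hp ⊢
      exact ⟨hp.1.trans_le (Nat.pow_le_pow_right (by norm_num) (by omega)), hp.2⟩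
    rw [← sum_sdiff hsub]
    have key : ∑ p ∈ Nat.primesBelow (2 ^ (M + 1)) \ Nat.primesBelow (2 ^ M),
        Real.log p / p ≤ 2 * Real.log 4 := by
      have hpow : (0 : ℝ) < 2 ^ M := by positivity
      have h1 : ∑ p ∈ Nat.primesBelow (2 ^ (M + 1)) \ Nat.primesBelow (2 ^ M),
          Real.log p / p ≤ ∑ p ∈ Nat.primesBelow (2 ^ (M + 1)) \ Nat.primesBelow (2 ^ M),
          Real.log p / 2 ^ M := by
        refine sum_le_sum fun p hp => ?_
        simp only [mem_sdiff, Nat.mem_primesBelow, not_and] at hp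
        have h2 : 2 ^ M ≤ p := by
          by_contra h
          exact hp.2 (by omega) hp.1.2
        have h3 : (2 : ℝ) ^ M ≤ p := by exact_mod_cast h2
        exact div_le_div_of_nonneg_left (Real.log_natCast_nonneg p) hpow h3
      have h2 : ∑ p ∈ Nat.primesBelow (2 ^ (M + 1)) \ Nat.primesBelow (2 ^ M), Real.log p ≤
          Chebyshev.theta (2 ^ (M + 1) : ℝ) := by
        unfold Chebyshev.theta
        refine sum_le_sum_of_subset_of_nonneg ?_ fun p _ _ => Real.log_natCast_nonneg p
        intro p hp
        simp only [mem_sdiff, Nat.mem_primesBelow] at hp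
        simp only [mem_filter, mem_Ioc]
        refine ⟨⟨hp.1.2.pos, Nat.le_floor ?_⟩, hp.1.2⟩
        exact_mod_cast hp.1.1.le
      have h3 := Chebyshev.theta_le_log4_mul_x (x := (2 ^ (M + 1) : ℝ)) (by positivity)
      refine h1.trans ?_
      rw [← sum_div, div_le_iff₀ hpow]
      calc _ ≤ _ := h2.trans h3
        _ = _ := by ring
    push_cast
    linarith

theorem sum_range_two_pow_rpow_le {s : ℝ} (hs : 0 ≤ s) (J : ℕ) :
    ∑ n ∈ Ico (1 : ℕ) (2 ^ J), (n : ℝ) ^ (-s) ≤ ∑ i ∈ range J, ((2 : ℝ) ^ (1 - s)) ^ i := by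
  induction J with
  | zero => simp
  | succ J ih =>
    rw [sum_range_succ, ← sum_Ico_consecutive _ (Nat.one_le_two_pow (n := J))
      (Nat.pow_le_pow_right (by norm_num) (by omega : J ≤ J + 1))]
    refine add_le_add ih ?_
    calc ∑ n ∈ Ico ((2 : ℕ) ^ J) (2 ^ (J + 1)), (n : ℝ) ^ (-s)
        ≤ ∑ n ∈ Ico ((2 : ℕ) ^ J) (2 ^ (J + 1)), ((2 : ℝ) ^ J) ^ (-s) := by
          refine sum_le_sum fun n hn => ?_
          have : (2 : ℝ) ^ J ≤ n := by exact_mod_cast (mem_Ico.1 hn).1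
          exact Real.rpow_le_rpow_of_nonpos (by positivity) this (by linarith)
      _ = (2 : ℝ) ^ J * ((2 : ℝ) ^ J) ^ (-s) := by
          rw [sum_const, Nat.card_Ico, pow_succ, mul_two, Nat.add_sub_cancel, nsmul_eq_mul]
          push_cast; rfl
      _ = ((2 : ℝ) ^ (1 - s)) ^ J := by
          rw [← Real.rpow_natCast, ← Real.rpow_natCast, ← Real.rpow_mul (by norm_num),
            ← Real.rpow_mul (by norm_num), ← Real.rpow_add (by norm_num)]
          congr 1; ring
      _ ≤ _ := le_rfl

theorem sum_geometric_two_rpow_le {M : ℕ} (hM : 1 ≤ M) (J : ℕ) :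
    ∑ i ∈ range J, ((2 : ℝ) ^ (-(1 / M : ℝ))) ^ i ≤ 2 * M := by
  have hM' : (1 : ℝ) ≤ M := by exact_mod_cast hM
  set r : ℝ := (2 : ℝ) ^ (-(1 / M : ℝ)) with hr
  have hr0 : 0 < r := by positivity
  have hrM : r ^ M = 1 / 2 := by
    rw [hr, ← Real.rpow_natCast, ← Real.rpow_mul (by norm_num)]
    have : -(1 / M : ℝ) * M = -1 := by field_simp
    rw [this, Real.rpow_neg_one]; norm_num
  have hle : r ≤ 1 - 1 / (2 * M) := by
    by_contra! h
    have h0 : 1 / (2 * M : ℝ) ≤ 1 / 2 := by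
      apply one_div_le_one_div_of_le <;> linarith
    have h1 := one_add_mul_le_pow (a := -(1 / (2 * M) : ℝ)) (by linarith) M
    have h2 : (1 + -(1 / (2 * M) : ℝ)) ^ M < r ^ M :=
      pow_lt_pow_left₀ (by linarith) (by linarith) (by omega)
    have h3 : (1 : ℝ) + M * -(1 / (2 * M)) = 1 / 2 := by field_simp; ring
    linarith
  have hpos : (0 : ℝ) < 1 / (2 * M) := by positivity
  have := geom_sum_eq (x := r) (by linarith) J
  rw [this, ← neg_div_neg_eq, div_le_iff₀ (by linarith)]
  have h4 : (2 * M : ℝ) * (1 / (2 * M)) = 1 := by field_simp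
  nlinarith [pow_pos hr0 J]

theorem prod_one_add_rpow_primes_le {s : ℝ} (M : ℕ) (P : Finset ℕ) (hP : ∀ p ∈ P, p.Prime)
    (hM : 1 ≤ M) (hs : s = 1 + 1 / M) :
    ∏ p ∈ P, (1 + (p : ℝ) ^ (-s)) ≤ 2 * M := by
  have hs0 : 0 ≤ s := by rw [hs]; positivity
  obtain ⟨J, hJ⟩ : ∃ J : ℕ, ∏ p ∈ P, p < 2 ^ J := ⟨_, Nat.lt_two_pow_self⟩
  have hpos : ∀ S ⊆ P, 0 < ∏ p ∈ S, p := fun S hS => prod_pos fun p hp => (hP p (hS hp)).pos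
  rw [prod_one_add]
  have h1 : ∑ S ∈ P.powerset, ∏ p ∈ S, (p : ℝ) ^ (-s) =
      ∑ n ∈ P.powerset.image (fun S => ∏ p ∈ S, p), (n : ℝ) ^ (-s) := by
    rw [sum_image]
    · refine sum_congr rfl fun S _ => ?_
      push_cast
      exact Real.finsetProd_rpow _ _ (fun i _ => by positivity) _
    · intro S hS T hT h
      have hS' : S ⊆ P := by simpa using hS
      have hT' : T ⊆ P := by simpa using hT
      have h := congrArg Nat.primeFactors h
      simpa only [Nat.primeFactors_prod fun p hp => hP p (hS' hp),
        Nat.primeFactors_prod fun p hp => hP p (hT' hp)] using h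
  rw [h1]
  have h2 : P.powerset.image (fun S => ∏ p ∈ S, p) ⊆ Ico 1 (2 ^ J) := by
    intro n hn
    obtain ⟨S, hS, rfl⟩ := mem_image.1 hn
    rw [mem_powerset] at hS
    rw [mem_Ico]
    refine ⟨hpos S hS, lt_of_le_of_lt (Nat.le_of_dvd (hpos P subset_rfl) ?_) hJ⟩
    exact prod_dvd_prod_of_subset _ _ _ hS
  refine (sum_le_sum_of_subset_of_nonneg h2 fun n _ _ => by positivity).trans ?_
  refine (sum_range_two_pow_rpow_le hs0 J).trans ?_
  have : 1 - s = -(1 / M : ℝ) := by rw [hs]; ring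
  rw [this]
  exact sum_geometric_two_rpow_le hM J

theorem sum_inv_sq_le_two (s : Finset ℕ) (hs : 0 ∉ s) : ∑ n ∈ s, ((n : ℝ) ^ 2)⁻¹ ≤ 2 := by
  obtain ⟨n, hn⟩ := s.exists_nat_subset_range
  have h1 : s ⊆ Ioo 0 n := fun i hi => by
    rw [mem_Ioo]
    exact ⟨Nat.pos_of_ne_zero fun h => hs (h ▸ hi), mem_range.1 (hn hi)⟩
  refine (sum_le_sum_of_subset_of_nonneg h1 fun _ _ _ => by positivity).trans ?_
  simpa using sum_Ioo_inv_sq_le (α := ℝ) 0 n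

theorem sum_inv_primesBelow_two_pow_le {M : ℕ} (hM : 1 ≤ M) :
    ∑ p ∈ Nat.primesBelow (2 ^ M), (p : ℝ)⁻¹ ≤ Real.log M + 6 := by
  have hM' : (0 : ℝ) < M := by exact_mod_cast hM
  set s : ℝ := 1 + 1 / M with hs
  have hP : ∀ p ∈ Nat.primesBelow (2 ^ M), p.Prime := fun p hp => (Nat.mem_primesBelow.1 hp).2
  have h1 := prod_one_add_rpow_primes_le M _ hP hM hs
  have h2 := Real.log_le_log (prod_pos fun p _ => by positivity) h1
  rw [Real.log_prod fun p _ => by positivity, Real.log_mul (by norm_num) (by positivity)] at h2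
  have h3 : ∀ p ∈ Nat.primesBelow (2 ^ M), (p : ℝ)⁻¹ ≤
      Real.log (1 + (p : ℝ) ^ (-s)) + ((p : ℝ) ^ 2)⁻¹ + 1 / M * (Real.log p / p) := by
    intro p hp
    have hp1 : (1 : ℝ) ≤ p := by exact_mod_cast (hP p hp).one_le
    have hp0 : (0 : ℝ) < p := by linarith
    set t := (p : ℝ) ^ (-s) with ht
    have ht0 : 0 < t := by positivity
    have htle : t ≤ (p : ℝ)⁻¹ := by
      rw [← Real.rpow_neg_one, ht]
      refine Real.rpow_le_rpow_of_exponent_le hp1 ?_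
      have : (0 : ℝ) ≤ 1 / M := by positivity
      linarith
    have hlog : t - t ^ 2 ≤ Real.log (1 + t) := by
      have := Real.one_sub_inv_le_log_of_pos (x := 1 + t) (by linarith)
      refine le_trans ?_ this
      have h : 1 - (1 + t)⁻¹ - (t - t ^ 2) = t ^ 3 / (1 + t) := by field_simp; ring
      have : 0 ≤ t ^ 3 / (1 + t) := by positivity
      linarith
    have hsq : t ^ 2 ≤ ((p : ℝ) ^ 2)⁻¹ := by
      rw [← inv_pow]; exact pow_le_pow_left₀ ht0.le htle 2
    have hteq : t = (p : ℝ)⁻¹ * Real.exp (-(1 / M * Real.log p)) := by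
      rw [ht, hs, neg_add, Real.rpow_add hp0, Real.rpow_neg_one, Real.rpow_def_of_pos hp0 (-(1 / M : ℝ))]
      congr 2; ring
    have hexp := Real.add_one_le_exp (-(1 / M * Real.log p))
    have : (p : ℝ)⁻¹ * (-(1 / M * Real.log p) + 1) ≤ t := by
      rw [hteq]; gcongr
    have h5 : (p : ℝ)⁻¹ * (-(1 / M * Real.log p) + 1) = (p : ℝ)⁻¹ - 1 / M * (Real.log p / p) := by
      field_simp; ring
    linarith
  have h4 := sum_le_sum h3
  rw [sum_add_distrib, sum_add_distrib, ← mul_sum] at h4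
  have h5 := sum_inv_sq_le_two (Nat.primesBelow (2 ^ M)) (by simp [Nat.mem_primesBelow, Nat.not_prime_zero])
  have h6 : 1 / (M : ℝ) * ∑ p ∈ Nat.primesBelow (2 ^ M), Real.log p / p ≤ 2 * Real.log 4 := by
    rw [one_div, inv_mul_le_iff₀ hM']
    linarith [sum_log_div_primesBelow_two_pow_le M]
  have h7 : Real.log 4 = 2 * Real.log 2 := by
    rw [show (4 : ℝ) = 2 ^ 2 by norm_num, Real.log_pow]; norm_num
  have := Real.log_two_lt_d9
  linarith

/-- The squarefree integers in `[2 ^ i, 2 ^ (i + 1))` with exactly `α` prime factors. -/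
def dyadicSquarefree (α i : ℕ) : Finset ℕ :=
  (Ico (2 ^ i) (2 ^ (i + 1))).filter fun n => Squarefree n ∧ n.primeFactors.card = α

theorem mem_dyadicSquarefree {α i n : ℕ} : n ∈ dyadicSquarefree α i ↔
    (2 ^ i ≤ n ∧ n < 2 ^ (i + 1)) ∧ Squarefree n ∧ n.primeFactors.card = α := by
  simp [dyadicSquarefree]

theorem sum_powersetCard_prod_le {ι : Type*} [DecidableEq ι] (P : Finset ι) (f : ι → ℝ)
    (hf : ∀ i ∈ P, 0 ≤ f i) (n : ℕ) :
    ∑ S ∈ P.powersetCard n, ∏ i ∈ S, f i ≤ (∑ i ∈ P, f i) ^ n / n.factorial := by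
  induction P using Finset.induction_on generalizing n with
  | empty =>
    cases n with
    | zero => simp
    | succ n => simp [powersetCard_eq_empty.2 (show (∅ : Finset ι).card < n + 1 by simp)]
  | insert a P ha ih =>
    have hfP : ∀ i ∈ P, 0 ≤ f i := fun i hi => hf i (mem_insert_of_mem hi)
    have hfa : 0 ≤ f a := hf a (mem_insert_self _ _)
    have hσ : 0 ≤ ∑ i ∈ P, f i := sum_nonneg hfP
    cases n with
    | zero => simp
    | succ n =>
      have hnot : ∀ S ∈ P.powersetCard n, a ∉ S := fun S hS h =>
        ha ((mem_powersetCard.1 hS).1 h)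
      rw [powersetCard_succ_insert ha, sum_union, sum_image, sum_insert ha]
      · have h1 : ∑ S ∈ P.powersetCard n, ∏ i ∈ insert a S, f i =
            f a * ∑ S ∈ P.powersetCard n, ∏ i ∈ S, f i := by
          rw [mul_sum]
          exact sum_congr rfl fun S hS => prod_insert (hnot S hS)
        rw [h1]
        set σ := ∑ i ∈ P, f i
        have h2 := ih hfP (n + 1)
        have h3 := mul_le_mul_of_nonneg_left (ih hfP n) hfa
        have h4 : σ ^ (n + 1) + (n + 1) * (f a * σ ^ n) ≤ (f a + σ) ^ (n + 1) := by
          have hadd := pow_add_mul_le_add_pow hσ (by linarith : 0 ≤ 2 * σ + f a) (n + 1)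
          rw [Nat.add_sub_cancel] at hadd
          push_cast at hadd
          linarith [add_comm (f a) σ ▸ hadd]
        have hfac : (0 : ℝ) < (n + 1).factorial := by positivity
        refine (add_le_add h2 h3).trans ?_
        rw [le_div_iff₀ hfac]
        have h5 : ((n + 1).factorial : ℝ) = (n + 1) * n.factorial := by
          rw [Nat.factorial_succ]; push_cast; ring
        have h6 : (n.factorial : ℝ) ≠ 0 := by positivity
        rw [h5]
        calc _ = σ ^ (n + 1) + (n + 1) * (f a * σ ^ n) := by field_simp
          _ ≤ _ := h4
      · intro S hS T hT h
        rw [← erase_insert (hnot S hS), ← erase_insert (hnot T hT), h]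
      · rw [disjoint_left]
        intro S hS hS'
        obtain ⟨T, _, rfl⟩ := mem_image.1 hS'
        exact ha ((mem_powersetCard.1 hS).1 (mem_insert_self _ _))

theorem sum_inv_squarefree_le (M n : ℕ) (hM : 1 ≤ M) :
    ∑ m ∈ (Ico (1 : ℕ) (2 ^ M)).filter fun m => Squarefree m ∧ m.primeFactors.card = n, (m : ℝ)⁻¹ ≤
      (Real.log M + 6) ^ n / n.factorial := by
  set Q := (Ico 1 (2 ^ M)).filter fun m => Squarefree m ∧ m.primeFactors.card = n with hQ
  have hmem : ∀ m ∈ Q, (1 ≤ m ∧ m < 2 ^ M) ∧ Squarefree m ∧ m.primeFactors.card = n := by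
    intro m hm; simpa [hQ] using hm
  have h1 : ∑ m ∈ Q, (m : ℝ)⁻¹ = ∑ S ∈ Q.image Nat.primeFactors, ∏ p ∈ S, (p : ℝ)⁻¹ := by
    rw [sum_image]
    · refine sum_congr rfl fun m hm => ?_
      rw [prod_inv_distrib, ← Nat.cast_prod, Nat.prod_primeFactors_of_squarefree (hmem m hm).2.1]
    · intro a ha b hb h
      rw [← Nat.prod_primeFactors_of_squarefree (hmem a ha).2.1,
        ← Nat.prod_primeFactors_of_squarefree (hmem b hb).2.1, h]
  have h2 : Q.image Nat.primeFactors ⊆ (Nat.primesBelow (2 ^ M)).powersetCard n := by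
    intro S hS
    obtain ⟨m, hm, rfl⟩ := mem_image.1 hS
    obtain ⟨⟨h1, h2⟩, -, h3⟩ := hmem m hm
    refine mem_powersetCard.2 ⟨fun p hp => ?_, h3⟩
    rw [Nat.mem_primesBelow]
    exact ⟨(Nat.le_of_mem_primeFactors hp).trans_lt h2, Nat.prime_of_mem_primeFactors hp⟩
  rw [h1]
  refine (sum_le_sum_of_subset_of_nonneg h2 fun S _ _ => prod_nonneg fun p _ => by positivity).trans ?_
  refine (sum_powersetCard_prod_le _ _ (fun i _ => by positivity) n).trans ?_
  gcongr
  exact sum_inv_primesBelow_two_pow_le hM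

theorem sum_log_dyadicSquarefree_le (α i : ℕ) :
    ∑ n ∈ dyadicSquarefree (α + 1) i, Real.log n ≤
      Real.log 4 * 2 ^ (i + 1) * ((Real.log (i + 1) + 6) ^ α / α.factorial) := by
  set D := dyadicSquarefree (α + 1) i with hD
  set Q := (Ico 1 (2 ^ (i + 1))).filter fun m => Squarefree m ∧ m.primeFactors.card = α with hQ
  have h1 : ∑ n ∈ D, Real.log n = ∑ n ∈ D, ∑ p ∈ n.primeFactors, Real.log p := by
    refine sum_congr rfl fun n hn => ?_
    have hsq := (mem_dyadicSquarefree.1 hn).2.1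
    rw [← Real.log_prod fun p hp => by
      exact_mod_cast (Nat.prime_of_mem_primeFactors hp).ne_zero, ← Nat.cast_prod,
      Nat.prod_primeFactors_of_squarefree hsq]
  have h2 : ∑ n ∈ D, ∑ p ∈ n.primeFactors, Real.log p ≤
      ∑ m ∈ Q, ∑ p ∈ (Ioc 0 ⌊(2 ^ (i + 1) / m : ℝ)⌋₊).filter Nat.Prime, Real.log p := by
    rw [sum_sigma', sum_sigma']
    have hinj : Set.InjOn (fun x : (_ : ℕ) × ℕ => (⟨x.1 / x.2, x.2⟩ : (_ : ℕ) × ℕ))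
        (D.sigma fun n => n.primeFactors) := by
      rintro ⟨n, p⟩ hx ⟨n', p'⟩ hx' h
      simp only [coe_sigma, Set.mem_sigma_iff, mem_coe] at hx hx'
      simp only [Sigma.mk.injEq, heq_eq_eq] at h
      obtain ⟨h, rfl⟩ := h
      have e1 := Nat.div_mul_cancel (Nat.dvd_of_mem_primeFactors hx.2)
      have e2 := Nat.div_mul_cancel (Nat.dvd_of_mem_primeFactors hx'.2)
      rw [← e1, ← e2, h]
    rw [← sum_image (g := fun x : (_ : ℕ) × ℕ => (⟨x.1 / x.2, x.2⟩ : (_ : ℕ) × ℕ))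
      (f := fun x => Real.log x.2) hinj]
    refine sum_le_sum_of_subset_of_nonneg ?_ fun x _ _ => Real.log_natCast_nonneg _
    intro x hx
    obtain ⟨⟨n, p⟩, hnp, rfl⟩ := mem_image.1 hx
    rw [mem_sigma] at hnp
    obtain ⟨hn, hp⟩ := hnp
    simp only at hn hp
    obtain ⟨⟨-, hlt⟩, hsq, hcard⟩ := mem_dyadicSquarefree.1 hn
    have hpp := Nat.prime_of_mem_primeFactors hp
    obtain ⟨m, rfl⟩ := Nat.dvd_of_mem_primeFactors hp
    have hm0 : m ≠ 0 := by rintro rfl; simp at hp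
    obtain ⟨hcop, -, hsqm⟩ := Nat.squarefree_mul_iff.1 hsq
    have hcard' : m.primeFactors.card = α := by
      rw [hcop.primeFactors_mul, card_union_of_disjoint hcop.disjoint_primeFactors,
        hpp.primeFactors, card_singleton] at hcard
      omega
    simp only [mem_sigma, Nat.mul_div_cancel_left m hpp.pos, hQ, mem_filter, mem_Ico, mem_Ioc]
    refine ⟨⟨⟨by omega, lt_of_le_of_lt (Nat.le_mul_of_pos_left m hpp.pos) hlt⟩, hsqm, hcard'⟩,
      ⟨hpp.pos, Nat.le_floor ?_⟩, hpp⟩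
    rw [le_div_iff₀ (by positivity)]
    exact_mod_cast hlt.le
  have h3 : ∀ m ∈ Q, ∑ p ∈ (Ioc 0 ⌊(2 ^ (i + 1) / m : ℝ)⌋₊).filter Nat.Prime, Real.log p ≤
      Real.log 4 * 2 ^ (i + 1) * (m : ℝ)⁻¹ := fun m _ => by
    have := Chebyshev.theta_le_log4_mul_x (x := (2 ^ (i + 1) / m : ℝ)) (by positivity)
    rw [mul_assoc, ← div_eq_mul_inv]
    exact this
  rw [h1]
  refine h2.trans ((sum_le_sum h3).trans ?_)
  rw [← mul_sum]
  have hlog4 : 0 < Real.log 4 := Real.log_pos (by norm_num)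
  have h4 := sum_inv_squarefree_le (i + 1) α (by omega)
  push_cast at h4
  gcongr

theorem card_dyadicSquarefree_succ_le (α i : ℕ) :
    ((dyadicSquarefree (α + 1) i).card : ℝ) ≤
      2 ^ i * (8 * (Real.log (i + 1) + 6) ^ α / (α.factorial * (i + 1))) := by
  have hL : 0 ≤ Real.log (i + 1) + 6 := by
    have := Real.log_natCast_nonneg (i + 1)
    push_cast at this
    linarith
  rcases Nat.eq_zero_or_pos i with rfl | hi
  · have : dyadicSquarefree (α + 1) 0 = ∅ := by
      rw [eq_empty_iff_forall_notMem]
      intro n hn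
      obtain ⟨⟨h1, h2⟩, -, h3⟩ := mem_dyadicSquarefree.1 hn
      obtain rfl : n = 1 := by omega
      simp at h3
    rw [this, card_empty, Nat.cast_zero]
    positivity
  · have h1 : (dyadicSquarefree (α + 1) i).card * (i * Real.log 2) ≤
        ∑ n ∈ dyadicSquarefree (α + 1) i, Real.log n := by
      rw [← nsmul_eq_mul]
      refine card_nsmul_le_sum _ _ _ fun n hn => ?_
      rw [← Real.log_pow]
      refine Real.log_le_log (by positivity) ?_
      exact_mod_cast (mem_dyadicSquarefree.1 hn).1.1
    have h2 := h1.trans (sum_log_dyadicSquarefree_le α i)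
    have h7 : Real.log 4 = 2 * Real.log 2 := by
      rw [show (4 : ℝ) = 2 ^ 2 by norm_num, Real.log_pow]; norm_num
    have hl2 : 0 < Real.log 2 := Real.log_pos (by norm_num)
    have hi' : (1 : ℝ) ≤ i := by exact_mod_cast hi
    set E := (Real.log (i + 1) + 6) ^ α / α.factorial with hE
    have hE0 : 0 ≤ E := by positivity
    rw [h7] at h2
    have h3 : (dyadicSquarefree (α + 1) i).card * (i : ℝ) ≤ 4 * 2 ^ i * E := by
      refine le_of_mul_le_mul_right ?_ hl2
      calc _ = ((dyadicSquarefree (α + 1) i).card : ℝ) * (i * Real.log 2) := by ring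
        _ ≤ _ := h2
        _ = _ := by ring
    have h4 : 2 ^ i * (8 * (Real.log (i + 1) + 6) ^ α / (α.factorial * (i + 1))) =
        8 * 2 ^ i * E / (i + 1) := by rw [hE]; field_simp
    rw [h4, le_div_iff₀ (by positivity)]
    have : (0 : ℝ) ≤ (dyadicSquarefree (α + 1) i).card := by positivity
    nlinarith

theorem hasDerivAt_sum_log_pow_div (B : ℝ) (m : ℕ) {t : ℝ} (ht : 0 < t) :
    HasDerivAt (fun t => (∑ i ∈ range (m + 1), (Real.log t + B) ^ i / i.factorial) / t)
      (-((Real.log t + B) ^ m / (m.factorial * t ^ 2))) t := by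
  have ht0 : t ≠ 0 := ht.ne'
  induction m with
  | zero =>
    have := hasDerivAt_inv ht0
    simpa [div_eq_mul_inv] using this
  | succ m ih =>
    have h1 : HasDerivAt (fun t => (Real.log t + B) ^ (m + 1) / (m + 1).factorial / t)
        ((((m + 1 : ℕ) * (Real.log t + B) ^ m * t⁻¹) / (m + 1).factorial * t -
          (Real.log t + B) ^ (m + 1) / (m + 1).factorial * 1) / t ^ 2) t := by
      have h := ((Real.hasDerivAt_log ht0).add_const B).fun_pow (m + 1)
      rw [Nat.add_sub_cancel] at h
      exact (h.div_const _).fun_div (hasDerivAt_id' t) ht0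
    have h2 := ih.fun_add h1
    refine (h2.congr_deriv ?_).congr_of_eventuallyEq (Filter.Eventually.of_forall fun s => ?_)
    · have h5 : ((m + 1).factorial : ℝ) = (m + 1) * m.factorial := by
        rw [Nat.factorial_succ]; push_cast; ring
      have h6 : (m.factorial : ℝ) ≠ 0 := by positivity
      rw [h5]
      push_cast
      field_simp
      ring
    · simp only
      rw [sum_range_succ _ (m + 1), add_div]

theorem sum_log_pow_div_sq_le {B : ℝ} (hB : 0 ≤ B) (m R : ℕ) :
    ∑ r ∈ range R, (Real.log (r + 1) + B) ^ m / ((r : ℝ) + 1) ^ 2 ≤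
      4 * Real.exp B * m.factorial := by
  set ψ : ℝ → ℝ := fun t => (∑ i ∈ range (m + 1), (Real.log t + B) ^ i / i.factorial) / t with hψ
  have hfac : (0 : ℝ) < m.factorial := by positivity
  have hstep : ∀ r : ℕ, (Real.log (r + 1) + B) ^ m / ((r : ℝ) + 1) ^ 2 ≤
      4 * m.factorial * (ψ (r + 1) - ψ ((r + 1 : ℕ) + 1)) := by
    intro r
    have hr : (0 : ℝ) < r + 1 := by positivity
    obtain ⟨c, hc, hc'⟩ := exists_hasDerivAt_eq_slope ψ
      (fun t => -((Real.log t + B) ^ m / (m.factorial * t ^ 2))) (a := (r : ℝ) + 1)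
      (b := (r : ℝ) + 1 + 1) (by linarith)
      (fun t ht => (hasDerivAt_sum_log_pow_div B m (hr.trans_le ht.1)).continuousAt.continuousWithinAt)
      (fun t ht => hasDerivAt_sum_log_pow_div B m (hr.trans ht.1))
    have hc0 : 0 < c := hr.trans hc.1
    have hlog0 : 0 ≤ Real.log (r + 1) := by
      have := Real.log_natCast_nonneg (r + 1); push_cast at this; exact this
    have hlog : Real.log (r + 1) ≤ Real.log c := Real.log_le_log hr hc.1.le
    have h1 : ψ (r + 1) - ψ ((r + 1 : ℕ) + 1) = (Real.log c + B) ^ m / (m.factorial * c ^ 2) := by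
      push_cast
      rw [add_sub_cancel_left, div_one] at hc'
      linarith
    rw [h1]
    have h2 : c ^ 2 ≤ (2 * ((r : ℝ) + 1)) ^ 2 := by
      refine pow_le_pow_left₀ hc0.le ?_ 2
      have := hc.2
      have : (0 : ℝ) ≤ r := by positivity
      linarith
    calc (Real.log (r + 1) + B) ^ m / ((r : ℝ) + 1) ^ 2
        ≤ (Real.log c + B) ^ m / ((r : ℝ) + 1) ^ 2 := by gcongr
      _ = 4 * ((Real.log c + B) ^ m / (2 * ((r : ℝ) + 1)) ^ 2) := by field_simp; ring
      _ ≤ 4 * ((Real.log c + B) ^ m / c ^ 2) := by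
        have : 0 ≤ (Real.log c + B) ^ m := pow_nonneg (by linarith) m
        gcongr
      _ = _ := by field_simp
  have htel := sum_range_sub' (fun r : ℕ => ψ ((r : ℝ) + 1)) R
  refine (sum_le_sum fun r _ => hstep r).trans ?_
  rw [← mul_sum, htel]
  have h1 : ψ ((0 : ℕ) + 1) ≤ Real.exp B := by
    simp only [hψ, Nat.cast_zero, zero_add, Real.log_one, div_one]
    exact Real.sum_le_exp_of_nonneg hB _
  have h2 : 0 ≤ ψ ((R : ℝ) + 1) := by
    have hlog0 : 0 ≤ Real.log (R + 1) := by
      have := Real.log_natCast_nonneg (R + 1); push_cast at this; exact this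
    exact div_nonneg (sum_nonneg fun i _ => by positivity) (by positivity)
  calc _ ≤ 4 * (m.factorial : ℝ) * Real.exp B := by gcongr; linarith
    _ = _ := by ring

theorem sum_dist_le_two_mul_tsum {κ : ℕ → ℝ} (hκ : Summable κ) (h0 : ∀ t, 0 ≤ κ t)
    (I : Finset ℕ) (a : ℕ) :
    ∑ b ∈ I, κ ((a - b) + (b - a)) ≤ 2 * ∑' t, κ t := by
  rw [← sum_filter_add_sum_filter_not I (fun b => b ≤ a), two_mul]
  refine add_le_add ?_ ?_
  · rw [← sum_image (f := κ) (g := fun b => (a - b) + (b - a))]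
    · exact hκ.sum_le_tsum _ fun t _ => h0 t
    · intro b hb b' hb' h
      simp only [coe_filter, Set.mem_ofPred_eq] at hb hb' h
      omega
  · rw [← sum_image (f := κ) (g := fun b => (a - b) + (b - a))]
    · exact hκ.sum_le_tsum _ fun t _ => h0 t
    · intro b hb b' hb' h
      simp only [coe_filter, Set.mem_ofPred_eq] at hb hb' h
      omega

theorem sum_sum_mul_mul_le (I : Finset ℕ) (e : ℕ → ℝ) (G : ℕ → ℕ → ℝ)
    (hG : ∀ a b, 0 ≤ G a b) (hsymm : ∀ a b, G a b = G b a) :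
    ∑ a ∈ I, ∑ b ∈ I, e a * e b * G a b ≤ ∑ a ∈ I, ∑ b ∈ I, e a ^ 2 * G a b := by
  have h1 : ∑ a ∈ I, ∑ b ∈ I, e b ^ 2 * G a b = ∑ a ∈ I, ∑ b ∈ I, e a ^ 2 * G a b := by
    rw [sum_comm]
    exact sum_congr rfl fun a _ => sum_congr rfl fun b _ => by rw [hsymm]
  have h2 : ∑ a ∈ I, ∑ b ∈ I, 2 * (e a * e b * G a b) ≤
      ∑ a ∈ I, ∑ b ∈ I, (e a ^ 2 * G a b + e b ^ 2 * G a b) := by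
    refine sum_le_sum fun a _ => sum_le_sum fun b _ => ?_
    nlinarith [mul_nonneg (sq_nonneg (e a - e b)) (hG a b)]
  have h3 : 2 * ∑ a ∈ I, ∑ b ∈ I, e a * e b * G a b =
      ∑ a ∈ I, ∑ b ∈ I, 2 * (e a * e b * G a b) := by simp only [mul_sum]
  simp only [sum_add_distrib, h1] at h2
  linarith

/-- The weight `2 ^ (a + a' + b + b' + c + c')`, restricted to the exponents for which the sum
plus a third of the deviations within the three pairs is at most `2 * N`. -/
def pairWeight (N a a' b b' c c' : ℕ) : ℝ :=
  if 3 * (a + a' + b + b' + c + c') + ((a - a') + (a' - a)) + ((b - b') + (b' - b)) +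
      ((c - c') + (c' - c)) ≤ 6 * N then 2 ^ (a + a' + b + b' + c + c') else 0

theorem pairWeight_nonneg (N a a' b b' c c' : ℕ) : 0 ≤ pairWeight N a a' b b' c c' := by
  unfold pairWeight
  split_ifs <;> positivity

theorem pairWeight_swap_fst (N a a' b b' c c' : ℕ) :
    pairWeight N a a' b b' c c' = pairWeight N a' a b b' c c' := by
  simp only [pairWeight, add_comm a a', add_comm (a - a') (a' - a)]

theorem pairWeight_swap_snd (N a a' b b' c c' : ℕ) :
    pairWeight N a a' b b' c c' = pairWeight N a a' b' b c c' := by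
  simp only [pairWeight, add_right_comm _ b b', add_comm (b - b') (b' - b)]

theorem pairWeight_swap_thd (N a a' b b' c c' : ℕ) :
    pairWeight N a a' b b' c c' = pairWeight N a a' b b' c' c := by
  simp only [pairWeight, add_right_comm _ c c', add_comm (c - c') (c' - c)]

theorem pairWeight_le {ρ : ℝ} (h0 : 0 < ρ) (h1 : ρ ≤ 1) (hρ : ρ ^ 12 = 1 / 2)
    (N a a' b b' c c' : ℕ) :
    pairWeight N a a' b b' c c' ≤ 4 ^ N * ρ ^ ((N - (a + b + c)) + (a + b + c - N)) *
      ρ ^ ((a - a') + (a' - a)) * ρ ^ ((b - b') + (b' - b)) * ρ ^ ((c - c') + (c' - c)) := by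
  unfold pairWeight
  split_ifs with h
  · have hS : a + a' + b + b' + c + c' ≤ 2 * N := by omega
    obtain ⟨k, hk⟩ := Nat.exists_eq_add_of_le hS
    have h4 : (4 : ℝ) ^ N = 2 ^ (a + a' + b + b' + c + c') * 2 ^ k := by
      rw [← pow_add, ← hk, pow_mul]; norm_num
    have h5 : (2 : ℝ) ^ k * ρ ^ (12 * k) = 1 := by
      rw [pow_mul, hρ, ← mul_pow]; norm_num
    have h6 : ((N - (a + b + c)) + (a + b + c - N)) + ((a - a') + (a' - a)) +
        ((b - b') + (b' - b)) + ((c - c') + (c' - c)) ≤ 12 * k := by omega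
    have h7 := pow_le_pow_of_le_one h0.le h1 h6
    rw [pow_add, pow_add, pow_add] at h7
    calc (2 : ℝ) ^ (a + a' + b + b' + c + c')
        = 2 ^ (a + a' + b + b' + c + c') * 2 ^ k * ρ ^ (12 * k) := by rw [mul_assoc, h5, mul_one]
      _ ≤ 2 ^ (a + a' + b + b' + c + c') * 2 ^ k * _ := mul_le_mul_of_nonneg_left h7 (by positivity)
      _ = _ := by rw [h4]; ring
  · positivity

theorem three_mul_inv_sq_le {N a b c : ℕ} (hb : b ≤ a) (hc : c ≤ a) :
    1 / ((a : ℝ) + 1) ^ 2 ≤ 9 / ((N : ℝ) + 1) ^ 2 *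
      (1 + (((N - (a + b + c)) + (a + b + c - N) : ℕ) : ℝ)) ^ 2 := by
  set t := (N - (a + b + c)) + (a + b + c - N) with ht
  have h1 : N + 1 ≤ (3 * (a + 1)) * (1 + t) := by
    have : N + 1 ≤ (a + b + c + 1) + t := by omega
    nlinarith
  have h2 : ((N : ℝ) + 1) ≤ (3 * (a + 1)) * (1 + t) := by exact_mod_cast h1
  have h3 : ((N : ℝ) + 1) ^ 2 ≤ ((3 * (a + 1)) * (1 + t)) ^ 2 :=
    pow_le_pow_left₀ (by positivity) h2 2
  rw [div_mul_eq_mul_div, div_le_div_iff₀ (by positivity) (by positivity)]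
  refine (one_mul _).trans_le (h3.trans (le_of_eq ?_))
  ring

theorem sum_triple_le {κ : ℕ → ℝ} (hκ : Summable κ) (h0 : ∀ t, 0 ≤ κ t) {ρ : ℝ} (hρ : 0 ≤ ρ)
    (hκρ : ∀ t : ℕ, ρ ^ t * (1 + (t : ℝ)) ^ 2 = κ t) (N : ℕ) (f g h : ℕ → ℝ)
    (hf0 : ∀ r, 0 ≤ f r) (hg0 : ∀ r, 0 ≤ g r) (hh0 : ∀ r, 0 ≤ h r) (F G H F' G' H' : ℝ)
    (hF0 : 0 ≤ F) (hG0 : 0 ≤ G) (hH0 : 0 ≤ H)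
    (hF : ∀ r, 1 ≤ r → r ≤ N → f r ≤ F * (1 / ((r : ℝ) + 1) ^ 2))
    (hG : ∀ r, r ≤ N → g r ≤ G * (1 / ((r : ℝ) + 1) ^ 2))
    (hH : ∀ r, r ≤ N → h r ≤ H * (1 / ((r : ℝ) + 1) ^ 2))
    (hF' : ∑ r ∈ range (N + 1), f r ≤ F') (hG' : ∑ r ∈ range (N + 1), g r ≤ G')
    (hH' : ∑ r ∈ range (N + 1), h r ≤ H') :
    ∑ a ∈ range (N + 1), f a * ∑ b ∈ range (N + 1), g b * ∑ c ∈ range (N + 1), h c *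
      ρ ^ ((N - (a + b + c)) + (a + b + c - N)) ≤
    18 * (∑' t, κ t) / ((N : ℝ) + 1) ^ 2 * (F * G' * H' + F' * G * H' + F' * G' * H) := by
  set I := range (N + 1) with hI
  set A : ℝ := 9 / ((N : ℝ) + 1) ^ 2 with hA
  have hA0 : 0 ≤ A := by positivity
  set τ := ∑' t, κ t with hτ
  have hτ0 : 0 ≤ τ := tsum_nonneg h0
  set d : ℕ → ℕ → ℕ → ℕ := fun a b c => (N - (a + b + c)) + (a + b + c - N) with hd
  have hpt : ∀ a ∈ I, ∀ b ∈ I, ∀ c ∈ I, f a * (g b * (h c * ρ ^ d a b c)) ≤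
      A * F * (g b * h c * κ (d a b c)) + A * G * (f a * h c * κ (d a b c)) +
        A * H * (f a * g b * κ (d a b c)) := by
    intro a ha b hb c hc
    rw [hI, mem_range, Nat.lt_succ_iff] at ha hb hc
    have hfa := hf0 a
    have hgb := hg0 b
    have hhc := hh0 c
    have hκd := h0 (d a b c)
    have hρd : 0 ≤ ρ ^ d a b c := pow_nonneg hρ _
    have n1 : 0 ≤ A * F * (g b * h c * κ (d a b c)) := by positivity
    have n2 : 0 ≤ A * G * (f a * h c * κ (d a b c)) := by positivity
    have n3 : 0 ≤ A * H * (f a * g b * κ (d a b c)) := by positivity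
    rcases Nat.lt_or_ge (max b c) a with hmax | hmax
    · have h1 := (hF a (by omega) ha).trans (mul_le_mul_of_nonneg_left
        (three_mul_inv_sq_le (N := N) (a := a) (b := b) (c := c) (by omega) (by omega)) hF0)
      have h2 : f a * (g b * (h c * ρ ^ d a b c)) ≤ A * F * (g b * h c * κ (d a b c)) := by
        calc _ ≤ _ := mul_le_mul_of_nonneg_right h1 (by positivity)
          _ = _ := by rw [← hκρ]; ring
      linarith
    · rcases Nat.lt_or_ge b c with hbc | hbc
      · have h1 := (hH c hc).trans (mul_le_mul_of_nonneg_left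
          (three_mul_inv_sq_le (N := N) (a := c) (b := a) (c := b) (by omega) (by omega)) hH0)
        rw [show c + a + b = a + b + c by ring] at h1
        have h2 : f a * (g b * (h c * ρ ^ d a b c)) ≤ A * H * (f a * g b * κ (d a b c)) := by
          calc _ = h c * (f a * g b * ρ ^ d a b c) := by ring
            _ ≤ _ := mul_le_mul_of_nonneg_right h1 (by positivity)
            _ = _ := by rw [← hκρ]; ring
        linarith
      · have h1 := (hG b hb).trans (mul_le_mul_of_nonneg_left
          (three_mul_inv_sq_le (N := N) (a := b) (b := a) (c := c) (by omega) (by omega)) hG0)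
        rw [show b + a + c = a + b + c by ring] at h1
        have h2 : f a * (g b * (h c * ρ ^ d a b c)) ≤ A * G * (f a * h c * κ (d a b c)) := by
          calc _ = g b * (f a * h c * ρ ^ d a b c) := by ring
            _ ≤ _ := mul_le_mul_of_nonneg_right h1 (by positivity)
            _ = _ := by rw [← hκρ]; ring
        linarith
  have hshift : ∀ s : ℕ, ∑ a ∈ I, κ ((N - (a + s)) + (a + s - N)) ≤ 2 * τ := by
    intro s
    have := sum_dist_le_two_mul_tsum hκ h0 (I.map (addRightEmbedding s)) N
    simpa using this
  have pair : ∀ (u v : ℕ → ℝ) (U V : ℝ), (∀ r, 0 ≤ u r) → (∀ r, 0 ≤ v r) → ∑ r ∈ I, u r ≤ U →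
      ∑ r ∈ I, v r ≤ V → ∑ b ∈ I, ∑ c ∈ I, ∑ a ∈ I,
        u b * v c * κ ((N - (a + (b + c))) + (a + (b + c) - N)) ≤ 2 * τ * (U * V) := by
    intro u v U V hu hv hU hV
    calc _ ≤ ∑ b ∈ I, ∑ c ∈ I, u b * v c * (2 * τ) := by
          refine sum_le_sum fun b _ => sum_le_sum fun c _ => ?_
          rw [← mul_sum]
          exact mul_le_mul_of_nonneg_left (hshift _) (mul_nonneg (hu b) (hv c))
      _ = 2 * τ * ((∑ b ∈ I, u b) * ∑ c ∈ I, v c) := by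
          rw [sum_mul_sum, mul_sum]
          refine sum_congr rfl fun b _ => ?_
          rw [mul_sum]
          exact sum_congr rfl fun c _ => by ring
      _ ≤ _ := by
          have := sum_nonneg (s := I) fun r _ => hv r
          have := sum_nonneg (s := I) fun r _ => hu r
          have : 0 ≤ U := by linarith
          gcongr
  calc _ = ∑ a ∈ I, ∑ b ∈ I, ∑ c ∈ I, f a * (g b * (h c * ρ ^ d a b c)) := by
        simp only [mul_sum, hd]
    _ ≤ ∑ a ∈ I, ∑ b ∈ I, ∑ c ∈ I, (A * F * (g b * h c * κ (d a b c)) +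
          A * G * (f a * h c * κ (d a b c)) + A * H * (f a * g b * κ (d a b c))) :=
        sum_le_sum fun a ha => sum_le_sum fun b hb => sum_le_sum fun c hc => hpt a ha b hb c hc
    _ = A * F * ∑ a ∈ I, ∑ b ∈ I, ∑ c ∈ I, g b * h c * κ (d a b c) +
        A * G * ∑ a ∈ I, ∑ b ∈ I, ∑ c ∈ I, f a * h c * κ (d a b c) +
        A * H * ∑ a ∈ I, ∑ b ∈ I, ∑ c ∈ I, f a * g b * κ (d a b c) := by
        simp only [sum_add_distrib, mul_sum]
    _ ≤ A * F * (2 * τ * (G' * H')) + A * G * (2 * τ * (F' * H')) +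
        A * H * (2 * τ * (F' * G')) := by
        gcongr
        · refine le_trans (le_of_eq ?_) (pair g h G' H' hg0 hh0 hG' hH')
          rw [sum_comm]
          refine sum_congr rfl fun b _ => ?_
          rw [sum_comm]
          simp only [hd, add_assoc]
        · refine le_trans (le_of_eq ?_) (pair f h F' H' hf0 hh0 hF' hH')
          refine sum_congr rfl fun a _ => ?_
          rw [sum_comm]
          simp only [hd, add_left_comm, add_assoc]
        · refine le_trans (le_of_eq ?_) (pair f g F' G' hf0 hg0 hF' hG')
          refine sum_congr rfl fun a _ => sum_congr rfl fun b _ => sum_congr rfl fun c _ => ?_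
          simp only [hd, add_comm c]
    _ = _ := by rw [hA]; ring

theorem exists_sum_pairWeight_le : ∃ C > (0 : ℝ), ∀ (N : ℕ) (e₁ e₂ e₃ : ℕ → ℝ)
    (F G H F' G' H' : ℝ), (∀ r, 0 ≤ e₁ r) → (∀ r, 0 ≤ e₂ r) → (∀ r, 0 ≤ e₃ r) →
    0 ≤ F → 0 ≤ G → 0 ≤ H →
    (∀ r, 1 ≤ r → r ≤ N → e₁ r ^ 2 ≤ F * (1 / ((r : ℝ) + 1) ^ 2)) →
    (∀ r, r ≤ N → e₂ r ^ 2 ≤ G * (1 / ((r : ℝ) + 1) ^ 2)) →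
    (∀ r, r ≤ N → e₃ r ^ 2 ≤ H * (1 / ((r : ℝ) + 1) ^ 2)) →
    ∑ r ∈ range (N + 1), e₁ r ^ 2 ≤ F' → ∑ r ∈ range (N + 1), e₂ r ^ 2 ≤ G' →
    ∑ r ∈ range (N + 1), e₃ r ^ 2 ≤ H' →
    ∑ a ∈ range (N + 1), ∑ a' ∈ range (N + 1), e₁ a * e₁ a' *
      ∑ b ∈ range (N + 1), ∑ b' ∈ range (N + 1), e₂ b * e₂ b' *
        ∑ c ∈ range (N + 1), ∑ c' ∈ range (N + 1), e₃ c * e₃ c' * pairWeight N a a' b b' c c' ≤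
    C * (4 ^ N / ((N : ℝ) + 1) ^ 2) * (F * G' * H' + F' * G * H' + F' * G' * H) := by
  obtain ⟨ρ, h0, h1, hρ⟩ : ∃ ρ : ℝ, 0 < ρ ∧ ρ < 1 ∧ ρ ^ 12 = 1 / 2 := by
    refine ⟨(1 / 2 : ℝ) ^ (1 / 12 : ℝ), by positivity,
      Real.rpow_lt_one (by norm_num) (by norm_num) (by norm_num), ?_⟩
    rw [← Real.rpow_natCast, ← Real.rpow_mul (by norm_num)]
    norm_num
  set κ : ℕ → ℝ := fun t => ρ ^ t * (1 + (t : ℝ)) ^ 2 with hκdef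
  have hκ0 : ∀ t, 0 ≤ κ t := fun t => by positivity
  have hnorm : ‖ρ‖ < 1 := by rw [Real.norm_eq_abs, abs_of_pos h0]; exact h1
  have hκ : Summable κ := by
    have s0 := summable_pow_mul_geometric_of_norm_lt_one 0 hnorm
    have s1 := summable_pow_mul_geometric_of_norm_lt_one 1 hnorm
    have s2 := summable_pow_mul_geometric_of_norm_lt_one 2 hnorm
    refine ((s0.add (s1.mul_left 2)).add s2).congr fun t => ?_
    simp only [hκdef]
    ring
  have hgeo : Summable fun t : ℕ => ρ ^ t := summable_geometric_of_lt_one h0.le h1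
  set γ := 2 * ∑' t : ℕ, ρ ^ t with hγ
  have hγ0 : 0 < γ := by
    have : 0 < ∑' t : ℕ, ρ ^ t := hgeo.tsum_pos (fun t => by positivity) 0 (by simp)
    positivity
  set τ := ∑' t, κ t with hτ
  have hτ0 : 0 < τ := hκ.tsum_pos hκ0 0 (by simp [hκdef])
  refine ⟨γ ^ 3 * (18 * τ), by positivity, ?_⟩
  intro N e₁ e₂ e₃ F G H F' G' H' he₁ he₂ he₃ hF0 hG0 hH0 hF hG hH hF' hG' hH'
  set I := range (N + 1) with hI
  have hdist : ∀ a : ℕ, ∑ b ∈ I, ρ ^ ((a - b) + (b - a)) ≤ γ := fun a =>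
    sum_dist_le_two_mul_tsum hgeo (fun t => by positivity) I a
  have hK := fun a a' b b' c c' => pairWeight_nonneg N a a' b b' c c'
  have hpeel : ∀ u v : ℕ → ℝ, (∀ r, 0 ≤ u r) → (∀ r, 0 ≤ v r) →
      ∑ b ∈ I, ∑ b' ∈ I, u b * (ρ ^ ((b - b') + (b' - b)) * v b) ≤ γ * ∑ b ∈ I, u b * v b := by
    intro u v hu hv
    rw [mul_sum]
    refine sum_le_sum fun b _ => ?_
    have h : ∑ b' ∈ I, u b * (ρ ^ ((b - b') + (b' - b)) * v b) =
        (∑ b' ∈ I, ρ ^ ((b - b') + (b' - b))) * (u b * v b) := by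
      rw [sum_mul]
      exact sum_congr rfl fun b' _ => by ring
    rw [h]
    exact mul_le_mul_of_nonneg_right (hdist b) (mul_nonneg (hu b) (hv b))
  set Y : ℕ → ℕ → ℝ := fun a b =>
    ∑ c ∈ I, e₃ c ^ 2 * ρ ^ ((N - (a + b + c)) + (a + b + c - N)) with hY
  have hY0 : ∀ a b, 0 ≤ Y a b := fun a b => sum_nonneg fun c _ => by positivity
  set Z : ℕ → ℝ := fun a => ∑ b ∈ I, e₂ b ^ 2 * Y a b with hZ
  have hZ0 : ∀ a, 0 ≤ Z a := fun a => sum_nonneg fun b _ => mul_nonneg (sq_nonneg _) (hY0 a b)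
  have hinner : ∀ a a' b b', ∑ c ∈ I, ∑ c' ∈ I, e₃ c * e₃ c' * pairWeight N a a' b b' c c' ≤
      4 ^ N * γ * ρ ^ ((a - a') + (a' - a)) * ρ ^ ((b - b') + (b' - b)) * Y a b := by
    intro a a' b b'
    refine (sum_sum_mul_mul_le I e₃ (fun c c' => pairWeight N a a' b b' c c')
      (fun c c' => hK _ _ _ _ _ _) (fun c c' => pairWeight_swap_thd _ _ _ _ _ _ _)).trans ?_
    set P := 4 ^ N * ρ ^ ((a - a') + (a' - a)) * ρ ^ ((b - b') + (b' - b)) with hP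
    have hP0 : 0 ≤ P := by positivity
    calc _ ≤ ∑ c ∈ I, ∑ c' ∈ I, e₃ c ^ 2 * (ρ ^ ((c - c') + (c' - c)) *
          (P * ρ ^ ((N - (a + b + c)) + (a + b + c - N)))) := by
          refine sum_le_sum fun c _ => sum_le_sum fun c' _ =>
            mul_le_mul_of_nonneg_left ?_ (sq_nonneg _)
          refine (pairWeight_le h0 h1.le hρ N a a' b b' c c').trans (le_of_eq ?_)
          rw [hP]; ring
      _ ≤ γ * ∑ c ∈ I, e₃ c ^ 2 * (P * ρ ^ ((N - (a + b + c)) + (a + b + c - N))) :=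
          hpeel (fun c => e₃ c ^ 2) (fun c => P * ρ ^ ((N - (a + b + c)) + (a + b + c - N)))
            (fun c => sq_nonneg _) (fun c => by positivity)
      _ = γ * (P * Y a b) := by
          rw [hY, mul_sum _ _ P]
          congr 1
          exact sum_congr rfl fun c _ => by ring
      _ = _ := by rw [hP]; ring
  have hmid : ∀ a a', ∑ b ∈ I, ∑ b' ∈ I, e₂ b * e₂ b' *
      ∑ c ∈ I, ∑ c' ∈ I, e₃ c * e₃ c' * pairWeight N a a' b b' c c' ≤
      4 ^ N * γ ^ 2 * ρ ^ ((a - a') + (a' - a)) * Z a := by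
    intro a a'
    have hin0 : ∀ b b', 0 ≤ ∑ c ∈ I, ∑ c' ∈ I, e₃ c * e₃ c' * pairWeight N a a' b b' c c' :=
      fun b b' => sum_nonneg fun c _ => sum_nonneg fun c' _ =>
        mul_nonneg (mul_nonneg (he₃ _) (he₃ _)) (hK _ _ _ _ _ _)
    refine (sum_sum_mul_mul_le I e₂ _ hin0 (fun b b' => sum_congr rfl fun c _ =>
      sum_congr rfl fun c' _ => by rw [pairWeight_swap_snd])).trans ?_
    set P := 4 ^ N * γ * ρ ^ ((a - a') + (a' - a)) with hP
    have hP0 : 0 ≤ P := by positivity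
    calc _ ≤ ∑ b ∈ I, ∑ b' ∈ I, e₂ b ^ 2 * (ρ ^ ((b - b') + (b' - b)) * (P * Y a b)) := by
          refine sum_le_sum fun b _ => sum_le_sum fun b' _ =>
            mul_le_mul_of_nonneg_left ?_ (sq_nonneg _)
          refine (hinner a a' b b').trans (le_of_eq ?_)
          rw [hP]; ring
      _ ≤ γ * ∑ b ∈ I, e₂ b ^ 2 * (P * Y a b) :=
          hpeel (fun b => e₂ b ^ 2) (fun b => P * Y a b)
            (fun b => sq_nonneg _) (fun b => mul_nonneg hP0 (hY0 a b))
      _ = γ * (P * Z a) := by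
          rw [hZ, mul_sum _ _ P]
          congr 1
          exact sum_congr rfl fun b _ => by ring
      _ = _ := by rw [hP]; ring
  have hmid0 : ∀ a a', 0 ≤ ∑ b ∈ I, ∑ b' ∈ I, e₂ b * e₂ b' *
      ∑ c ∈ I, ∑ c' ∈ I, e₃ c * e₃ c' * pairWeight N a a' b b' c c' := fun a a' =>
    sum_nonneg fun b _ => sum_nonneg fun b' _ => mul_nonneg (mul_nonneg (he₂ _) (he₂ _))
      (sum_nonneg fun c _ => sum_nonneg fun c' _ =>
        mul_nonneg (mul_nonneg (he₃ _) (he₃ _)) (hK _ _ _ _ _ _))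
  refine (sum_sum_mul_mul_le I e₁ _ hmid0 (fun a a' => sum_congr rfl fun b _ =>
    sum_congr rfl fun b' _ => by simp only [pairWeight_swap_fst N a a'])).trans ?_
  calc _ ≤ ∑ a ∈ I, ∑ a' ∈ I, e₁ a ^ 2 * (ρ ^ ((a - a') + (a' - a)) * (4 ^ N * γ ^ 2 * Z a)) := by
        refine sum_le_sum fun a _ => sum_le_sum fun a' _ =>
          mul_le_mul_of_nonneg_left ?_ (sq_nonneg _)
        refine (hmid a a').trans (le_of_eq ?_)
        ring
    _ ≤ γ * ∑ a ∈ I, e₁ a ^ 2 * (4 ^ N * γ ^ 2 * Z a) :=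
        hpeel (fun a => e₁ a ^ 2) (fun a => 4 ^ N * γ ^ 2 * Z a)
          (fun a => sq_nonneg _) (fun a => mul_nonneg (by positivity) (hZ0 a))
    _ = 4 ^ N * γ ^ 3 * ∑ a ∈ I, e₁ a ^ 2 * Z a := by
        rw [mul_sum, mul_sum]
        exact sum_congr rfl fun a _ => by ring
    _ ≤ 4 ^ N * γ ^ 3 * (18 * τ / ((N : ℝ) + 1) ^ 2 *
          (F * G' * H' + F' * G * H' + F' * G' * H)) := by
        refine mul_le_mul_of_nonneg_left ?_ (by positivity)
        exact sum_triple_le hκ hκ0 h0.le (fun t => rfl) N (fun r => e₁ r ^ 2)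
          (fun r => e₂ r ^ 2) (fun r => e₃ r ^ 2) (fun r => sq_nonneg _) (fun r => sq_nonneg _)
          (fun r => sq_nonneg _) F G H F' G' H' hF0 hG0 hH0 hF hG hH hF' hG' hH'
    _ = _ := by ring

theorem prod_eq_prod_inter_mul_prod_inter {M : Type*} [CommMonoid M] {S P Q : Finset ℕ}
    (hS : S ⊆ P ∪ Q) (hPQ : Disjoint P Q) (f : ℕ → M) :
    ∏ i ∈ S, f i = (∏ i ∈ S ∩ P, f i) * ∏ i ∈ S ∩ Q, f i := by
  rw [← prod_union (hPQ.mono inter_subset_right inter_subset_right), ← inter_union_distrib_left,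
    inter_eq_left.2 hS]

theorem card_eq_card_inter_add_card_inter {S P Q : Finset ℕ} (hS : S ⊆ P ∪ Q)
    (hPQ : Disjoint P Q) : S.card = (S ∩ P).card + (S ∩ Q).card := by
  rw [← card_union_of_disjoint (hPQ.mono inter_subset_right inter_subset_right),
    ← inter_union_distrib_left, inter_eq_left.2 hS]

theorem primeFactors_sqKernel_mul {a b : ℕ} (ha : Squarefree a) (hb : Squarefree b) :
    (sqKernel (a * b)).primeFactors = symmDiff a.primeFactors b.primeFactors := by
  unfold sqKernel
  rw [Nat.primeFactors_prod fun p hp => Nat.prime_of_mem_primeFactors (mem_filter.1 hp).1]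
  have hfac : ∀ {n : ℕ}, Squarefree n → ∀ p, n.factorization p = if p ∈ n.primeFactors then 1 else 0 := by
    intro n hn p
    split_ifs with h
    · exact le_antisymm (hn.natFactorization_le_one p)
        ((Nat.prime_of_mem_primeFactors h).factorization_pos_of_dvd hn.ne_zero
          (Nat.dvd_of_mem_primeFactors h))
    · rwa [← Nat.support_factorization, Finsupp.notMem_support_iff] at h
  ext p
  rw [mem_filter, Nat.primeFactors_mul ha.ne_zero hb.ne_zero, mem_union, mem_symmDiff,
    Nat.factorization_mul ha.ne_zero hb.ne_zero, Finsupp.add_apply, hfac ha, hfac hb]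
  by_cases h1 : p ∈ a.primeFactors <;> by_cases h2 : p ∈ b.primeFactors <;> simp [h1, h2]

/-- The squarefree integers in `[1, X]` with exactly `α` prime factors. -/
def squarefreeUpTo (α X : ℕ) : Finset ℕ :=
  (Icc 1 X).filter fun n => Squarefree n ∧ n.primeFactors.card = α

theorem mem_squarefreeUpTo {α X n : ℕ} : n ∈ squarefreeUpTo α X ↔
    (1 ≤ n ∧ n ≤ X) ∧ Squarefree n ∧ n.primeFactors.card = α := by
  simp [squarefreeUpTo]

/-- The sextuples `(u, z, v, w, g, h)` of squarefree integers, with `α`, `α`, `β`, `β`, `γ`, `γ`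
prime factors respectively, for which `u * v * g`, `w * z * g`, `u * w * h` and `v * z * h` are
all at most `X`. -/
def sextuples (α β γ X : ℕ) : Finset (ℕ × ℕ × ℕ × ℕ × ℕ × ℕ) :=
  (squarefreeUpTo α X ×ˢ squarefreeUpTo α X ×ˢ squarefreeUpTo β X ×ˢ squarefreeUpTo β X ×ˢ
    squarefreeUpTo γ X ×ˢ squarefreeUpTo γ X).filter fun t =>
      match t with
      | (u, z, v, w, g, h) =>
        u * v * g ≤ X ∧ w * z * g ≤ X ∧ u * w * h ≤ X ∧ v * z * h ≤ X

theorem mem_sextuples {α β γ X u z v w g h : ℕ} : (u, z, v, w, g, h) ∈ sextuples α β γ X ↔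
    (u ∈ squarefreeUpTo α X ∧ z ∈ squarefreeUpTo α X ∧ v ∈ squarefreeUpTo β X ∧
      w ∈ squarefreeUpTo β X ∧ g ∈ squarefreeUpTo γ X ∧ h ∈ squarefreeUpTo γ X) ∧
    u * v * g ≤ X ∧ w * z * g ≤ X ∧ u * w * h ≤ X ∧ v * z * h ≤ X := by
  simp [sextuples]

theorem exists_mem_sextuples {a b c d k W X : ℕ} (ha : a ∈ squarefreeUpTo k X)
    (hb : b ∈ squarefreeUpTo k X) (hc : c ∈ squarefreeUpTo k X) (hd : d ∈ squarefreeUpTo k X)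
    (hm : sqKernel (a * b) = sqKernel (c * d))
    (hW : (sqKernel (a * b)).primeFactors.card = 2 * W) :
    ∃ j ≤ W, ∃ u z v w g h, (u, z, v, w, g, h) ∈ sextuples j (W - j) (k - W) X ∧
      u * v * g = a ∧ w * z * g = b ∧ u * w * h = c ∧ v * z * h = d := by
  obtain ⟨⟨ha1, haX⟩, hasq, hak⟩ := mem_squarefreeUpTo.1 ha
  obtain ⟨⟨hb1, hbX⟩, hbsq, hbk⟩ := mem_squarefreeUpTo.1 hb
  obtain ⟨⟨hc1, hcX⟩, hcsq, hck⟩ := mem_squarefreeUpTo.1 hc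
  obtain ⟨⟨hd1, hdX⟩, hdsq, hdk⟩ := mem_squarefreeUpTo.1 hd
  have hsymm := congrArg Nat.primeFactors hm
  rw [primeFactors_sqKernel_mul hasq hbsq] at hsymm hW
  rw [primeFactors_sqKernel_mul hcsq hdsq] at hsymm
  have hea := Nat.prod_primeFactors_of_squarefree hasq
  have heb := Nat.prod_primeFactors_of_squarefree hbsq
  have hec := Nat.prod_primeFactors_of_squarefree hcsq
  have hed := Nat.prod_primeFactors_of_squarefree hdsq
  have hpa : ∀ p ∈ a.primeFactors, p.Prime := fun p => Nat.prime_of_mem_primeFactors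
  have hpb : ∀ p ∈ b.primeFactors, p.Prime := fun p => Nat.prime_of_mem_primeFactors
  have hpc : ∀ p ∈ c.primeFactors, p.Prime := fun p => Nat.prime_of_mem_primeFactors
  have hpd : ∀ p ∈ d.primeFactors, p.Prime := fun p => Nat.prime_of_mem_primeFactors
  set A := a.primeFactors
  set B := b.primeFactors
  set C := c.primeFactors
  set D := d.primeFactors
  have dAB : Disjoint (A \ B) (B \ A) := disjoint_sdiff_sdiff
  have dCD : Disjoint (C \ D) (D \ C) := disjoint_sdiff_sdiff
  have s1 : A \ B ⊆ (C \ D) ∪ (D \ C) := subset_union_left.trans hsymm.subset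
  have s2 : B \ A ⊆ (C \ D) ∪ (D \ C) := subset_union_right.trans hsymm.subset
  have s3 : C \ D ⊆ (A \ B) ∪ (B \ A) := subset_union_left.trans hsymm.symm.subset
  have s4 : D \ C ⊆ (A \ B) ∪ (B \ A) := subset_union_right.trans hsymm.symm.subset
  set U := (A \ B) ∩ (C \ D) with hU
  set V := (A \ B) ∩ (D \ C) with hV
  set T := (B \ A) ∩ (C \ D) with hT
  set Z := (B \ A) ∩ (D \ C) with hZ
  have p1 := prod_eq_prod_inter_mul_prod_inter s1 dCD (fun p => p)
  have p2 := prod_eq_prod_inter_mul_prod_inter s2 dCD (fun p => p)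
  have p3 := prod_eq_prod_inter_mul_prod_inter s3 dAB (fun p => p)
  have p4 := prod_eq_prod_inter_mul_prod_inter s4 dAB (fun p => p)
  have c1 := card_eq_card_inter_add_card_inter s1 dCD
  have c2 := card_eq_card_inter_add_card_inter s2 dCD
  have c3 := card_eq_card_inter_add_card_inter s3 dAB
  rw [inter_comm (C \ D), inter_comm (C \ D)] at p3 c3
  rw [inter_comm (D \ C), inter_comm (D \ C)] at p4
  rw [← hU, ← hV] at p1 c1
  rw [← hT, ← hZ] at p2 c2
  rw [← hU, ← hT] at p3 c3
  rw [← hV, ← hZ] at p4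
  have q1 := prod_inter_mul_prod_sdiff A B (fun p => p)
  have q2 := prod_inter_mul_prod_sdiff B A (fun p => p)
  have q3 := prod_inter_mul_prod_sdiff C D (fun p => p)
  have q4 := prod_inter_mul_prod_sdiff D C (fun p => p)
  rw [inter_comm B A] at q2
  rw [inter_comm D C] at q4
  have k1 := card_inter_add_card_sdiff A B
  have k2 := card_inter_add_card_sdiff B A
  have k3 := card_inter_add_card_sdiff C D
  have k4 := card_inter_add_card_sdiff D C
  rw [inter_comm B A] at k2
  rw [inter_comm D C] at k4
  have m1 : (A \ B).card + (B \ A).card = 2 * W := by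
    rw [← hW, ← card_union_of_disjoint dAB]; rfl
  have m2 : (C \ D).card + (D \ C).card = 2 * W := by
    rw [← hW, hsymm, ← card_union_of_disjoint dCD]; rfl
  have hprod_a : (∏ p ∈ U, p) * (∏ p ∈ V, p) * (∏ p ∈ A ∩ B, p) = a := by
    rw [← p1, mul_comm, q1, hea]
  have hprod_b : (∏ p ∈ T, p) * (∏ p ∈ Z, p) * (∏ p ∈ A ∩ B, p) = b := by
    rw [← p2, mul_comm, q2, heb]
  have hprod_c : (∏ p ∈ U, p) * (∏ p ∈ T, p) * (∏ p ∈ C ∩ D, p) = c := by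
    rw [← p3, mul_comm, q3, hec]
  have hprod_d : (∏ p ∈ V, p) * (∏ p ∈ Z, p) * (∏ p ∈ C ∩ D, p) = d := by
    rw [← p4, mul_comm, q4, hed]
  have hmem : ∀ (n α : ℕ) (S R : Finset ℕ), 1 ≤ n → n ≤ X → Squarefree n →
      (∀ p ∈ R, p.Prime) → S ⊆ R → ∏ p ∈ R, p = n → S.card = α →
      ∏ p ∈ S, p ∈ squarefreeUpTo α X := by
    intro n α S R hn1 hnX hnsq hpn hS hen hcard
    have hdvd : ∏ p ∈ S, p ∣ n := hen ▸ prod_dvd_prod_of_subset _ _ _ hS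
    refine mem_squarefreeUpTo.2 ⟨⟨Nat.pos_of_dvd_of_pos hdvd hn1,
      (Nat.le_of_dvd hn1 hdvd).trans hnX⟩, hnsq.squarefree_of_dvd hdvd, ?_⟩
    rw [Nat.primeFactors_prod fun p hp => hpn p (hS hp), hcard]
  refine ⟨U.card, by omega, ∏ p ∈ U, p, ∏ p ∈ Z, p, ∏ p ∈ V, p, ∏ p ∈ T, p, ∏ p ∈ A ∩ B, p,
    ∏ p ∈ C ∩ D, p, mem_sextuples.2 ⟨⟨?_, ?_, ?_, ?_, ?_, ?_⟩, ?_⟩,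
    hprod_a, hprod_b, hprod_c, hprod_d⟩
  · exact hmem a _ U A ha1 haX hasq hpa (inter_subset_left.trans sdiff_subset) hea rfl
  · exact hmem b _ Z B hb1 hbX hbsq hpb (inter_subset_left.trans sdiff_subset) heb (by omega)
  · exact hmem a _ V A ha1 haX hasq hpa (inter_subset_left.trans sdiff_subset) hea (by omega)
  · exact hmem b _ T B hb1 hbX hbsq hpb (inter_subset_left.trans sdiff_subset) heb (by omega)
  · exact hmem a _ (A ∩ B) A ha1 haX hasq hpa inter_subset_left hea (by omega)
  · exact hmem c _ (C ∩ D) C hc1 hcX hcsq hpc inter_subset_left hec (by omega)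
  · rw [hprod_a, hprod_b, hprod_c, hprod_d]
    exact ⟨haX, hbX, hcX, hdX⟩

theorem sum_card_mul_card_le_sum_card_sextuples (k W : ℕ) (x : ℝ) :
    ∑ p ∈ (Finset.Icc 1 ⌊x⌋₊).filter Nat.Prime,
      ∑ q ∈ (Finset.Icc 1 p).filter Nat.Prime,
        ∑ m ∈ (Finset.Icc 1 ⌊x ^ 2⌋₊).filter
            (fun m => Squarefree m ∧ m.primeFactors.card = 2 * W),
          ((Spkx p k x ×ˢ Spkx p k x).filter fun ab => sqKernel (ab.1 * ab.2) = m).card *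
          ((Spkx q k x ×ˢ Spkx q k x).filter fun cd => sqKernel (cd.1 * cd.2) = m).card ≤
    ∑ j ∈ range (W + 1), (sextuples j (W - j) (k - W) ⌊x⌋₊).card := by
  have hS : ∀ {p n : ℕ}, n ∈ Spkx p k x →
      n ∈ squarefreeUpTo k ⌊x⌋₊ ∧ n.primeFactors.sup id = p := by
    intro p n hn
    simp only [Spkx, mem_filter, mem_Icc] at hn
    exact ⟨mem_squarefreeUpTo.2 ⟨hn.1, hn.2.1, hn.2.2.1⟩, hn.2.2.2⟩
  simp only [← card_product]
  simp only [← card_sigma]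
  refine card_le_card_of_surjOn (fun t => match t with
    | ⟨_, u, z, v, w, g, h⟩ => ⟨(u * v * g).primeFactors.sup id, (u * w * h).primeFactors.sup id,
        sqKernel (u * v * g * (w * z * g)), (u * v * g, w * z * g), (u * w * h, v * z * h)⟩) ?_
  rintro ⟨p, q, m, ⟨a, b⟩, ⟨c, d⟩⟩ hx
  simp only [coe_sigma, Set.mem_sigma_iff, mem_coe, mem_product, mem_filter] at hx
  obtain ⟨-, -, ⟨-, -, hm⟩, ⟨⟨ha, hb⟩, hab⟩, ⟨hc, hd⟩, hcd⟩ := hx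
  obtain ⟨j, hj, u, z, v, w, g, h, hmem, rfl, rfl, rfl, rfl⟩ :=
    exists_mem_sextuples (hS ha).1 (hS hb).1 (hS hc).1 (hS hd).1 (hab.trans hcd.symm)
      (by rw [hab]; exact hm)
  refine ⟨⟨j, u, z, v, w, g, h⟩, ?_, ?_⟩
  · simp only [coe_sigma, Set.mem_sigma_iff, mem_coe, mem_range]
    exact ⟨by omega, hmem⟩
  · simp only [(hS ha).2, (hS hc).2, hab]

/-- The density of squarefree integers with `α` prime factors at the scale `2 ^ i`. -/
noncomputable def dyadicDensity (α i : ℕ) : ℝ := (dyadicSquarefree α i).card / 2 ^ i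

theorem dyadicDensity_nonneg (α i : ℕ) : 0 ≤ dyadicDensity α i := by
  unfold dyadicDensity; positivity

theorem mem_dyadicSquarefree_log {α X n : ℕ} (hn : n ∈ squarefreeUpTo α X) :
    n ∈ dyadicSquarefree α (Nat.log 2 n) := by
  obtain ⟨⟨h1, -⟩, h2⟩ := mem_squarefreeUpTo.1 hn
  exact mem_dyadicSquarefree.2 ⟨⟨Nat.pow_log_le_self 2 (by omega),
    Nat.lt_pow_succ_log_self (by norm_num) n⟩, h2⟩

theorem log_add_log_add_log_le {α β γ X N u v g : ℕ} (hX : X < 2 ^ (N + 1))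
    (hu : u ∈ squarefreeUpTo α X) (hv : v ∈ squarefreeUpTo β X) (hg : g ∈ squarefreeUpTo γ X)
    (h : u * v * g ≤ X) : Nat.log 2 u + Nat.log 2 v + Nat.log 2 g ≤ N := by
  have h1 := (mem_dyadicSquarefree.1 (mem_dyadicSquarefree_log hu)).1.1
  have h2 := (mem_dyadicSquarefree.1 (mem_dyadicSquarefree_log hv)).1.1
  have h3 := (mem_dyadicSquarefree.1 (mem_dyadicSquarefree_log hg)).1.1
  have h4 : 2 ^ (Nat.log 2 u + Nat.log 2 v + Nat.log 2 g) < 2 ^ (N + 1) := by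
    rw [pow_add, pow_add]
    exact (Nat.mul_le_mul (Nat.mul_le_mul h1 h2) h3).trans_lt (h.trans_lt hX)
  have := (Nat.pow_lt_pow_iff_right (by norm_num : 1 < 2)).1 h4
  omega

theorem card_sextuples_le {α β γ X N : ℕ} (hX : X < 2 ^ (N + 1)) :
    ((sextuples α β γ X).card : ℝ) ≤
    ∑ a ∈ range (N + 1), ∑ a' ∈ range (N + 1), dyadicDensity α a * dyadicDensity α a' *
      ∑ b ∈ range (N + 1), ∑ b' ∈ range (N + 1), dyadicDensity β b * dyadicDensity β b' *
        ∑ c ∈ range (N + 1), ∑ c' ∈ range (N + 1), dyadicDensity γ c * dyadicDensity γ c' *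
          pairWeight N a a' b b' c c' := by
  set I := range (N + 1) with hI
  set f : ℕ × ℕ × ℕ × ℕ × ℕ × ℕ → ℕ × ℕ × ℕ × ℕ × ℕ × ℕ := fun t =>
    (Nat.log 2 t.1, Nat.log 2 t.2.1, Nat.log 2 t.2.2.1, Nat.log 2 t.2.2.2.1,
      Nat.log 2 t.2.2.2.2.1, Nat.log 2 t.2.2.2.2.2) with hf
  have hlog : ∀ {u z v w g h : ℕ}, (u, z, v, w, g, h) ∈ sextuples α β γ X →
      (Nat.log 2 u + Nat.log 2 v + Nat.log 2 g ≤ N ∧ Nat.log 2 w + Nat.log 2 z + Nat.log 2 g ≤ N) ∧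
      (Nat.log 2 u + Nat.log 2 w + Nat.log 2 h ≤ N ∧ Nat.log 2 v + Nat.log 2 z + Nat.log 2 h ≤ N) := by
    intro u z v w g h ht
    obtain ⟨⟨hu, hz, hv, hw, hg, hh⟩, h1, h2, h3, h4⟩ := mem_sextuples.1 ht
    exact ⟨⟨log_add_log_add_log_le hX hu hv hg h1, log_add_log_add_log_le hX hw hz hg h2⟩,
      log_add_log_add_log_le hX hu hw hh h3, log_add_log_add_log_le hX hv hz hh h4⟩
  have hmaps : Set.MapsTo f (sextuples α β γ X) (I ×ˢ I ×ˢ I ×ˢ I ×ˢ I ×ˢ I : Finset _) := by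
    rintro ⟨u, z, v, w, g, h⟩ ht
    have := hlog (mem_coe.1 ht)
    simp only [hf, hI, mem_coe, mem_product, mem_range]
    omega
  rw [card_eq_sum_card_fiberwise hmaps]
  simp only [sum_product, mul_sum, Nat.cast_sum]
  refine sum_le_sum fun a _ => sum_le_sum fun a' _ => sum_le_sum fun b _ =>
    sum_le_sum fun b' _ => sum_le_sum fun c _ => sum_le_sum fun c' _ => ?_
  set Φ := (sextuples α β γ X).filter fun t => f t = (a, a', b, b', c, c') with hΦ
  have hsub : Φ ⊆ dyadicSquarefree α a ×ˢ dyadicSquarefree α a' ×ˢ dyadicSquarefree β b ×ˢ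
      dyadicSquarefree β b' ×ˢ dyadicSquarefree γ c ×ˢ dyadicSquarefree γ c' := by
    rintro ⟨u, z, v, w, g, h⟩ ht
    simp only [hΦ, hf, mem_filter, Prod.mk.injEq] at ht
    obtain ⟨ht, rfl, rfl, rfl, rfl, rfl, rfl⟩ := ht
    obtain ⟨⟨hu, hz, hv, hw, hg, hh⟩, -⟩ := mem_sextuples.1 ht
    simp only [mem_product]
    exact ⟨mem_dyadicSquarefree_log hu, mem_dyadicSquarefree_log hz, mem_dyadicSquarefree_log hv,
      mem_dyadicSquarefree_log hw, mem_dyadicSquarefree_log hg, mem_dyadicSquarefree_log hh⟩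
  rcases Φ.eq_empty_or_nonempty with he | ⟨⟨u, z, v, w, g, h⟩, ht⟩
  · rw [he, card_empty, Nat.cast_zero]
    have := pairWeight_nonneg N a a' b b' c c'
    have h1 := mul_nonneg (dyadicDensity_nonneg α a) (dyadicDensity_nonneg α a')
    have h2 := mul_nonneg (dyadicDensity_nonneg β b) (dyadicDensity_nonneg β b')
    have h3 := mul_nonneg (dyadicDensity_nonneg γ c) (dyadicDensity_nonneg γ c')
    positivity
  · simp only [hΦ, hf, mem_filter, Prod.mk.injEq] at ht
    obtain ⟨ht, rfl, rfl, rfl, rfl, rfl, rfl⟩ := ht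
    have hl := hlog ht
    have hcard : (Φ.card : ℝ) ≤ _ := Nat.cast_le.2 (card_le_card hsub)
    refine hcard.trans (le_of_eq ?_)
    rw [pairWeight, if_pos (by omega)]
    have h2 : ∀ n : ℕ, (2 : ℝ) ^ n ≠ 0 := fun n => by positivity
    simp only [card_product, dyadicDensity, pow_add, Nat.cast_mul]
    conv_lhs =>
      rw [← div_mul_cancel₀ ((dyadicSquarefree α (Nat.log 2 u)).card : ℝ) (h2 (Nat.log 2 u)),
        ← div_mul_cancel₀ ((dyadicSquarefree α (Nat.log 2 z)).card : ℝ) (h2 (Nat.log 2 z)),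
        ← div_mul_cancel₀ ((dyadicSquarefree β (Nat.log 2 v)).card : ℝ) (h2 (Nat.log 2 v)),
        ← div_mul_cancel₀ ((dyadicSquarefree β (Nat.log 2 w)).card : ℝ) (h2 (Nat.log 2 w)),
        ← div_mul_cancel₀ ((dyadicSquarefree γ (Nat.log 2 g)).card : ℝ) (h2 (Nat.log 2 g)),
        ← div_mul_cancel₀ ((dyadicSquarefree γ (Nat.log 2 h)).card : ℝ) (h2 (Nat.log 2 h))]
    ring

theorem card_sextuples_swap_le (α β γ X : ℕ) :
    (sextuples α β γ X).card ≤ (sextuples β α γ X).card := by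
  refine card_le_card_of_injOn (fun t => (t.2.2.1, t.2.2.2.1, t.1, t.2.1, t.2.2.2.2)) ?_ ?_
  · rintro ⟨u, z, v, w, g, h⟩ ht
    obtain ⟨⟨hu, hz, hv, hw, hg, hh⟩, h1, h2, h3, h4⟩ := mem_sextuples.1 (mem_coe.1 ht)
    refine mem_coe.2 (mem_sextuples.2 ⟨⟨hv, hw, hu, hz, hg, hh⟩, ?_, ?_, h4, ?_⟩)
    · rwa [mul_comm v u]
    · rwa [mul_comm z w]
    · rwa [mul_comm] at h3 ⊢
  · rintro ⟨u, z, v, w, g, h⟩ - ⟨u', z', v', w', g', h'⟩ - heq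
    simp only [Prod.mk.injEq] at heq ⊢
    tauto

theorem efact_nonneg (n : ℤ) : 0 ≤ efact n := by
  unfold efact
  split_ifs <;> positivity

theorem efact_natCast (n : ℕ) : efact n = n.factorial := by
  simp [efact]

theorem dyadicDensity_zero_sq_le (r : ℕ) : dyadicDensity 0 r ^ 2 ≤ if r = 0 then 1 else 0 := by
  have h1 : ∀ n ∈ dyadicSquarefree 0 r, n = 1 := by
    intro n hn
    obtain ⟨-, hsq, h0⟩ := mem_dyadicSquarefree.1 hn
    rw [← Nat.prod_primeFactors_of_squarefree hsq, card_eq_zero.1 h0, prod_empty]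
  split_ifs with hr
  · have h2 : (dyadicSquarefree 0 r).card ≤ 1 :=
      card_le_one.2 fun a ha b hb => (h1 a ha).trans (h1 b hb).symm
    have h3 : ((dyadicSquarefree 0 r).card : ℝ) ≤ 1 := by exact_mod_cast h2
    rw [dyadicDensity, hr, pow_zero, div_one]
    exact pow_le_one₀ (Nat.cast_nonneg _) (hr ▸ h3)
  · have h2 : dyadicSquarefree 0 r = ∅ := by
      refine eq_empty_of_forall_notMem fun n hn => ?_
      have h3 := (mem_dyadicSquarefree.1 hn).1.1
      rw [h1 n hn] at h3
      exact absurd h3 (not_le.2 (Nat.one_lt_two_pow hr))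
    rw [dyadicDensity, h2]
    simp

theorem dyadicDensity_succ_sq_le (α r : ℕ) : dyadicDensity (α + 1) r ^ 2 ≤
    64 / (α.factorial : ℝ) ^ 2 * ((Real.log (r + 1) + 6) ^ (2 * α) / ((r : ℝ) + 1) ^ 2) := by
  have h : dyadicDensity (α + 1) r ≤
      8 * (Real.log (r + 1) + 6) ^ α / (α.factorial * (r + 1)) := by
    rw [dyadicDensity, div_le_iff₀ (by positivity), mul_comm]
    exact card_dyadicSquarefree_succ_le α r
  refine (pow_le_pow_left₀ (dyadicDensity_nonneg _ _) h 2).trans (le_of_eq ?_)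
  rw [div_pow, mul_pow, mul_pow, ← pow_mul, mul_comm α 2, div_mul_div_comm]
  norm_num

theorem dyadicDensity_sq_le {α r N : ℕ} {L : ℝ} (hL : Real.log (N + 1) + 6 ≤ L) (hα : 1 ≤ α)
    (hr : r ≤ N) : dyadicDensity α r ^ 2 ≤
    64 * L ^ (2 * α - 2) / efact ((α : ℤ) - 1) ^ 2 * (1 / ((r : ℝ) + 1) ^ 2) := by
  obtain ⟨α, rfl⟩ := Nat.exists_eq_add_of_le' hα
  rw [show ((α + 1 : ℕ) : ℤ) - 1 = (α : ℕ) by push_cast; ring, efact_natCast,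
    show 2 * (α + 1) - 2 = 2 * α by omega]
  refine (dyadicDensity_succ_sq_le α r).trans ?_
  have hlog0 : 0 ≤ Real.log ((r : ℝ) + 1) := Real.log_nonneg (by linarith [r.cast_nonneg (α := ℝ)])
  have hlog : Real.log ((r : ℝ) + 1) + 6 ≤ L := by
    refine le_trans (add_le_add_left (Real.log_le_log (by positivity) ?_) 6) hL
    exact add_le_add_left (Nat.cast_le.2 hr) 1
  calc _ ≤ 64 / (α.factorial : ℝ) ^ 2 * (L ^ (2 * α) / ((r : ℝ) + 1) ^ 2) := by gcongr
    _ = _ := by ring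

theorem sum_dyadicDensity_sq_le (α R : ℕ) : ∑ r ∈ range R, dyadicDensity α r ^ 2 ≤
    256 * Real.exp 6 * (efact (2 * (α : ℤ) - 2) / efact ((α : ℤ) - 1) ^ 2) := by
  cases α with
  | zero =>
    have h : ∑ r ∈ range R, dyadicDensity 0 r ^ 2 ≤ 1 := by
      refine (sum_le_sum fun r _ => dyadicDensity_zero_sq_le r).trans ?_
      rw [sum_ite_eq']
      split_ifs <;> norm_num
    refine h.trans ?_
    have := Real.one_le_exp (by norm_num : (0 : ℝ) ≤ 6)
    simp only [efact]
    norm_num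
    linarith
  | succ α =>
    rw [show ((α + 1 : ℕ) : ℤ) - 1 = (α : ℕ) by push_cast; ring,
      show 2 * ((α + 1 : ℕ) : ℤ) - 2 = (2 * α : ℕ) by push_cast; ring, efact_natCast,
      efact_natCast]
    calc _ ≤ ∑ r ∈ range R, 64 / (α.factorial : ℝ) ^ 2 *
          ((Real.log (r + 1) + 6) ^ (2 * α) / ((r : ℝ) + 1) ^ 2) :=
          sum_le_sum fun r _ => dyadicDensity_succ_sq_le α r
      _ ≤ 64 / (α.factorial : ℝ) ^ 2 * (4 * Real.exp 6 * (2 * α).factorial) := by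
          rw [← mul_sum]
          exact mul_le_mul_of_nonneg_left (sum_log_pow_div_sq_le (by norm_num) _ _)
            (by positivity)
      _ = _ := by ring

theorem exists_card_sextuples_le : ∃ C > (0 : ℝ), ∀ (N X α β γ : ℕ) (L : ℝ), X < 2 ^ (N + 1) →
    Real.log (N + 1) + 6 ≤ L → 1 ≤ β → 1 ≤ γ →
    ((sextuples α β γ X).card : ℝ) ≤
      C * (4 ^ N / ((N : ℝ) + 1) ^ 2 / efact ((γ : ℤ) - 1) ^ 2) *
        (efact (2 * (α : ℤ) - 2) * efact (2 * (γ : ℤ) - 2) * L ^ (2 * β - 2) /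
            (efact ((β : ℤ) - 1) ^ 2 * efact ((α : ℤ) - 1) ^ 2) +
          efact (2 * (α : ℤ) - 2) * efact (2 * (β : ℤ) - 2) * L ^ (2 * γ - 2) /
            (efact ((β : ℤ) - 1) ^ 2 * efact ((α : ℤ) - 1) ^ 2) +
          if α = 0 then 0 else
            efact (2 * (β : ℤ) - 2) * efact (2 * (γ : ℤ) - 2) * L ^ (2 * α - 2) /
              (efact ((β : ℤ) - 1) ^ 2 * efact ((α : ℤ) - 1) ^ 2)) := by
  obtain ⟨C, hC, hmain⟩ := exists_sum_pairWeight_le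
  set c := 256 * Real.exp 6 with hc
  refine ⟨C * (64 * c ^ 2), by positivity, ?_⟩
  intro N X α β γ L hX hL hβ hγ
  have hlog : 0 ≤ Real.log ((N : ℝ) + 1) :=
    Real.log_nonneg (by linarith [N.cast_nonneg (α := ℝ)])
  have hL0 : 0 ≤ L := by linarith
  have hH : ∀ α : ℕ, 0 ≤ 64 * L ^ (2 * α - 2) / efact ((α : ℤ) - 1) ^ 2 := fun α => by positivity
  refine (card_sextuples_le hX).trans ((hmain N (dyadicDensity α) (dyadicDensity β)
    (dyadicDensity γ) (if α = 0 then 0 else 64 * L ^ (2 * α - 2) / efact ((α : ℤ) - 1) ^ 2)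
    _ _ _ _ _ (dyadicDensity_nonneg α) (dyadicDensity_nonneg β) (dyadicDensity_nonneg γ)
    ?_ (hH β) (hH γ) ?_ (fun r hr => dyadicDensity_sq_le hL hβ hr)
    (fun r hr => dyadicDensity_sq_le hL hγ hr) (sum_dyadicDensity_sq_le α _)
    (sum_dyadicDensity_sq_le β _) (sum_dyadicDensity_sq_le γ _)).trans (le_of_eq ?_))
  · split_ifs
    exacts [le_rfl, hH α]
  · intro r hr1 hrN
    split_ifs with hα
    · rw [hα, zero_mul]
      exact (dyadicDensity_zero_sq_le r).trans_eq (if_neg (by omega))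
    · exact dyadicDensity_sq_le hL (Nat.one_le_iff_ne_zero.2 hα) hrN
  · rw [← hc]
    split_ifs <;> ring

theorem log_natLog_floor_le {x : ℝ} (hx : 3 ≤ x) :
    Real.log ((Nat.log 2 ⌊x⌋₊ : ℝ) + 1) + 6 ≤ Real.log (Real.log x) + 7 := by
  have hlog1 : 1 ≤ Real.log x := by
    rw [Real.le_log_iff_exp_le (by linarith)]
    linarith [Real.exp_one_lt_d9]
  have hpow : (2 : ℝ) ^ Nat.log 2 ⌊x⌋₊ ≤ x := by
    have h : 2 ^ Nat.log 2 ⌊x⌋₊ ≤ ⌊x⌋₊ :=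
      Nat.pow_log_le_self 2 (Nat.floor_pos.2 (by linarith)).ne'
    calc (2 : ℝ) ^ Nat.log 2 ⌊x⌋₊ ≤ (⌊x⌋₊ : ℝ) := by exact_mod_cast h
      _ ≤ x := Nat.floor_le (by linarith)
  have h1 := Real.log_le_log (by positivity) hpow
  rw [Real.log_pow] at h1
  have h2 : (Nat.log 2 ⌊x⌋₊ : ℝ) + 1 ≤ Real.exp 1 * Real.log x := by
    nlinarith [Real.log_two_gt_d9, Real.exp_one_gt_d9, (Nat.log 2 ⌊x⌋₊).cast_nonneg (α := ℝ)]
  have h3 := Real.log_le_log (by positivity) h2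
  rw [Real.log_mul (Real.exp_ne_zero _) (by linarith), Real.log_exp] at h3
  linarith

theorem four_pow_natLog_floor_div_le {x : ℝ} (hx : 3 ≤ x) :
    4 ^ Nat.log 2 ⌊x⌋₊ / ((Nat.log 2 ⌊x⌋₊ : ℝ) + 1) ^ 2 ≤ x ^ 2 / Real.log x ^ 2 := by
  have hlog0 : 0 < Real.log x := Real.log_pos (by linarith)
  have hpow : (2 : ℝ) ^ Nat.log 2 ⌊x⌋₊ ≤ x := by
    have h : 2 ^ Nat.log 2 ⌊x⌋₊ ≤ ⌊x⌋₊ :=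
      Nat.pow_log_le_self 2 (Nat.floor_pos.2 (by linarith)).ne'
    calc (2 : ℝ) ^ Nat.log 2 ⌊x⌋₊ ≤ (⌊x⌋₊ : ℝ) := by exact_mod_cast h
      _ ≤ x := Nat.floor_le (by linarith)
  have hlt : x ≤ 2 ^ (Nat.log 2 ⌊x⌋₊ + 1) := by
    have h : ⌊x⌋₊ + 1 ≤ 2 ^ (Nat.log 2 ⌊x⌋₊ + 1) := Nat.lt_pow_succ_log_self (by norm_num) _
    calc x ≤ (⌊x⌋₊ : ℝ) + 1 := (Nat.lt_floor_add_one x).le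
      _ ≤ _ := by exact_mod_cast h
  have hlog : Real.log x ≤ (Nat.log 2 ⌊x⌋₊ : ℝ) + 1 := by
    have h := Real.log_le_log (by linarith) hlt
    rw [Real.log_pow] at h
    push_cast at h
    nlinarith [Real.log_two_lt_d9, (Nat.log 2 ⌊x⌋₊).cast_nonneg (α := ℝ)]
  have h4 : (4 : ℝ) ^ Nat.log 2 ⌊x⌋₊ = (2 ^ Nat.log 2 ⌊x⌋₊) ^ 2 := by
    rw [← pow_mul, mul_comm, pow_mul]; norm_num
  rw [h4]
  gcongr

theorem stmt_9 :
    ∃ B ≥ (0 : ℝ), ∃ K > (0 : ℝ), ∀ (k W : ℕ) (x : ℝ), 3 ≤ x → 2 ≤ k → 1 ≤ W → W + 1 ≤ k →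
      (∑ p ∈ (Finset.Icc 1 ⌊x⌋₊).filter Nat.Prime,
        ∑ q ∈ (Finset.Icc 1 p).filter Nat.Prime,
          ∑ m ∈ (Finset.Icc 1 ⌊x ^ 2⌋₊).filter
              (fun m => Squarefree m ∧ m.primeFactors.card = 2 * W),
            (((Spkx p k x ×ˢ Spkx p k x).filter
                fun ab => sqKernel (ab.1 * ab.2) = m).card : ℝ) *
            (((Spkx q k x ×ˢ Spkx q k x).filter
                fun cd => sqKernel (cd.1 * cd.2) = m).card : ℝ))
      ≤ K * (x ^ 2 / (Real.log x ^ 2 * efact ((k : ℤ) - W - 1) ^ 2)) *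
          ∑ j ∈ Finset.range W,
            (efact (2 * (j : ℤ) - 2) * efact (2 * (k : ℤ) - 2 * W - 2) *
                (Real.log (Real.log x) + B) ^ (2 * W - 2 * j - 2) /
              (efact ((W : ℤ) - j - 1) ^ 2 * efact ((j : ℤ) - 1) ^ 2) +
            efact (2 * (j : ℤ) - 2) * efact (2 * (W : ℤ) - 2 * j - 2) *
                (Real.log (Real.log x) + B) ^ (2 * k - 2 * W - 2) /
              (efact ((W : ℤ) - j - 1) ^ 2 * efact ((j : ℤ) - 1) ^ 2) +
            if j = 0 then 0 else
              efact (2 * (W : ℤ) - 2 * j - 2) * efact (2 * (k : ℤ) - 2 * W - 2) *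
                  (Real.log (Real.log x) + B) ^ (2 * j - 2) /
                (efact ((W : ℤ) - j - 1) ^ 2 * efact ((j : ℤ) - 1) ^ 2)) := by
  obtain ⟨C, hC, hcard⟩ := exists_card_sextuples_le
  refine ⟨7, by norm_num, 2 * C, by positivity, ?_⟩
  intro k W x hx hk hW hWk
  set N := Nat.log 2 ⌊x⌋₊ with hN
  set L := Real.log (Real.log x) + 7 with hLdef
  have hX : ⌊x⌋₊ < 2 ^ (N + 1) := Nat.lt_pow_succ_log_self (by norm_num) _
  have hL : Real.log ((N : ℝ) + 1) + 6 ≤ L := log_natLog_floor_le hx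
  have hlog : 0 ≤ Real.log ((N : ℝ) + 1) :=
    Real.log_nonneg (by linarith [N.cast_nonneg (α := ℝ)])
  have hL0 : 0 ≤ L := by linarith
  set D := x ^ 2 / (Real.log x ^ 2 * efact ((k : ℤ) - W - 1) ^ 2) with hD
  have hD0 : 0 ≤ D := by positivity
  set T : ℕ → ℝ := fun j =>
    efact (2 * (j : ℤ) - 2) * efact (2 * (k : ℤ) - 2 * W - 2) * L ^ (2 * W - 2 * j - 2) /
        (efact ((W : ℤ) - j - 1) ^ 2 * efact ((j : ℤ) - 1) ^ 2) +
      efact (2 * (j : ℤ) - 2) * efact (2 * (W : ℤ) - 2 * j - 2) * L ^ (2 * k - 2 * W - 2) /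
        (efact ((W : ℤ) - j - 1) ^ 2 * efact ((j : ℤ) - 1) ^ 2) +
      if j = 0 then 0 else
        efact (2 * (W : ℤ) - 2 * j - 2) * efact (2 * (k : ℤ) - 2 * W - 2) * L ^ (2 * j - 2) /
          (efact ((W : ℤ) - j - 1) ^ 2 * efact ((j : ℤ) - 1) ^ 2) with hT
  have hT0 : ∀ j, 0 ≤ T j := by
    intro j
    have h1 := efact_nonneg (2 * (j : ℤ) - 2)
    have h2 := efact_nonneg (2 * (k : ℤ) - 2 * W - 2)
    have h3 := efact_nonneg (2 * (W : ℤ) - 2 * j - 2)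
    simp only [hT]
    split_ifs <;> positivity
  have hterm : ∀ j, j < W → ((sextuples j (W - j) (k - W) ⌊x⌋₊).card : ℝ) ≤ C * D * T j := by
    intro j hj
    obtain ⟨β, rfl⟩ := Nat.exists_eq_add_of_le hj.le
    obtain ⟨γ, rfl⟩ := Nat.exists_eq_add_of_le (Nat.le_of_succ_le hWk)
    rw [Nat.add_sub_cancel_left, Nat.add_sub_cancel_left]
    have hDle : 4 ^ N / ((N : ℝ) + 1) ^ 2 / efact ((γ : ℤ) - 1) ^ 2 ≤ D := by
      rw [hD, ← div_div, show ((j + β + γ : ℕ) : ℤ) - (j + β : ℕ) - 1 = (γ : ℤ) - 1 by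
        push_cast; ring]
      exact div_le_div_of_nonneg_right (four_pow_natLog_floor_div_le hx) (sq_nonneg _)
    refine (hcard N ⌊x⌋₊ j β γ L hX hL (by omega) (by omega)).trans ?_
    have hTj := congrFun hT j
    beta_reduce at hTj
    rw [show 2 * ((j + β + γ : ℕ) : ℤ) - 2 * (j + β : ℕ) - 2 = 2 * (γ : ℤ) - 2 by push_cast; ring,
      show 2 * ((j + β : ℕ) : ℤ) - 2 * j - 2 = 2 * (β : ℤ) - 2 by push_cast; ring,
      show ((j + β : ℕ) : ℤ) - j - 1 = (β : ℤ) - 1 by push_cast; ring,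
      show 2 * (j + β + γ) - 2 * (j + β) - 2 = 2 * γ - 2 by omega,
      show 2 * (j + β) - 2 * j - 2 = 2 * β - 2 by omega] at hTj
    rw [← hTj]
    exact mul_le_mul_of_nonneg_right (mul_le_mul_of_nonneg_left hDle hC.le) (hT0 j)
  have hlast : ((sextuples W (W - W) (k - W) ⌊x⌋₊).card : ℝ) ≤ C * D * ∑ j ∈ range W, T j := by
    have h1 : ((sextuples W (W - W) (k - W) ⌊x⌋₊).card : ℝ) ≤ C * D * T 0 := by
      refine le_trans ?_ (hterm 0 hW)
      rw [Nat.sub_self, Nat.sub_zero]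
      exact Nat.cast_le.2 (card_sextuples_swap_le _ _ _ _)
    refine h1.trans (mul_le_mul_of_nonneg_left ?_ (by positivity))
    exact single_le_sum (fun j _ => hT0 j) (mem_range.2 hW)
  have hsum := Nat.cast_le (α := ℝ) |>.2 (sum_card_mul_card_le_sum_card_sextuples k W x)
  push_cast at hsum
  refine hsum.trans ?_
  rw [sum_range_succ]
  have hfirst : ∑ j ∈ range W, ((sextuples j (W - j) (k - W) ⌊x⌋₊).card : ℝ) ≤
      C * D * ∑ j ∈ range W, T j := by
    rw [mul_sum]
    exact sum_le_sum fun j hj => hterm j (mem_range.1 hj)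
  linarith
end

section
/- There is an absolute constant B ≥ 0 such that for every real C ≥ 0 there is a constant K = K(C) > 0 with the following property: for all integers a ≥ 1, n ≥ 0 and all reals m ≥ 2, Σ_{√m ≤ j ≤ m, ω(j) = a} (log log(m/j + 2) + C)^n / (j log²(m/j + 1)) ≤ K · n! · (log log m + B)^{a−1} / ((a−1)! · log m), where the sum is over integers j. -/
open Finset

/-- The positive integers up to `N` having exactly `b` distinct prime factors. -/
def omegaLevel (b N : ℕ) : Finset ℕ := (Ioc 0 N).filter fun j => j.primeFactors.card = b

/-- The prime powers up to `N`. -/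
def primePowersUpTo (N : ℕ) : Finset ℕ := by
  classical exact (Ioc 0 N).filter IsPrimePow

lemma mem_omegaLevel {b N j : ℕ} :
    j ∈ omegaLevel b N ↔ (0 < j ∧ j ≤ N) ∧ j.primeFactors.card = b := by
  simp [omegaLevel]

lemma mem_primePowersUpTo {N q : ℕ} :
    q ∈ primePowersUpTo N ↔ (0 < q ∧ q ≤ N) ∧ IsPrimePow q := by
  simp [primePowersUpTo]

lemma sum_log_primeFactors_le {n : ℕ} (hn : n ≠ 0) :
    ∑ p ∈ n.primeFactors, Real.log p ≤ Real.log n := by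
  rw [← Real.log_prod fun p hp => by
    exact_mod_cast (Nat.prime_of_mem_primeFactors hp).ne_zero]
  have h := Nat.le_of_dvd (Nat.pos_of_ne_zero hn) (Nat.prod_primeFactors_dvd n)
  apply Real.log_le_log
  · exact Finset.prod_pos fun p hp => by
      exact_mod_cast (Nat.prime_of_mem_primeFactors hp).pos
  · rw [← Nat.cast_prod]
    exact Nat.cast_le.2 h

lemma sum_log_mul_div_le (N : ℕ) :
    ∑ p ∈ (Ioc 0 N).filter Nat.Prime, Real.log p * ((N / p : ℕ) : ℝ) ≤ N * Real.log N := by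
  calc ∑ p ∈ (Ioc 0 N).filter Nat.Prime, Real.log p * ((N / p : ℕ) : ℝ)
      = ∑ p ∈ (Ioc 0 N).filter Nat.Prime, ∑ n ∈ Ioc 0 N, if p ∣ n then Real.log p else 0 := by
        refine Finset.sum_congr rfl fun p _ => ?_
        rw [← Finset.sum_filter, Finset.sum_const, Nat.Ioc_filter_dvd_card_eq_div, nsmul_eq_mul,
          mul_comm]
    _ = ∑ n ∈ Ioc 0 N, ∑ p ∈ (Ioc 0 N).filter Nat.Prime, if p ∣ n then Real.log p else 0 :=
        Finset.sum_comm
    _ = ∑ n ∈ Ioc 0 N, ∑ p ∈ n.primeFactors, Real.log p := by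
        refine Finset.sum_congr rfl fun n hn => ?_
        rw [← Finset.sum_filter]
        refine Finset.sum_congr ?_ fun _ _ => rfl
        ext p
        rw [Finset.mem_Ioc] at hn
        simp only [Finset.mem_filter, Finset.mem_Ioc, Nat.mem_primeFactors]
        constructor
        · rintro ⟨⟨_, hp⟩, hd⟩
          exact ⟨hp, hd, by omega⟩
        · rintro ⟨hp, hd, _⟩
          exact ⟨⟨⟨hp.pos, (Nat.le_of_dvd hn.1 hd).trans hn.2⟩, hp⟩, hd⟩
    _ ≤ ∑ n ∈ Ioc 0 N, Real.log N := by
        refine Finset.sum_le_sum fun n hn => ?_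
        rw [Finset.mem_Ioc] at hn
        refine (sum_log_primeFactors_le (by omega)).trans ?_
        exact Real.log_le_log (by exact_mod_cast hn.1) (by exact_mod_cast hn.2)
    _ = N * Real.log N := by simp

lemma sum_log_primes_le (N : ℕ) :
    ∑ p ∈ (Ioc 0 N).filter Nat.Prime, Real.log p ≤ Real.log 4 * N := by
  have h := Chebyshev.theta_le_log4_mul_x (x := (N : ℝ)) (by positivity)
  simpa [Chebyshev.theta] using h

/-- The upper bound in the first theorem of Mertens. -/
lemma sum_log_div_primes_le {N : ℕ} (hN : 0 < N) :
    ∑ p ∈ (Ioc 0 N).filter Nat.Prime, Real.log p / p ≤ Real.log N + Real.log 4 := by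
  have hN' : (0 : ℝ) < N := by exact_mod_cast hN
  have h1 : ∑ p ∈ (Ioc 0 N).filter Nat.Prime, Real.log p * ((N : ℝ) / p - 1) ≤
      N * Real.log N := by
    refine le_trans (Finset.sum_le_sum fun p hp => ?_) (sum_log_mul_div_le N)
    refine mul_le_mul_of_nonneg_left ?_ (Real.log_natCast_nonneg p)
    rw [← Nat.floor_div_eq_div (K := ℝ)]
    exact (Nat.sub_one_lt_floor _).le
  have h2 : ∑ p ∈ (Ioc 0 N).filter Nat.Prime, Real.log p * ((N : ℝ) / p - 1) =
      N * ∑ p ∈ (Ioc 0 N).filter Nat.Prime, Real.log p / p -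
        ∑ p ∈ (Ioc 0 N).filter Nat.Prime, Real.log p := by
    rw [Finset.mul_sum, ← Finset.sum_sub_distrib]
    exact Finset.sum_congr rfl fun p _ => by ring
  have h3 := sum_log_primes_le N
  have h4 : (N : ℝ) * ∑ p ∈ (Ioc 0 N).filter Nat.Prime, Real.log p / p ≤
      N * (Real.log N + Real.log 4) := by linarith
  exact le_of_mul_le_mul_left h4 hN'

lemma sum_inv_primes_le_abel {N : ℕ} (hN : 2 ≤ N) :
    ∑ p ∈ (Ioc 0 N).filter Nat.Prime, (1 : ℝ) / p ≤
      (∑ p ∈ (Ioc 0 N).filter Nat.Prime, Real.log p / p - Real.log 4) / Real.log N +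
        Real.log (Real.log N) + (Real.log 4 / Real.log 2 - Real.log (Real.log 2)) := by
  induction N, hN using Nat.le_induction with
  | base =>
    have h : (Ioc 0 2).filter Nat.Prime = {2} := by decide
    have h2 : Real.log 2 ≠ 0 := (Real.log_pos one_lt_two).ne'
    rw [h, Finset.sum_singleton, Finset.sum_singleton]
    push_cast
    field_simp
    linarith
  | succ N hN ih =>
    have hA := sum_log_div_primes_le (N := N) (by omega)
    have hL : 0 < Real.log N := Real.log_pos (by exact_mod_cast hN)
    have hL' : 0 < Real.log ((N + 1 : ℕ) : ℝ) := Real.log_pos (by exact_mod_cast (by omega))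
    have hLL : Real.log N ≤ Real.log ((N + 1 : ℕ) : ℝ) :=
      Real.log_le_log (by positivity) (by push_cast; linarith)
    have hlog := Real.one_sub_inv_le_log_of_pos (div_pos hL' hL)
    rw [Real.log_div hL'.ne' hL.ne', inv_div] at hlog
    have hins : Ioc 0 (N + 1) = insert (N + 1) (Ioc 0 N) := by
      ext x; simp only [Finset.mem_Ioc, Finset.mem_insert]; omega
    have hstep : (∑ p ∈ (Ioc 0 N).filter Nat.Prime, Real.log p / p - Real.log 4) / Real.log N +
        Real.log (Real.log N) ≤
        (∑ p ∈ (Ioc 0 N).filter Nat.Prime, Real.log p / p - Real.log 4) /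
          Real.log ((N + 1 : ℕ) : ℝ) + Real.log (Real.log ((N + 1 : ℕ) : ℝ)) := by
      generalize ∑ p ∈ (Ioc 0 N).filter Nat.Prime, Real.log p / p = A at *
      generalize Real.log ((N + 1 : ℕ) : ℝ) = L' at *
      generalize Real.log (N : ℝ) = L at *
      have : (A - Real.log 4) * (1 / L - 1 / L') ≤ L * (1 / L - 1 / L') :=
        mul_le_mul_of_nonneg_right (by linarith)
          (sub_nonneg.2 (one_div_le_one_div_of_le hL hLL))
      have e : L * (1 / L - 1 / L') = 1 - L / L' := by field_simp
      have e2 : (A - Real.log 4) * (1 / L - 1 / L') =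
        (A - Real.log 4) / L - (A - Real.log 4) / L' := by ring
      linarith
    rw [hins, Finset.filter_insert]
    split_ifs with hp
    · rw [Finset.sum_insert (by simp), Finset.sum_insert (by simp)]
      have e : (Real.log ((N + 1 : ℕ) : ℝ) / ((N + 1 : ℕ) : ℝ) +
          ∑ p ∈ (Ioc 0 N).filter Nat.Prime, Real.log p / p - Real.log 4) /
            Real.log ((N + 1 : ℕ) : ℝ) = 1 / ((N + 1 : ℕ) : ℝ) +
          (∑ p ∈ (Ioc 0 N).filter Nat.Prime, Real.log p / p - Real.log 4) /
            Real.log ((N + 1 : ℕ) : ℝ) := by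
        field_simp
        ring
      rw [e]
      linarith
    · linarith

/-- The upper bound in the second theorem of Mertens. -/
lemma sum_inv_primes_le {N : ℕ} (hN : 2 ≤ N) :
    ∑ p ∈ (Ioc 0 N).filter Nat.Prime, (1 : ℝ) / p ≤
      Real.log (Real.log N) + (1 + Real.log 4 / Real.log 2 - Real.log (Real.log 2)) := by
  have h1 := sum_inv_primes_le_abel hN
  have h2 := sum_log_div_primes_le (N := N) (by omega)
  have hL : 0 < Real.log N := Real.log_pos (by exact_mod_cast hN)
  have h3 : (∑ p ∈ (Ioc 0 N).filter Nat.Prime, Real.log p / p - Real.log 4) / Real.log N ≤ 1 := by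
    rw [div_le_one hL]; linarith
  linarith

lemma sum_inv_pow_le {p : ℕ} (hp : 2 ≤ p) (N : ℕ) :
    ∑ e ∈ Ico 2 N, (1 : ℝ) / (p : ℝ) ^ e ≤ 1 / ((p : ℝ) - 1) - 1 / p := by
  have hp' : (2 : ℝ) ≤ p := by exact_mod_cast hp
  have h1 : (p : ℝ)⁻¹ < 1 := inv_lt_one_of_one_lt₀ (by linarith)
  have h0 : (0 : ℝ) ≤ (p : ℝ)⁻¹ := by positivity
  have h := geom_sum_Ico_le_of_lt_one (m := 2) (n := N) h0 h1
  refine le_trans (le_of_eq ?_) (h.trans (le_of_eq ?_))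
  · exact Finset.sum_congr rfl fun e _ => by rw [inv_pow, one_div]
  · have : (p : ℝ) - 1 ≠ 0 := by linarith
    field_simp
    ring

lemma sum_inv_sub_inv_le (N : ℕ) :
    ∑ p ∈ Ico 2 (N + 2), (1 / ((p : ℝ) - 1) - 1 / p) ≤ 1 := by
  have h : ∑ p ∈ Ico 2 (N + 2), (1 / ((p : ℝ) - 1) - 1 / p) = 1 - 1 / ((N : ℝ) + 1) := by
    induction N with
    | zero => simp
    | succ N ih =>
      rw [Finset.sum_Ico_succ_top (by omega), ih]
      push_cast
      ring
  rw [h]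
  have : (0 : ℝ) ≤ 1 / ((N : ℝ) + 1) := by positivity
  linarith

lemma sum_inv_not_prime_primePowers_le (N : ℕ) :
    ∑ q ∈ (primePowersUpTo N).filter (fun q => ¬ q.Prime), (1 : ℝ) / q ≤ 1 := by
  have hsub : (primePowersUpTo N).filter (fun q => ¬ q.Prime) ⊆
      (Ico 2 (N + 2) ×ˢ Ico 2 (N + 2)).image fun x : ℕ × ℕ => x.1 ^ x.2 := by
    intro q hq
    simp only [Finset.mem_filter, mem_primePowersUpTo] at hq
    obtain ⟨⟨⟨_, hqN⟩, hpp⟩, hnp⟩ := hq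
    obtain ⟨p, k, hp, hk, rfl⟩ := (isPrimePow_nat_iff q).1 hpp
    have hk1 : k ≠ 1 := by rintro rfl; exact hnp (by simpa using hp)
    have h1 : p ≤ p ^ k := Nat.le_self_pow hk.ne' p
    have h2 : k < p ^ k := Nat.lt_pow_self hp.one_lt
    have := hp.two_le
    refine Finset.mem_image.2 ⟨(p, k), ?_, rfl⟩
    simp only [Finset.mem_product, Finset.mem_Ico]
    omega
  calc ∑ q ∈ (primePowersUpTo N).filter (fun q => ¬ q.Prime), (1 : ℝ) / q
      ≤ ∑ q ∈ (Ico 2 (N + 2) ×ˢ Ico 2 (N + 2)).image fun x : ℕ × ℕ => x.1 ^ x.2, (1 : ℝ) / q :=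
        Finset.sum_le_sum_of_subset_of_nonneg hsub fun _ _ _ => by positivity
    _ ≤ ∑ x ∈ Ico 2 (N + 2) ×ˢ Ico 2 (N + 2), (1 : ℝ) / ((x.1 ^ x.2 : ℕ) : ℝ) :=
        Finset.sum_image_le_of_nonneg (f := fun q : ℕ => (1 : ℝ) / q) fun _ _ => by positivity
    _ = ∑ p ∈ Ico 2 (N + 2), ∑ e ∈ Ico 2 (N + 2), (1 : ℝ) / (p : ℝ) ^ e := by
        rw [Finset.sum_product]; push_cast; rfl
    _ ≤ ∑ p ∈ Ico 2 (N + 2), (1 / ((p : ℝ) - 1) - 1 / p) :=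
        Finset.sum_le_sum fun p hp => sum_inv_pow_le (Finset.mem_Ico.1 hp).1 _
    _ ≤ 1 := sum_inv_sub_inv_le N

lemma filter_prime_primePowersUpTo (N : ℕ) :
    (primePowersUpTo N).filter Nat.Prime = (Ioc 0 N).filter Nat.Prime := by
  ext q
  simp only [Finset.mem_filter, mem_primePowersUpTo, Finset.mem_Ioc]
  exact ⟨fun h => ⟨h.1.1, h.2⟩, fun h => ⟨⟨h.1, h.2.isPrimePow⟩, h.2⟩⟩

lemma exists_sum_inv_primePowers_le :
    ∃ B ≥ (0 : ℝ), ∀ N : ℕ, 2 ≤ N →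
      ∑ q ∈ primePowersUpTo N, (1 : ℝ) / q ≤ Real.log (Real.log N) + B := by
  refine ⟨max 0 (2 + Real.log 4 / Real.log 2 - Real.log (Real.log 2)), le_max_left _ _,
    fun N hN => ?_⟩
  rw [← Finset.sum_filter_add_sum_filter_not _ Nat.Prime, filter_prime_primePowersUpTo]
  have h1 := sum_inv_primes_le hN
  have h2 := sum_inv_not_prime_primePowers_le N
  have h3 := le_max_right 0 (2 + Real.log 4 / Real.log 2 - Real.log (Real.log 2))
  linarith

lemma card_not_prime_primePowers_le {N : ℕ} (hN : 0 < N) :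
    (((primePowersUpTo N).filter (fun q => ¬ q.Prime)).card : ℝ) * Real.log 2 ≤
      2 * √N * Real.log N := by
  have h := Chebyshev.psi_sub_theta_le (x := (N : ℝ)) (by exact_mod_cast hN)
  rw [Chebyshev.psi_sub_theta_eq_sum_not_prime, Nat.floor_natCast] at h
  refine le_trans ?_ h
  rw [← nsmul_eq_mul, ← Finset.sum_const]
  refine le_trans (Finset.sum_le_sum (g := fun q => ArithmeticFunction.vonMangoldt q)
    fun q hq => ?_) (Finset.sum_le_sum_of_subset_of_nonneg (fun q hq => ?_)
      fun _ _ _ => ArithmeticFunction.vonMangoldt_nonneg)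
  · have hpp := (mem_primePowersUpTo.1 (Finset.mem_filter.1 hq).1).2
    rw [ArithmeticFunction.vonMangoldt_apply, if_pos hpp]
    refine Real.log_le_log two_pos ?_
    exact_mod_cast (Nat.minFac_prime hpp.ne_one).two_le
  · simp only [Finset.mem_filter, mem_primePowersUpTo, Finset.mem_Ioc] at hq ⊢
    exact ⟨hq.1.1, hq.2⟩

lemma log_sq_le {x : ℝ} (hx : 1 ≤ x) : Real.log x ^ 2 ≤ 16 * √x := by
  have h0 : 0 ≤ Real.log x := Real.log_nonneg hx
  have h1 : Real.log x = 4 * Real.log √√x := by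
    rw [Real.log_sqrt (Real.sqrt_nonneg x), Real.log_sqrt (by linarith)]; ring
  have h2 : Real.log √√x ≤ √√x := Real.log_le_self (Real.sqrt_nonneg _)
  have h3 : √√x ^ 2 = √x := Real.sq_sqrt (Real.sqrt_nonneg x)
  nlinarith [Real.sqrt_nonneg √x]

lemma sum_log_primePowers_le (N : ℕ) :
    ∑ q ∈ primePowersUpTo N, Real.log q ≤ (Real.log 4 + 32 / Real.log 2) * N := by
  rcases Nat.eq_zero_or_pos N with rfl | hN
  · simp [primePowersUpTo]
  have hN1 : (1 : ℝ) ≤ N := by exact_mod_cast hN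
  rw [← Finset.sum_filter_add_sum_filter_not _ Nat.Prime, filter_prime_primePowersUpTo]
  have h1 := sum_log_primes_le N
  have h2 : ∑ q ∈ (primePowersUpTo N).filter (fun q => ¬ q.Prime), Real.log q ≤
      ((primePowersUpTo N).filter (fun q => ¬ q.Prime)).card * Real.log N := by
    rw [← nsmul_eq_mul, ← Finset.sum_const]
    refine Finset.sum_le_sum fun q hq => ?_
    have h := (mem_primePowersUpTo.1 (Finset.mem_filter.1 hq).1).1
    exact Real.log_le_log (by exact_mod_cast h.1) (by exact_mod_cast h.2)
  have h3 := card_not_prime_primePowers_le hN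
  have hl2 : 0 < Real.log 2 := Real.log_pos one_lt_two
  have hL : 0 ≤ Real.log N := Real.log_nonneg hN1
  have h4 : (((primePowersUpTo N).filter (fun q => ¬ q.Prime)).card : ℝ) * Real.log N ≤
      32 / Real.log 2 * N := by
    rw [div_mul_eq_mul_div, le_div_iff₀ hl2]
    have h5 := mul_le_mul_of_nonneg_right h3 hL
    have h6 := mul_le_mul_of_nonneg_left (log_sq_le hN1) (Real.sqrt_nonneg (N : ℝ))
    have h7 : √(N : ℝ) * √N = N := Real.mul_self_sqrt (by positivity)
    nlinarith
  linarith

/-- Splitting off the full power of one prime turns a sum over integers with `b + 1` distinct prime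
factors into a sum over integers with `b` of them. -/
lemma sum_ordProj_ordCompl_le (F : ℕ → ℕ → ℝ) (hF : ∀ q i, 0 ≤ F q i) (b N : ℕ) :
    ∑ j ∈ omegaLevel (b + 1) N, ∑ p ∈ j.primeFactors, F (ordProj[p] j) (ordCompl[p] j) ≤
      ∑ i ∈ omegaLevel b N, ∑ q ∈ primePowersUpTo (N / i), F q i := by
  classical
  rw [Finset.sum_sigma', Finset.sum_sigma']
  set S := (omegaLevel (b + 1) N).sigma fun j => j.primeFactors with hS
  let g : (Σ _ : ℕ, ℕ) → (Σ _ : ℕ, ℕ) := fun x => ⟨ordCompl[x.2] x.1, ordProj[x.2] x.1⟩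
  have hinj : Set.InjOn g S := by
    rintro ⟨j, p⟩ hx ⟨j', p'⟩ hx' h
    simp only [hS, Finset.coe_sigma, Set.mem_sigma_iff, Finset.mem_coe, mem_omegaLevel] at hx hx'
    simp only [g, Sigma.mk.injEq, heq_eq_eq] at h
    have hj : j = j' := by
      rw [← Nat.ordProj_mul_ordCompl_eq_self j p, h.1, h.2, Nat.ordProj_mul_ordCompl_eq_self]
    subst hj
    have hp := Nat.prime_of_mem_primeFactors hx.2
    have hp' := Nat.prime_of_mem_primeFactors hx'.2
    have hd : p ∣ ordProj[p'] j :=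
      h.2 ▸ Nat.dvd_ordProj_of_dvd hx.1.1.1.ne' hp (Nat.dvd_of_mem_primeFactors hx.2)
    have := (Nat.prime_dvd_prime_iff_eq hp hp').1 (hp.dvd_of_dvd_pow hd)
    subst this
    rfl
  have himg : ∑ x ∈ S, F (ordProj[x.2] x.1) (ordCompl[x.2] x.1) =
      ∑ y ∈ S.image g, F y.2 y.1 := by
    rw [Finset.sum_image hinj]
  rw [himg]
  refine Finset.sum_le_sum_of_subset_of_nonneg ?_ fun _ _ _ => hF _ _
  intro y hy
  obtain ⟨⟨j, p⟩, hx, rfl⟩ := Finset.mem_image.1 hy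
  simp only [hS, Finset.mem_sigma, mem_omegaLevel] at hx
  obtain ⟨⟨⟨hj0, hjN⟩, hcard⟩, hpj⟩ := hx
  have hp := Nat.prime_of_mem_primeFactors hpj
  have hc0 : 0 < ordCompl[p] j := Nat.ordCompl_pos p hj0.ne'
  simp only [g, Finset.mem_sigma, mem_omegaLevel, mem_primePowersUpTo]
  refine ⟨⟨⟨hc0, (Nat.ordCompl_le j p).trans hjN⟩, ?_⟩, ⟨Nat.ordProj_pos j p, ?_⟩, ?_⟩
  · rw [← Nat.support_factorization, Nat.factorization_ordCompl, Finsupp.support_erase,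
      Nat.support_factorization, Finset.card_erase_of_mem hpj, hcard]
    rfl
  · rw [Nat.le_div_iff_mul_le hc0, Nat.ordProj_mul_ordCompl_eq_self]
    exact hjN
  · exact hp.isPrimePow.pow (hp.factorization_pos_of_dvd hj0.ne'
      (Nat.dvd_of_mem_primeFactors hpj)).ne'

lemma sum_inv_omegaLevel_le (b N : ℕ) :
    ∑ i ∈ omegaLevel b N, (1 : ℝ) / i ≤
      (∑ q ∈ primePowersUpTo N, (1 : ℝ) / q) ^ b / b.factorial := by
  induction b with
  | zero =>
    have hsub : omegaLevel 0 N ⊆ {1} := by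
      intro i hi
      rw [mem_omegaLevel, Finset.card_eq_zero, Nat.primeFactors_eq_empty] at hi
      rw [Finset.mem_singleton]
      omega
    refine (Finset.sum_le_sum_of_subset_of_nonneg hsub fun _ _ _ => by positivity).trans ?_
    simp
  | succ b ih =>
    set S := ∑ q ∈ primePowersUpTo N, (1 : ℝ) / q with hS
    have hS0 : 0 ≤ S := Finset.sum_nonneg fun _ _ => by positivity
    have h1 := sum_ordProj_ordCompl_le (fun q i => 1 / ((q : ℝ) * i))
      (fun _ _ => by positivity) b N
    have h2 : ∑ j ∈ omegaLevel (b + 1) N, ∑ p ∈ j.primeFactors,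
        1 / (((ordProj[p] j : ℕ) : ℝ) * (ordCompl[p] j : ℕ)) =
        (b + 1) * ∑ j ∈ omegaLevel (b + 1) N, (1 : ℝ) / j := by
      rw [Finset.mul_sum]
      refine Finset.sum_congr rfl fun j hj => ?_
      rw [Finset.sum_congr rfl (g := fun _ => (1 : ℝ) / j) fun p _ => by
        rw [← Nat.cast_mul, Nat.ordProj_mul_ordCompl_eq_self]]
      rw [Finset.sum_const, (mem_omegaLevel.1 hj).2, nsmul_eq_mul]
      push_cast
      ring
    have h3 : ∑ i ∈ omegaLevel b N, ∑ q ∈ primePowersUpTo (N / i), 1 / ((q : ℝ) * i) ≤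
        S * ∑ i ∈ omegaLevel b N, (1 : ℝ) / i := by
      rw [Finset.mul_sum]
      refine Finset.sum_le_sum fun i _ => ?_
      rw [hS, Finset.sum_mul]
      refine (Finset.sum_le_sum_of_subset_of_nonneg (t := primePowersUpTo N) ?_
        fun _ _ _ => by positivity).trans (le_of_eq (Finset.sum_congr rfl fun q _ => by ring))
      intro q hq
      rw [mem_primePowersUpTo] at hq ⊢
      exact ⟨⟨hq.1.1, hq.1.2.trans (Nat.div_le_self _ _)⟩, hq.2⟩
    have h4 := mul_le_mul_of_nonneg_left ih hS0
    have h5 : ((b : ℝ) + 1) * ∑ j ∈ omegaLevel (b + 1) N, (1 : ℝ) / j ≤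
        S * (S ^ b / b.factorial) := by
      rw [← h2]; exact (h1.trans h3).trans h4
    have hb : (0 : ℝ) < b + 1 := by positivity
    rw [Nat.factorial_succ, pow_succ, Nat.cast_mul, Nat.cast_succ, ← div_div,
      div_right_comm, le_div_iff₀' hb]
    exact h5.trans (le_of_eq (by ring))

lemma log_eq_sum_log_ordProj {j : ℕ} (hj : j ≠ 0) :
    Real.log j = ∑ p ∈ j.primeFactors, Real.log (ordProj[p] j : ℕ) := by
  rw [← Real.log_prod fun p _ => by exact_mod_cast (Nat.ordProj_pos j p).ne', ← Nat.cast_prod,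
    ← Nat.prod_factorization_eq_prod_primeFactors (fun p k => p ^ k),
    Nat.prod_factorization_pow_eq_self hj]

lemma exists_sum_log_omegaLevel_le :
    ∃ c > (0 : ℝ), ∀ b N : ℕ, ∑ j ∈ omegaLevel (b + 1) N, Real.log j ≤
      c * N * ((∑ q ∈ primePowersUpTo N, (1 : ℝ) / q) ^ b / b.factorial) := by
  have hc : 0 < Real.log 4 + 32 / Real.log 2 :=
    add_pos (Real.log_pos (by norm_num)) (div_pos (by norm_num) (Real.log_pos one_lt_two))
  refine ⟨Real.log 4 + 32 / Real.log 2, hc, fun b N => ?_⟩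
  have h1 := sum_ordProj_ordCompl_le (fun q _ => Real.log q)
    (fun q _ => Real.log_natCast_nonneg q) b N
  rw [Finset.sum_congr rfl fun j hj =>
    log_eq_sum_log_ordProj (mem_omegaLevel.1 hj).1.1.ne']
  refine h1.trans ?_
  calc ∑ i ∈ omegaLevel b N, ∑ q ∈ primePowersUpTo (N / i), Real.log q
      ≤ ∑ i ∈ omegaLevel b N, (Real.log 4 + 32 / Real.log 2) * N * (1 / i) := by
        refine Finset.sum_le_sum fun i _ => (sum_log_primePowers_le _).trans ?_
        rw [mul_assoc, mul_one_div]
        exact mul_le_mul_of_nonneg_left Nat.cast_div_le hc.le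
    _ = (Real.log 4 + 32 / Real.log 2) * N * ∑ i ∈ omegaLevel b N, (1 : ℝ) / i := by
        rw [Finset.mul_sum]
    _ ≤ _ := mul_le_mul_of_nonneg_left (sum_inv_omegaLevel_le b N) (by positivity)

/-- A Hardy-Ramanujan type bound for integers that are not too small. -/
lemma exists_card_omegaLevel_le :
    ∃ B ≥ (0 : ℝ), ∃ c > (0 : ℝ), ∀ (b : ℕ) (m X : ℝ), 2 ≤ m → 0 ≤ X → X ≤ m →
      (((omegaLevel (b + 1) ⌊X⌋₊).filter fun j : ℕ => √m ≤ (j : ℝ)).card : ℝ) ≤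
        c * X / Real.log m * ((Real.log (Real.log m) + B) ^ b / b.factorial) := by
  obtain ⟨B, hB, hS⟩ := exists_sum_inv_primePowers_le
  obtain ⟨c, hc, hlog⟩ := exists_sum_log_omegaLevel_le
  refine ⟨B, hB, 2 * c, by positivity, fun b m X hm hX hXm => ?_⟩
  have hL : 0 < Real.log m := Real.log_pos (by linarith)
  have hm2 : 2 ≤ ⌊m⌋₊ := Nat.le_floor (by exact_mod_cast hm)
  set S := ∑ q ∈ primePowersUpTo ⌊X⌋₊, (1 : ℝ) / q with hSdef
  have hS0 : 0 ≤ S := Finset.sum_nonneg fun _ _ => by positivity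
  have hSm : S ≤ Real.log (Real.log m) + B := by
    have h1 : S ≤ ∑ q ∈ primePowersUpTo ⌊m⌋₊, (1 : ℝ) / q := by
      refine Finset.sum_le_sum_of_subset_of_nonneg (fun q hq => ?_) fun _ _ _ => by positivity
      rw [mem_primePowersUpTo] at hq ⊢
      exact ⟨⟨hq.1.1, hq.1.2.trans (Nat.floor_mono hXm)⟩, hq.2⟩
    have h2 : Real.log (Real.log (⌊m⌋₊ : ℝ)) ≤ Real.log (Real.log m) := by
      have h3 : (1 : ℝ) < ⌊m⌋₊ := by exact_mod_cast hm2
      exact Real.log_le_log (Real.log_pos h3)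
        (Real.log_le_log (by linarith) (Nat.floor_le (by linarith)))
    linarith [hS _ hm2]
  have hcard : (((omegaLevel (b + 1) ⌊X⌋₊).filter fun j : ℕ => √m ≤ (j : ℝ)).card : ℝ) *
      (Real.log m / 2) ≤ ∑ j ∈ omegaLevel (b + 1) ⌊X⌋₊, Real.log j := by
    rw [← nsmul_eq_mul, ← Finset.sum_const]
    refine (Finset.sum_le_sum (g := fun j : ℕ => Real.log j) fun j hj => ?_).trans
      (Finset.sum_le_sum_of_subset_of_nonneg (Finset.filter_subset _ _)
        fun j _ _ => Real.log_natCast_nonneg j)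
    rw [← Real.log_sqrt (by linarith)]
    exact Real.log_le_log (Real.sqrt_pos.2 (by linarith)) (Finset.mem_filter.1 hj).2
  have hpow : S ^ b / b.factorial ≤ (Real.log (Real.log m) + B) ^ b / b.factorial := by gcongr
  have h1 : c * (⌊X⌋₊ : ℝ) * (S ^ b / b.factorial) ≤
      c * X * ((Real.log (Real.log m) + B) ^ b / b.factorial) := by
    have := Nat.floor_le hX
    gcongr
  have h2 := (hcard.trans (hlog b _)).trans h1
  rw [← le_div_iff₀ (by positivity)] at h2
  refine h2.trans (le_of_eq ?_)
  field_simp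

/-- The iterated integral-by-parts antiderivative of `-(log x + C) ^ n / x ^ 2`. -/
noncomputable def logPowTail (C : ℝ) : ℕ → ℝ → ℝ
  | 0, x => 1 / x
  | n + 1, x => (Real.log x + C) ^ (n + 1) / x + (n + 1) * logPowTail C n x

lemma hasDerivAt_logPowTail (C : ℝ) (n : ℕ) {x : ℝ} (hx : x ≠ 0) :
    HasDerivAt (logPowTail C n) (-((Real.log x + C) ^ n / x ^ 2)) x := by
  induction n with
  | zero =>
    have e : logPowTail C 0 = fun y => y⁻¹ := funext one_div
    rw [e, pow_zero, one_div]
    exact hasDerivAt_inv hx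
  | succ n ih =>
    have h1 := (((Real.hasDerivAt_log hx).add_const C).pow (n + 1)).div (hasDerivAt_id x) hx
    have h2 := h1.add (ih.const_mul ((n : ℝ) + 1))
    refine HasDerivAt.congr_deriv (f := logPowTail C (n + 1)) h2 ?_
    simp only [id, Nat.add_sub_cancel, Pi.pow_apply]
    push_cast
    field_simp
    ring

lemma logPowTail_eq (C : ℝ) (n : ℕ) (x : ℝ) :
    logPowTail C n x =
      n.factorial * (∑ i ∈ range (n + 1), (Real.log x + C) ^ i / i.factorial) / x := by
  induction n with
  | zero => simp [logPowTail]
  | succ n ih =>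
    rw [logPowTail, ih, Finset.sum_range_succ _ (n + 1), Nat.factorial_succ]
    have : (n.factorial : ℝ) ≠ 0 := by positivity
    have : ((n : ℝ) + 1) ≠ 0 := by positivity
    push_cast
    field_simp
    ring

lemma logPowTail_nonneg {C : ℝ} (hC : 0 ≤ C) (n : ℕ) {x : ℝ} (hx : 1 ≤ x) :
    0 ≤ logPowTail C n x := by
  have := Real.log_nonneg hx
  rw [logPowTail_eq]
  positivity

lemma logPowTail_le {C : ℝ} (hC : 0 ≤ C) (n : ℕ) {x : ℝ} (hx : 1 ≤ x) :
    logPowTail C n x ≤ n.factorial * Real.exp C := by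
  have hl := Real.log_nonneg hx
  have hx0 : 0 < x := by linarith
  rw [logPowTail_eq, div_le_iff₀ hx0, mul_assoc]
  refine mul_le_mul_of_nonneg_left ?_ (by positivity)
  refine (Real.sum_le_exp_of_nonneg (add_nonneg hl hC) _).trans ?_
  rw [Real.exp_add, Real.exp_log hx0, mul_comm]

lemma log_add_pow_div_sq_le {C : ℝ} (hC : 0 ≤ C) (n k : ℕ) :
    (Real.log (k + 2) + C) ^ n / ((k : ℝ) + 1) ^ 2 ≤
      9 * (logPowTail C n (k + 2) - logPowTail C n (k + 1 + 2)) := by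
  have hk : (0 : ℝ) ≤ k := Nat.cast_nonneg k
  have hd : ∀ x : ℝ, (k : ℝ) + 2 ≤ x →
      HasDerivAt (logPowTail C n) (-((Real.log x + C) ^ n / x ^ 2)) x :=
    fun x hx => hasDerivAt_logPowTail C n (by linarith)
  obtain ⟨ξ, hξ, h⟩ := exists_hasDerivAt_eq_slope (logPowTail C n) _
    (show (k : ℝ) + 2 < k + 1 + 2 by linarith)
    (fun x hx => (hd x hx.1).continuousAt.continuousWithinAt) fun x hx => hd x hx.1.le
  have e : (k : ℝ) + 1 + 2 - (k + 2) = 1 := by ring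
  rw [e, div_one] at h
  have h2 : logPowTail C n (k + 2) - logPowTail C n (k + 1 + 2) = (Real.log ξ + C) ^ n / ξ ^ 2 := by
    linarith
  rw [h2]
  have hl : 0 ≤ Real.log ((k : ℝ) + 2) := Real.log_nonneg (by linarith)
  have hξ0 : 0 < ξ := by linarith [hξ.1]
  have h3 : (Real.log (k + 2) + C) ^ n ≤ (Real.log ξ + C) ^ n := by
    have := Real.log_le_log (by linarith) hξ.1.le
    gcongr
  have h4 : ξ ^ 2 ≤ 9 * ((k : ℝ) + 1) ^ 2 := by nlinarith [hξ.2]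
  have h0 : 0 ≤ (Real.log ((k : ℝ) + 2) + C) ^ n := by positivity
  rw [← mul_div_assoc, div_le_div_iff₀ (by positivity) (by positivity)]
  calc _ ≤ (Real.log ξ + C) ^ n * (9 * ((k : ℝ) + 1) ^ 2) :=
        mul_le_mul h3 h4 (by positivity) (h0.trans h3)
    _ = _ := by ring

lemma sum_log_add_pow_div_sq_le {C : ℝ} (hC : 0 ≤ C) (n M : ℕ) :
    ∑ k ∈ range M, (Real.log (k + 2) + C) ^ n / ((k : ℝ) + 1) ^ 2 ≤
      9 * (n.factorial * Real.exp C) := by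
  have h := Finset.sum_le_sum fun k (_ : k ∈ range M) => log_add_pow_div_sq_le hC n k
  rw [← Finset.mul_sum] at h
  have ht := Finset.sum_range_sub' (fun k : ℕ => logPowTail C n ((k : ℝ) + 2)) M
  push_cast at ht
  rw [ht] at h
  have h1 := logPowTail_nonneg hC n (x := (M : ℝ) + 2) (by linarith [Nat.cast_nonneg (α := ℝ) M])
  have h2 := logPowTail_le hC n (x := (0 : ℝ) + 2) (by norm_num)
  refine h.trans ?_
  linarith

lemma dyadic_weight_le {C : ℝ} (hC : 0 ≤ C) (n k : ℕ) {m j : ℝ} (hj : 0 < j)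
    (h1 : 2 ^ k * j ≤ m) (h2 : m ≤ 2 ^ (k + 1) * j) :
    (Real.log (Real.log (m / j + 2)) + C) ^ n / (j * Real.log (m / j + 1) ^ 2) ≤
      2 ^ k / m * (8 / Real.log 2 ^ 2 * ((Real.log (k + 2) + C) ^ n / ((k : ℝ) + 1) ^ 2)) := by
  have hk : (0 : ℝ) ≤ k := Nat.cast_nonneg k
  have hl2 : 0 < Real.log 2 := Real.log_pos one_lt_two
  have hl2' : Real.log 2 ≤ 1 := by linarith [Real.log_le_sub_one_of_pos two_pos]
  have hpow : (1 : ℝ) ≤ 2 ^ k := one_le_pow₀ one_le_two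
  have hm : 0 < m := lt_of_lt_of_le (by positivity) h1
  have hr1 : 2 ^ k ≤ m / j := by rwa [le_div_iff₀ hj]
  have hr2 : m / j ≤ 2 ^ (k + 1) := by rwa [div_le_iff₀ hj]
  have hlog1 : (k + 1) / 2 * Real.log 2 ≤ Real.log (m / j + 1) := by
    have ha : Real.log 2 ≤ Real.log (m / j + 1) := Real.log_le_log two_pos (by linarith)
    have hb : k * Real.log 2 ≤ Real.log (m / j + 1) := by
      rw [← Real.log_pow]
      exact Real.log_le_log (by positivity) (by linarith)
    linarith
  have hlog3 : 1 ≤ Real.log (m / j + 2) := by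
    rw [Real.le_log_iff_exp_le (by linarith)]
    linarith [Real.exp_one_lt_three]
  have hlog2 : Real.log (m / j + 2) ≤ k + 2 := by
    have ha : Real.log (m / j + 2) ≤ Real.log (2 ^ (k + 2)) := by
      refine Real.log_le_log (by linarith) ?_
      have : (2 : ℝ) ^ (k + 1) = 2 * 2 ^ k := by ring
      have : (2 : ℝ) ^ (k + 2) = 4 * 2 ^ k := by ring
      linarith
    rw [Real.log_pow] at ha
    push_cast at ha
    nlinarith
  have hll0 : 0 ≤ Real.log (Real.log (m / j + 2)) := Real.log_nonneg hlog3
  have hll : Real.log (Real.log (m / j + 2)) ≤ Real.log (k + 2) :=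
    Real.log_le_log (by linarith) hlog2
  calc (Real.log (Real.log (m / j + 2)) + C) ^ n / (j * Real.log (m / j + 1) ^ 2)
      ≤ (Real.log (k + 2) + C) ^ n / (m / 2 ^ (k + 1) * ((k + 1) / 2 * Real.log 2) ^ 2) := by
        have : m / 2 ^ (k + 1) ≤ j := by
          rw [div_le_iff₀ (by positivity)]; linarith
        have : 0 ≤ Real.log ((k : ℝ) + 2) := Real.log_nonneg (by linarith)
        gcongr
    _ = _ := by
        field_simp
        ring

theorem stmt_10 :
    ∃ B ≥ (0 : ℝ), ∀ C : ℝ, 0 ≤ C → ∃ K > (0 : ℝ),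
      ∀ (a n : ℕ), 1 ≤ a → ∀ m : ℝ, 2 ≤ m →
        (∑ j ∈ (Finset.Icc 1 ⌊m⌋₊).filter
            (fun j : ℕ => Real.sqrt m ≤ (j : ℝ) ∧ j.primeFactors.card = a),
          (Real.log (Real.log (m / j + 2)) + C) ^ n /
            ((j : ℝ) * Real.log (m / j + 1) ^ 2))
        ≤ K * (n.factorial : ℝ) * (Real.log (Real.log m) + B) ^ (a - 1) /
            (((a - 1).factorial : ℝ) * Real.log m) := by
  obtain ⟨B, hB, c, hc, hcard⟩ := exists_card_omegaLevel_le
  refine ⟨B, hB, fun C hC => ?_⟩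
  have hl2 : 0 < Real.log 2 := Real.log_pos one_lt_two
  refine ⟨c * (8 / Real.log 2 ^ 2) * (9 * Real.exp C), by positivity, ?_⟩
  intro a n ha m hm
  obtain ⟨b, rfl⟩ := Nat.exists_eq_add_of_le' ha
  rw [Nat.add_sub_cancel]
  have hL : 0 < Real.log m := Real.log_pos (by linarith)
  have hm0 : 0 < m := by linarith
  set H := (Real.log (Real.log m) + B) ^ b / b.factorial with hH
  set s := (Finset.Icc 1 ⌊m⌋₊).filter
    (fun j : ℕ => Real.sqrt m ≤ (j : ℝ) ∧ j.primeFactors.card = b + 1) with hs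
  have hH0 : 0 ≤ H := by
    have h := hcard b m m hm hm0.le le_rfl
    have h' := (Nat.cast_nonneg _).trans h
    exact nonneg_of_mul_nonneg_right h' (by positivity)
  have hmaps : ∀ j ∈ s, Nat.log 2 (⌊m⌋₊ / j) ∈ range (⌊m⌋₊ + 1) := fun j _ =>
    Finset.mem_range.2 (Nat.lt_succ_of_le ((Nat.log_le_self _ _).trans (Nat.div_le_self _ _)))
  rw [← Finset.sum_fiberwise_of_maps_to hmaps]
  have hfiber : ∀ k ∈ range (⌊m⌋₊ + 1),
      ∑ j ∈ s with Nat.log 2 (⌊m⌋₊ / j) = k,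
        (Real.log (Real.log (m / j + 2)) + C) ^ n / ((j : ℝ) * Real.log (m / j + 1) ^ 2) ≤
      c * (8 / Real.log 2 ^ 2) * H / Real.log m *
        ((Real.log (k + 2) + C) ^ n / ((k : ℝ) + 1) ^ 2) := by
    intro k _
    set W := (Real.log ((k : ℝ) + 2) + C) ^ n / ((k : ℝ) + 1) ^ 2 with hW
    have hW0 : 0 ≤ W := by
      have : 0 ≤ Real.log ((k : ℝ) + 2) :=
        Real.log_nonneg (by linarith [Nat.cast_nonneg (α := ℝ) k])
      positivity
    have hbd : ∀ j ∈ s.filter (fun j => Nat.log 2 (⌊m⌋₊ / j) = k),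
        0 < j ∧ (2 : ℝ) ^ k * j ≤ m ∧ m ≤ 2 ^ (k + 1) * j := by
      intro j hj
      simp only [hs, Finset.mem_filter, Finset.mem_Icc] at hj
      obtain ⟨⟨⟨hj1, hjm⟩, _⟩, rfl⟩ := hj
      have hq : ⌊m⌋₊ / j ≠ 0 := (Nat.div_pos hjm hj1).ne'
      have e1 := Nat.pow_log_le_self 2 hq
      have e2 := Nat.lt_pow_succ_log_self one_lt_two (⌊m⌋₊ / j)
      rw [Nat.le_div_iff_mul_le hj1] at e1
      rw [Nat.div_lt_iff_lt_mul hj1] at e2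
      refine ⟨hj1, ?_, ?_⟩
      · refine le_trans ?_ (Nat.floor_le hm0.le)
        exact_mod_cast e1
      · have := (Nat.floor_lt hm0.le).1 e2
        push_cast at this
        exact this.le
    have hcount : ((s.filter (fun j => Nat.log 2 (⌊m⌋₊ / j) = k)).card : ℝ) ≤
        c * (m / 2 ^ k) / Real.log m * H := by
      refine le_trans ?_ (hcard b m (m / 2 ^ k) hm (by positivity)
        (div_le_self hm0.le (one_le_pow₀ one_le_two)))
      refine Nat.cast_le.2 (Finset.card_le_card fun j hj => ?_)
      obtain ⟨h0, h1, _⟩ := hbd j hj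
      simp only [hs, Finset.mem_filter] at hj
      refine Finset.mem_filter.2 ⟨mem_omegaLevel.2 ⟨⟨h0, Nat.le_floor ?_⟩, hj.1.2.2⟩, hj.1.2.1⟩
      rw [le_div_iff₀ (by positivity)]
      linarith
    calc _ ≤ ∑ j ∈ s with Nat.log 2 (⌊m⌋₊ / j) = k, 2 ^ k / m * (8 / Real.log 2 ^ 2 * W) :=
          Finset.sum_le_sum fun j hj => by
            obtain ⟨h0, h1, h2⟩ := hbd j hj
            exact dyadic_weight_le hC n k (by exact_mod_cast h0) h1 h2
      _ = (s.filter (fun j => Nat.log 2 (⌊m⌋₊ / j) = k)).card *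
            (2 ^ k / m * (8 / Real.log 2 ^ 2 * W)) := by
          rw [Finset.sum_const, nsmul_eq_mul]
      _ ≤ c * (m / 2 ^ k) / Real.log m * H * (2 ^ k / m * (8 / Real.log 2 ^ 2 * W)) :=
          mul_le_mul_of_nonneg_right hcount (by positivity)
      _ = _ := by
          field_simp
  refine (Finset.sum_le_sum hfiber).trans ?_
  rw [← Finset.mul_sum]
  refine (mul_le_mul_of_nonneg_left (sum_log_add_pow_div_sq_le hC n _)
    (by positivity)).trans (le_of_eq ?_)
  rw [hH]
  field_simp
end

section
/- For every real C ≥ 0 there is a constant K = K(C) > 0 with the following property: for all integers a ≥ 1, n ≥ 0 and all reals m ≥ 2, Σ_{j ≤ m, ω(j) = a} (log log(j + 1) + C)^n / (j log j) ≤ K · (n + a − 1)! / (a − 1)!, where the sum is over integers j ≥ 2. -/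
open Finset

/-- A Riemann-sum comparison with the Gamma integral. -/
theorem sum_pow_mul_exp_neg_le (N D M : ℕ) :
    ∑ k ∈ range M, ((k : ℝ) + D) ^ N * Real.exp (-k) ≤ Real.exp (D + 1) * N.factorial := by
  have hint : MeasureTheory.IntegrableOn (fun x : ℝ => x ^ N * Real.exp (-x)) (Set.Ioi 0) := by
    refine (Real.GammaIntegral_convergent (s := N + 1) (by positivity)).congr_fun ?_
      measurableSet_Ioi
    intro x hx
    simp [mul_comm]
  have hG : ∫ x in Set.Ioi (0 : ℝ), x ^ N * Real.exp (-x) = N.factorial := by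
    rw [← Real.Gamma_nat_eq_factorial, Real.Gamma_eq_integral (by positivity)]
    refine MeasureTheory.setIntegral_congr_fun measurableSet_Ioi fun x hx => ?_
    simp [mul_comm]
  have h1 : ∑ i ∈ Ico D (D + M), (i : ℝ) ^ N * Real.exp (-((i : ℝ) + 1)) ≤ N.factorial := by
    refine (sum_Ico_le_integral_of_le (f := fun i => i ^ N * Real.exp (-(i + 1)))
      (g := fun x => x ^ N * Real.exp (-x)) (Nat.le_add_right D M) ?_ ?_).trans ?_
    · intro i _ x hx
      have hi : (0 : ℝ) ≤ i := i.cast_nonneg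
      have hx2 : x < i + 1 := by simpa using hx.2
      have := hx.1
      have hx0 : 0 ≤ x := hi.trans hx.1
      gcongr
    · refine (Continuous.integrableOn_Icc (by fun_prop)).mono_set Set.Ico_subset_Icc_self
    · rw [intervalIntegral.integral_of_le (by simp), ← hG]
      refine MeasureTheory.setIntegral_mono_set hint ?_ ?_
      · refine (MeasureTheory.ae_restrict_iff' measurableSet_Ioi).2 (.of_forall fun x hx => ?_)
        have : (0 : ℝ) < x := hx
        simp only [Pi.zero_apply]
        positivity
      · exact .of_forall fun x hx => lt_of_le_of_lt D.cast_nonneg hx.1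
  rw [sum_Ico_eq_sum_range] at h1
  calc ∑ k ∈ range M, ((k : ℝ) + D) ^ N * Real.exp (-k)
      = Real.exp (D + 1) * ∑ k ∈ range (D + M - D),
          ((D + k : ℕ) : ℝ) ^ N * Real.exp (-(((D + k : ℕ) : ℝ) + 1)) := by
        rw [mul_sum, Nat.add_sub_cancel_left]
        refine sum_congr rfl fun k _ => ?_
        rw [mul_left_comm, ← Real.exp_add]
        push_cast
        ring_nf
    _ ≤ _ := by gcongr

theorem sum_vonMangoldt_div_le (N : ℕ) :
    ∑ d ∈ Icc 1 N, ArithmeticFunction.vonMangoldt d / d ≤ 2 * Real.log N := by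
  rcases Nat.eq_zero_or_pos N with rfl | hN
  · simp
  have hN' : (0 : ℝ) < N := by exact_mod_cast hN
  have key : ∑ d ∈ Icc 1 N, ArithmeticFunction.vonMangoldt d * ((N / d : ℕ) : ℝ)
      ≤ N * Real.log N := by
    calc _ = ∑ d ∈ Icc 1 N, ∑ n ∈ (Icc 1 N).filter (d ∣ ·), ArithmeticFunction.vonMangoldt d := by
          refine sum_congr rfl fun d hd => ?_
          rw [sum_const, nsmul_eq_mul, mul_comm]
          congr 2
          rw [← Nat.Ioc_filter_dvd_card_eq_div]
          rfl
      _ = ∑ n ∈ Icc 1 N, ∑ d ∈ n.divisors, ArithmeticFunction.vonMangoldt d := by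
          refine sum_comm' fun d n => ?_
          simp only [mem_Icc, mem_filter, Nat.mem_divisors]
          constructor
          · rintro ⟨h1, h2, h3⟩
            exact ⟨⟨h3, by omega⟩, h2⟩
          · rintro ⟨⟨h1, h2⟩, h3⟩
            have := Nat.le_of_dvd (by omega) h1
            have := Nat.pos_of_dvd_of_pos h1 (by omega)
            exact ⟨⟨by omega, by omega⟩, h3, h1⟩
      _ ≤ ∑ n ∈ Icc 1 N, Real.log N := by
          refine sum_le_sum fun n hn => ?_
          rw [ArithmeticFunction.vonMangoldt_sum]
          rw [mem_Icc] at hn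
          exact Real.log_le_log (by exact_mod_cast hn.1) (by exact_mod_cast hn.2)
      _ = N * Real.log N := by simp
  have h2 : ∑ d ∈ Icc 1 N, ArithmeticFunction.vonMangoldt d / d * N
      ≤ ∑ d ∈ Icc 1 N, 2 * (ArithmeticFunction.vonMangoldt d * ((N / d : ℕ) : ℝ)) := by
    refine sum_le_sum fun d hd => ?_
    rw [mem_Icc] at hd
    have hd0 : (0 : ℝ) < d := by exact_mod_cast hd.1
    have h : (N : ℝ) / d ≤ 2 * ((N / d : ℕ) : ℝ) := by
      rw [div_le_iff₀ hd0]
      have h3 := Nat.div_add_mod N d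
      have h4 := Nat.mod_lt N hd.1
      have h5 : 1 ≤ N / d := (Nat.one_le_div_iff hd.1).2 hd.2
      have : N ≤ 2 * (N / d) * d := by nlinarith
      exact_mod_cast this
    calc _ = ArithmeticFunction.vonMangoldt d * (N / d) := by ring
      _ ≤ ArithmeticFunction.vonMangoldt d * (2 * ((N / d : ℕ) : ℝ)) := by
          gcongr
      _ = _ := by ring
  rw [← sum_mul, ← mul_sum] at h2
  refine le_of_mul_le_mul_right (h2.trans ?_) hN'
  linarith

theorem sum_prime_log_div_le (N : ℕ) :
    ∑ p ∈ (Icc 1 N).filter Nat.Prime, Real.log p / p ≤ 2 * Real.log N := by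
  refine le_trans ?_ (sum_vonMangoldt_div_le N)
  rw [sum_filter]
  refine sum_le_sum fun p _ => ?_
  split_ifs with hp
  · rw [ArithmeticFunction.vonMangoldt_apply_prime hp]
  · exact div_nonneg ArithmeticFunction.vonMangoldt_nonneg p.cast_nonneg

theorem tsum_rpow_neg_le {s : ℝ} (hs : 1 < s) :
    ∑' n : ℕ, (n : ℝ) ^ (-s) ≤ 1 + 1 / (s - 1) := by
  have h := ZetaAsymptotics.zeta_limit_aux1 hs
  have h0 : 0 ≤ ZetaAsymptotics.termTSum s :=
    tsum_nonneg fun n => ZetaAsymptotics.term_nonneg _ _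
  have hsum : Summable fun n : ℕ => (n : ℝ) ^ (-s) := Real.summable_nat_rpow.2 (by linarith)
  rw [hsum.tsum_eq_zero_add]
  have : ∑' n : ℕ, 1 / (n + 1 : ℝ) ^ s = ∑' n : ℕ, ((n + 1 : ℕ) : ℝ) ^ (-s) := by
    refine tsum_congr fun n => ?_
    rw [Real.rpow_neg (by positivity)]
    simp
  rw [← this, Nat.cast_zero, Real.zero_rpow (by linarith)]
  nlinarith [mul_nonneg (by linarith : (0:ℝ) ≤ s) h0]

theorem sum_prime_rpow_neg_le {s : ℝ} (hs : 1 < s) (N : ℕ) :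
    ∑ p ∈ (Icc 1 N).filter Nat.Prime, (p : ℝ) ^ (-s) ≤ Real.log (1 + 1 / (s - 1)) := by
  have hsum : Summable fun n : ℕ => (n : ℝ) ^ (-s) := Real.summable_nat_rpow.2 (by linarith)
  let f : ℕ →* ℝ :=
    { toFun := fun n => (n : ℝ) ^ (-s)
      map_one' := by simp
      map_mul' := fun m n => by
        push_cast
        exact Real.mul_rpow m.cast_nonneg n.cast_nonneg }
  have hE := EulerProduct.prod_primesBelow_geometric_eq_tsum_smoothNumbers (f := f) hsum (N + 1)
  have hle : ∑' m : (N + 1).smoothNumbers, f m ≤ ∑' n : ℕ, (n : ℝ) ^ (-s) :=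
    hsum.tsum_subtype_le _ _ fun n => Real.rpow_nonneg n.cast_nonneg _
  have hset : (Icc 1 N).filter Nat.Prime = (N + 1).primesBelow := by
    ext p
    simp only [mem_filter, mem_Icc, Nat.mem_primesBelow]
    exact ⟨fun h => ⟨by omega, h.2⟩, fun h => ⟨⟨h.2.one_le, by omega⟩, h.2⟩⟩
  have hpos : 0 < 1 / (s - 1) := one_div_pos.2 (by linarith)
  rw [Real.le_log_iff_exp_le (by linarith), Real.exp_sum, hset]
  refine le_trans ?_ (hle.trans (tsum_rpow_neg_le hs))
  rw [← hE]
  refine prod_le_prod (fun _ _ => (Real.exp_pos _).le) fun p hp => ?_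
  have hp := (Nat.mem_primesBelow.1 hp).2
  have hlt : (p : ℝ) ^ (-s) < 1 :=
    Real.rpow_lt_one_of_one_lt_of_neg (by exact_mod_cast hp.one_lt) (by linarith)
  change _ ≤ (1 - (p : ℝ) ^ (-s))⁻¹
  rw [le_inv_comm₀ (Real.exp_pos _) (by linarith), ← Real.exp_neg]
  exact Real.one_sub_le_exp_neg _

theorem sum_prime_inv_le (N : ℕ) :
    ∑ p ∈ (Icc 1 N).filter Nat.Prime, (1 : ℝ) / p ≤ Real.log (1 + Real.log N) + 3 := by
  have hl : 0 ≤ Real.log N := Real.log_natCast_nonneg N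
  set t : ℝ := 1 / (1 + Real.log N) with ht
  have ht0 : 0 < t := by positivity
  have h1 := sum_prime_rpow_neg_le (s := 1 + t) (by linarith) N
  have h2 := sum_prime_log_div_le N
  have h3 : ∑ p ∈ (Icc 1 N).filter Nat.Prime, (1 : ℝ) / p ≤
      ∑ p ∈ (Icc 1 N).filter Nat.Prime, (p : ℝ) ^ (-(1 + t)) +
      t * ∑ p ∈ (Icc 1 N).filter Nat.Prime, Real.log p / p := by
    rw [mul_sum, ← sum_add_distrib]
    refine sum_le_sum fun p hp => ?_
    have hp0 : (0 : ℝ) < p := by exact_mod_cast (mem_filter.1 hp).2.pos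
    have : (p : ℝ) ^ (-(1 + t)) = (1 / p) * Real.exp (-(t * Real.log p)) := by
      rw [neg_add, Real.rpow_add hp0, Real.rpow_neg_one, Real.rpow_def_of_pos hp0]
      ring_nf
    rw [this]
    have h4 := Real.one_sub_le_exp_neg (t * Real.log p)
    have h5 : (1 / p : ℝ) * (1 - t * Real.log p) ≤ 1 / p * Real.exp (-(t * Real.log p)) := by
      gcongr
    calc (1 / p : ℝ) = 1 / p * (1 - t * Real.log p) + t * (Real.log p / p) := by ring
      _ ≤ _ := by gcongr
  have h6 : t * (2 * Real.log N) ≤ 2 := by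
    rw [ht, one_div, inv_mul_le_iff₀ (by positivity)]
    linarith
  have h7 : Real.log (1 + 1 / (1 + t - 1)) ≤ Real.log (1 + Real.log N) + 1 := by
    have : 1 + 1 / (1 + t - 1) = 1 + (1 + Real.log N) := by
      rw [add_sub_cancel_left, ht, one_div_one_div]
    rw [this]
    calc _ ≤ Real.log ((1 + Real.log N) * Real.exp 1) := by
          apply Real.log_le_log (by positivity)
          nlinarith [Real.add_one_le_exp 1]
      _ = _ := by rw [Real.log_mul (by positivity) (by positivity), Real.log_exp]
  have h8 := mul_le_mul_of_nonneg_left h2 ht0.le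
  linarith

theorem sum_isPrimePow_not_prime_rpow_le :
    ∃ M : ℝ, 0 ≤ M ∧ ∀ N : ℕ, ∑ q ∈ (Icc 1 N).filter (fun q => IsPrimePow q ∧ ¬ q.Prime),
      (q : ℝ) ^ (-(3 / 4) : ℝ) ≤ M := by
  have h1 : Summable fun n : ℕ => (n : ℝ) ^ (-(9 / 4) : ℝ) :=
    Real.summable_nat_rpow.2 (by norm_num)
  have h2 : Summable fun n : ℕ => (n : ℝ) ^ (-(3 / 2) : ℝ) :=
    Real.summable_nat_rpow.2 (by norm_num)
  refine ⟨(∑' n : ℕ, (n : ℝ) ^ (-(9 / 4) : ℝ)) * ∑' n : ℕ, (n : ℝ) ^ (-(3 / 2) : ℝ),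
    by positivity, fun N => ?_⟩
  have hsub : (Icc 1 N).filter (fun q => IsPrimePow q ∧ ¬ q.Prime) ⊆
      (Icc 1 N ×ˢ Icc 1 N).image fun x : ℕ × ℕ => x.1 ^ 3 * x.2 ^ 2 := by
    intro q hq
    rw [mem_filter, mem_Icc] at hq
    obtain ⟨⟨hq1, hqN⟩, hpp, hnp⟩ := hq
    obtain ⟨p, k, hp, hk, rfl⟩ := (isPrimePow_nat_iff _).1 hpp
    have hk2 : 2 ≤ k := by
      by_contra h
      have : k = 1 := by omega
      subst this
      exact hnp (by simpa using hp)
    obtain ⟨e, f, hef⟩ : ∃ e f, k = e * 3 + f * 2 := by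
      rcases Nat.even_or_odd' k with ⟨c, rfl | rfl⟩
      · exact ⟨0, c, by omega⟩
      · exact ⟨1, c - 1, by omega⟩
    rw [mem_image]
    refine ⟨(p ^ e, p ^ f), ?_, by rw [hef, pow_add, pow_mul, pow_mul]⟩
    simp only [mem_product, mem_Icc]
    exact ⟨⟨Nat.pow_pos hp.pos, (Nat.pow_le_pow_right hp.pos (by omega)).trans hqN⟩,
      ⟨Nat.pow_pos hp.pos, (Nat.pow_le_pow_right hp.pos (by omega)).trans hqN⟩⟩
  calc _ ≤ ∑ q ∈ (Icc 1 N ×ˢ Icc 1 N).image fun x : ℕ × ℕ => x.1 ^ 3 * x.2 ^ 2,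
          (q : ℝ) ^ (-(3 / 4) : ℝ) :=
        sum_le_sum_of_subset_of_nonneg hsub fun _ _ _ => by positivity
    _ ≤ ∑ x ∈ Icc 1 N ×ˢ Icc 1 N, ((x.1 ^ 3 * x.2 ^ 2 : ℕ) : ℝ) ^ (-(3 / 4) : ℝ) :=
        sum_image_le_of_nonneg fun _ _ => by positivity
    _ = ∑ x ∈ Icc 1 N ×ˢ Icc 1 N, (x.1 : ℝ) ^ (-(9 / 4) : ℝ) * (x.2 : ℝ) ^ (-(3 / 2) : ℝ) := by
        refine sum_congr rfl fun x _ => ?_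
        push_cast
        rw [Real.mul_rpow (by positivity) (by positivity), ← Real.rpow_natCast,
          ← Real.rpow_natCast, ← Real.rpow_mul (by positivity), ← Real.rpow_mul (by positivity)]
        norm_num
    _ = (∑ u ∈ Icc 1 N, (u : ℝ) ^ (-(9 / 4) : ℝ)) * ∑ v ∈ Icc 1 N, (v : ℝ) ^ (-(3 / 2) : ℝ) := by
        rw [sum_product, sum_mul_sum]
    _ ≤ _ := by
        gcongr
        · exact h1.sum_le_tsum _ fun _ _ => by positivity
        · exact h2.sum_le_tsum _ fun _ _ => by positivity

/-- Removing one exact prime power factor from each integer with `b + 1` distinct prime factors. -/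
theorem sum_card_primeFactors_succ_le {f : ℕ → ℝ} (hf : ∀ q, 0 ≤ f q) (N b : ℕ) :
    ∑ j ∈ (Icc 1 N).filter (fun j => j.primeFactors.card = b + 1),
      (∑ p ∈ j.primeFactors, f (p ^ j.factorization p)) / j ≤
    (∑ j ∈ (Icc 1 N).filter (fun j => j.primeFactors.card = b), (1 : ℝ) / j) *
      ∑ q ∈ (Icc 1 N).filter IsPrimePow, f q / q := by
  simp_rw [sum_div]
  rw [sum_sigma', sum_mul_sum, ← sum_product']
  let φ : (_ : ℕ) × ℕ → ℕ × ℕ := fun x =>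
    (x.1 / x.2 ^ x.1.factorization x.2, x.2 ^ x.1.factorization x.2)
  set S := ((Icc 1 N).filter (fun j => j.primeFactors.card = b + 1)).sigma
    fun j => j.primeFactors with hS
  have hmem : ∀ x ∈ S, x.1 ≠ 0 ∧ x.1 ≤ N ∧ x.1.primeFactors.card = b + 1 ∧ x.2.Prime ∧
      x.2 ∣ x.1 := by
    intro x hx
    rw [hS, mem_sigma, mem_filter, mem_Icc, Nat.mem_primeFactors] at hx
    exact ⟨hx.2.2.2, hx.1.1.2, hx.1.2, hx.2.1, hx.2.2.1⟩
  have hinj : Set.InjOn φ S := by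
    rintro ⟨j, p⟩ hx ⟨j', p'⟩ hy h
    obtain ⟨h0, -, -, hp, hd⟩ := hmem _ hx
    obtain ⟨h0', -, -, hp', hd'⟩ := hmem _ hy
    dsimp only at h0 hp hd h0' hp' hd'
    simp only [φ, Prod.mk.injEq] at h
    have hj : j = j' := by
      rw [← Nat.ordProj_mul_ordCompl_eq_self j p, ← Nat.ordProj_mul_ordCompl_eq_self j' p',
        h.1, h.2]
    have hpp : p = p' := by
      have hk : j.factorization p ≠ 0 := (hp.factorization_pos_of_dvd h0 hd).ne'
      have : p ∣ p' ^ j'.factorization p' := h.2 ▸ dvd_pow_self p hk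
      exact (Nat.prime_dvd_prime_iff_eq hp hp').1 (hp.dvd_of_dvd_pow this)
    subst hj hpp
    rfl
  calc _ = ∑ x ∈ S, (1 : ℝ) / (φ x).1 * (f (φ x).2 / (φ x).2) := by
        refine sum_congr rfl fun x _ => ?_
        have : (x.1 : ℝ) = (φ x).2 * (φ x).1 := by
          exact_mod_cast (Nat.ordProj_mul_ordCompl_eq_self x.1 x.2).symm
        rw [this, div_mul_div_comm, one_mul, mul_comm]
    _ = ∑ y ∈ S.image φ, (1 : ℝ) / y.1 * (f y.2 / y.2) := by rw [sum_image hinj]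
    _ ≤ _ := by
        refine sum_le_sum_of_subset_of_nonneg ?_ fun y _ _ =>
          mul_nonneg (by positivity) (div_nonneg (hf _) (by positivity))
        intro y hy
        obtain ⟨⟨j, p⟩, hx, rfl⟩ := mem_image.1 hy
        obtain ⟨h0, hN, hc, hp, hd⟩ := hmem _ hx
        dsimp only at h0 hN hc hp hd
        simp only [φ, mem_product, mem_filter, mem_Icc]
        have hk := hp.factorization_pos_of_dvd h0 hd
        refine ⟨⟨⟨Nat.ordCompl_pos p h0, (Nat.ordCompl_le j p).trans hN⟩, ?_⟩,
          ⟨Nat.ordProj_pos j p, (Nat.ordProj_le p h0).trans hN⟩, hp.isPrimePow.pow hk.ne'⟩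
        rw [← Nat.support_factorization, Nat.factorization_ordCompl, Finsupp.support_erase,
          Nat.support_factorization, card_erase_of_mem (Nat.mem_primeFactors.2 ⟨hp, hd, h0⟩), hc]
        rfl

theorem sum_card_primeFactors_inv_le (N b : ℕ) :
    ∑ j ∈ (Icc 1 N).filter (fun j => j.primeFactors.card = b), (1 : ℝ) / j ≤
      (∑ q ∈ (Icc 1 N).filter IsPrimePow, (1 : ℝ) / q) ^ b / b.factorial := by
  induction b with
  | zero =>
    have : (Icc 1 N).filter (fun j => j.primeFactors.card = 0) ⊆ {1} := by
      intro j hj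
      rw [mem_filter, mem_Icc, card_eq_zero, Nat.primeFactors_eq_empty] at hj
      rw [mem_singleton]
      omega
    refine (sum_le_sum_of_subset_of_nonneg this fun _ _ _ => by positivity).trans ?_
    simp
  | succ b ih =>
    have h := sum_card_primeFactors_succ_le (f := fun _ => 1) (fun _ => zero_le_one) N b
    have h2 : ∑ j ∈ (Icc 1 N).filter (fun j => j.primeFactors.card = b + 1),
        (∑ p ∈ j.primeFactors, (1 : ℝ)) / j = (b + 1) *
        ∑ j ∈ (Icc 1 N).filter (fun j => j.primeFactors.card = b + 1), (1 : ℝ) / j := by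
      rw [mul_sum]
      refine sum_congr rfl fun j hj => ?_
      rw [sum_const, (mem_filter.1 hj).2, nsmul_eq_mul]
      push_cast
      ring
    rw [h2] at h
    have hQ : 0 ≤ ∑ q ∈ (Icc 1 N).filter IsPrimePow, (1 : ℝ) / q :=
      sum_nonneg fun _ _ => by positivity
    have h3 := h.trans (mul_le_mul_of_nonneg_right ih hQ)
    rw [Nat.factorial_succ, pow_succ, ← le_div_iff₀' (by positivity)] at *
    refine h3.trans (le_of_eq ?_)
    push_cast
    field_simp

theorem sum_card_primeFactors_log_div_le (N b : ℕ) :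
    ∑ j ∈ (Icc 1 N).filter (fun j => j.primeFactors.card = b + 1), Real.log j / j ≤
      (∑ q ∈ (Icc 1 N).filter IsPrimePow, (1 : ℝ) / q) ^ b / b.factorial *
      ∑ q ∈ (Icc 1 N).filter IsPrimePow, Real.log q / q := by
  have hQ : 0 ≤ ∑ q ∈ (Icc 1 N).filter IsPrimePow, Real.log q / q :=
    sum_nonneg fun q _ => div_nonneg (Real.log_natCast_nonneg q) q.cast_nonneg
  refine le_trans (le_of_eq ?_) ((sum_card_primeFactors_succ_le (f := fun q => Real.log q)
    (fun q => Real.log_natCast_nonneg q) N b).trans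
    (mul_le_mul_of_nonneg_right (sum_card_primeFactors_inv_le N b) hQ))
  refine sum_congr rfl fun j hj => ?_
  have hj0 : j ≠ 0 := by
    have := (mem_Icc.1 (mem_filter.1 hj).1).1
    omega
  congr 1
  conv_lhs => rw [← Nat.prod_factorization_pow_eq_self hj0, Finsupp.prod, Nat.cast_prod,
    Nat.support_factorization]
  refine Real.log_prod fun p hp => ?_
  have := (Nat.prime_of_mem_primeFactors hp).pos
  positivity

theorem sum_filter_isPrimePow_le {f : ℕ → ℝ} {c : ℝ}
    (hf : ∀ q : ℕ, 1 ≤ q → f q ≤ c * (q : ℝ) ^ (-(3 / 4) : ℝ)) (hc : 0 ≤ c) {M : ℝ} {N : ℕ}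
    (hM : ∑ q ∈ (Icc 1 N).filter (fun q => IsPrimePow q ∧ ¬ q.Prime),
      (q : ℝ) ^ (-(3 / 4) : ℝ) ≤ M) :
    ∑ q ∈ (Icc 1 N).filter IsPrimePow, f q ≤
      ∑ p ∈ (Icc 1 N).filter Nat.Prime, f p + c * M := by
  rw [← sum_filter_add_sum_filter_not _ Nat.Prime, filter_filter, filter_filter]
  have : (Icc 1 N).filter (fun q => IsPrimePow q ∧ q.Prime) = (Icc 1 N).filter Nat.Prime :=
    filter_congr fun q _ => ⟨fun h => h.2, fun h => ⟨h.isPrimePow, h⟩⟩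
  rw [this]
  gcongr
  refine le_trans ?_ (mul_le_mul_of_nonneg_left hM hc)
  rw [mul_sum]
  exact sum_le_sum fun q hq => hf q (mem_Icc.1 (mem_filter.1 hq).1).1

theorem exists_sum_isPrimePow_le :
    ∃ M : ℝ, 0 ≤ M ∧ ∀ N : ℕ,
      ∑ q ∈ (Icc 1 N).filter IsPrimePow, (1 : ℝ) / q ≤ Real.log (1 + Real.log N) + M ∧
      ∑ q ∈ (Icc 1 N).filter IsPrimePow, Real.log q / q ≤ 2 * Real.log N + M := by
  obtain ⟨M, hM0, hM⟩ := sum_isPrimePow_not_prime_rpow_le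
  refine ⟨3 + 4 * M, by positivity, fun N => ⟨?_, ?_⟩⟩
  · have h := sum_filter_isPrimePow_le (f := fun q => (1 : ℝ) / q) (c := 1) (fun q hq => ?_)
      zero_le_one (hM N)
    · have := sum_prime_inv_le N
      linarith
    · have hq1 : (1 : ℝ) ≤ q := by exact_mod_cast hq
      rw [one_div, ← Real.rpow_neg_one, one_mul]
      exact Real.rpow_le_rpow_of_exponent_le hq1 (by norm_num)
  · have h := sum_filter_isPrimePow_le (f := fun q => Real.log q / q) (c := 4) (fun q hq => ?_)
      (by norm_num) (hM N)
    · have := sum_prime_log_div_le N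
      linarith
    · have hq0 : (0 : ℝ) < q := by exact_mod_cast hq
      have hl := Real.log_le_rpow_div hq0.le (ε := 1 / 4) (by norm_num)
      have : (q : ℝ) ^ (-(3 / 4) : ℝ) = (q : ℝ) ^ (1 / 4 : ℝ) / q := by
        rw [← Real.rpow_sub_one hq0.ne']
        norm_num
      rw [this, ← mul_div_assoc]
      gcongr
      linarith

/-- For `j ≥ 2` with `k ≤ log (1 + log j) < k + 1`, a comparison of the summand with
`log j / j`. -/
theorem summand_le {C : ℝ} (hC : 0 ≤ C) {D : ℕ} (hD : 1 + C ≤ D) (n : ℕ) {j k : ℕ} (hj : 2 ≤ j)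
    (hk : k ≤ Real.log (1 + Real.log j)) (hk' : Real.log (1 + Real.log j) < k + 1) :
    (Real.log (Real.log ((j : ℝ) + 1)) + C) ^ n / ((j : ℝ) * Real.log j) ≤
      9 * ((k : ℝ) + D) ^ n * Real.exp (-(2 * k)) * (Real.log j / j) := by
  have hj2 : (2 : ℝ) ≤ j := by exact_mod_cast hj
  have hl : 1 / 2 ≤ Real.log j := by
    have := Real.log_le_log (by norm_num) hj2
    linarith [Real.log_two_gt_d9]
  have h1 : 1 ≤ Real.log ((j : ℝ) + 1) := by
    rw [Real.le_log_iff_exp_le (by linarith)]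
    linarith [Real.exp_one_lt_d9]
  have h2 : Real.log ((j : ℝ) + 1) ≤ 1 + Real.log j := by
    calc _ ≤ Real.log (Real.exp 1 * j) := by
          apply Real.log_le_log (by linarith)
          nlinarith [Real.add_one_le_exp 1]
      _ = _ := by rw [Real.log_mul (by positivity) (by positivity), Real.log_exp]
  have h3 : Real.log (Real.log ((j : ℝ) + 1)) ≤ Real.log (1 + Real.log j) :=
    Real.log_le_log (by linarith) h2
  have h4 : 0 ≤ Real.log (Real.log ((j : ℝ) + 1)) := Real.log_nonneg h1
  have h5 : Real.exp k ≤ 3 * Real.log j := by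
    have := (Real.le_log_iff_exp_le (by linarith)).1 hk
    linarith
  have h6 : 1 / ((j : ℝ) * Real.log j) ≤ 9 * Real.exp (-(2 * k)) * (Real.log j / j) := by
    have h7 : Real.exp k ^ 2 ≤ 9 * Real.log j ^ 2 := by
      have := pow_le_pow_left₀ (Real.exp_pos k).le h5 2
      linarith
    rw [Real.exp_neg, show (2 * (k : ℝ)) = k + k by ring, Real.exp_add, ← sq]
    have hlj : 0 < Real.log j := by linarith
    rw [div_le_iff₀ (by positivity)]
    have : 9 * (Real.exp k ^ 2)⁻¹ * (Real.log j / j) * (j * Real.log j) =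
        9 * Real.log j ^ 2 / Real.exp k ^ 2 := by
      field_simp
    rw [this, le_div_iff₀ (by positivity)]
    linarith
  calc _ = (Real.log (Real.log ((j : ℝ) + 1)) + C) ^ n * (1 / ((j : ℝ) * Real.log j)) := by ring
    _ ≤ ((k : ℝ) + D) ^ n * (9 * Real.exp (-(2 * k)) * (Real.log j / j)) := by
        have h8 : (Real.log (Real.log ((j : ℝ) + 1)) + C) ^ n ≤ ((k : ℝ) + D) ^ n :=
          pow_le_pow_left₀ (by linarith) (by linarith) n
        gcongr
    _ = _ := by ring

theorem log_natFloor_exp_sub_one_le (k : ℕ) :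
    1 + Real.log (⌊Real.exp (Real.exp ((k : ℝ) + 1) - 1)⌋₊ : ℝ) ≤ Real.exp ((k : ℝ) + 1) := by
  have h : 0 ≤ Real.exp ((k : ℝ) + 1) - 1 := by
    linarith [Real.add_one_le_exp ((k : ℝ) + 1), (k.cast_nonneg : (0 : ℝ) ≤ k)]
  have h1 : 0 < ⌊Real.exp (Real.exp ((k : ℝ) + 1) - 1)⌋₊ :=
    Nat.floor_pos.2 (Real.one_le_exp h)
  have := Real.log_le_log (Nat.cast_pos.2 h1) (Nat.floor_le (Real.exp_pos _).le)
  rw [Real.log_exp] at this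
  linarith

theorem stmt_11 :
    ∀ C : ℝ, 0 ≤ C → ∃ K > (0 : ℝ),
      ∀ (a n : ℕ), 1 ≤ a → ∀ m : ℝ, 2 ≤ m →
        (∑ j ∈ (Finset.Icc 2 ⌊m⌋₊).filter (fun j => j.primeFactors.card = a),
          (Real.log (Real.log ((j : ℝ) + 1)) + C) ^ n / ((j : ℝ) * Real.log j))
        ≤ K * ((n + a - 1).factorial : ℝ) / ((a - 1).factorial : ℝ) := by
  intro C hC
  obtain ⟨M, hM0, hM⟩ := exists_sum_isPrimePow_le
  obtain ⟨D, hD⟩ := exists_nat_ge (1 + C + M)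
  refine ⟨9 * (2 + M) * Real.exp 1 * Real.exp (D + 1), by positivity, fun a n ha m _ => ?_⟩
  obtain ⟨b, rfl⟩ : ∃ b, a = b + 1 := ⟨a - 1, by omega⟩
  rw [Nat.add_sub_cancel, show n + (b + 1) - 1 = n + b by omega]
  set J := (Finset.Icc 2 ⌊m⌋₊).filter (fun j => j.primeFactors.card = b + 1) with hJ
  let κ : ℕ → ℕ := fun j => ⌊Real.log (1 + Real.log j)⌋₊
  have hmaps : ∀ j ∈ J, κ j ∈ range (J.sup κ + 1) := fun j hj =>
    mem_range.2 (Nat.lt_succ_of_le (le_sup hj))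
  have hfib : ∀ k : ℕ, ∑ j ∈ J.filter (fun j => κ j = k),
      (Real.log (Real.log ((j : ℝ) + 1)) + C) ^ n / ((j : ℝ) * Real.log j) ≤
      9 * (2 + M) * Real.exp 1 / b.factorial * (((k : ℝ) + D) ^ (n + b) * Real.exp (-k)) := by
    intro k
    set N := ⌊Real.exp (Real.exp ((k : ℝ) + 1) - 1)⌋₊ with hN
    have hlogN := log_natFloor_exp_sub_one_le k
    rw [← hN] at hlogN
    have hlogN0 : 0 ≤ Real.log N := Real.log_natCast_nonneg N
    have hloglog : Real.log (1 + Real.log N) ≤ k + 1 :=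
      (Real.log_le_iff_le_exp (by linarith)).2 hlogN
    have hcond : ∀ j ∈ J.filter (fun j => κ j = k), 2 ≤ j ∧ j.primeFactors.card = b + 1 ∧
        k ≤ Real.log (1 + Real.log j) ∧ Real.log (1 + Real.log j) < k + 1 := by
      intro j hj
      rw [mem_filter, hJ, mem_filter, mem_Icc] at hj
      obtain ⟨⟨⟨hj2, -⟩, hjc⟩, hjk⟩ := hj
      have h0 : 0 ≤ Real.log (1 + Real.log j) :=
        Real.log_nonneg (by linarith [Real.log_natCast_nonneg j])
      exact ⟨hj2, hjc, (Nat.floor_eq_iff h0).1 hjk⟩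
    have hsub : J.filter (fun j => κ j = k) ⊆
        (Icc 1 N).filter (fun j => j.primeFactors.card = b + 1) := by
      intro j hj
      obtain ⟨hj2, hjc, -, hlt⟩ := hcond j hj
      rw [mem_filter, mem_Icc]
      refine ⟨⟨by omega, Nat.le_floor ?_⟩, hjc⟩
      have hl0 := Real.log_natCast_nonneg j
      rw [Real.log_lt_iff_lt_exp (by linarith)] at hlt
      rw [← Real.log_le_iff_le_exp (by positivity)]
      linarith
    have hS : ∑ j ∈ J.filter (fun j => κ j = k), Real.log j / j ≤
        ((k : ℝ) + D) ^ b / b.factorial * ((2 + M) * Real.exp (k + 1)) := by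
      calc _ ≤ ∑ j ∈ (Icc 1 N).filter (fun j => j.primeFactors.card = b + 1), Real.log j / j :=
            sum_le_sum_of_subset_of_nonneg hsub fun j _ _ =>
              div_nonneg (Real.log_natCast_nonneg j) j.cast_nonneg
        _ ≤ _ := sum_card_primeFactors_log_div_le N b
        _ ≤ _ := by
            have h1 := (hM N).1
            have h2 := (hM N).2
            gcongr
            · linarith
            · nlinarith
    calc _ ≤ ∑ j ∈ J.filter (fun j => κ j = k),
          9 * ((k : ℝ) + D) ^ n * Real.exp (-(2 * k)) * (Real.log j / j) := by
          refine sum_le_sum fun j hj => ?_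
          obtain ⟨hj2, -, hk, hk'⟩ := hcond j hj
          exact summand_le hC (by linarith) n hj2 hk hk'
      _ = 9 * ((k : ℝ) + D) ^ n * Real.exp (-(2 * k)) *
          ∑ j ∈ J.filter (fun j => κ j = k), Real.log j / j := by rw [mul_sum]
      _ ≤ 9 * ((k : ℝ) + D) ^ n * Real.exp (-(2 * k)) *
          (((k : ℝ) + D) ^ b / b.factorial * ((2 + M) * Real.exp (k + 1))) := by gcongr
      _ = _ := by
          have : Real.exp (-(2 * k)) * Real.exp (k + 1) = Real.exp 1 * Real.exp (-k) := by
            rw [← Real.exp_add, ← Real.exp_add]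
            ring_nf
          rw [pow_add]
          linear_combination 9 * ((k : ℝ) + D) ^ n * ((k : ℝ) + D) ^ b / b.factorial * (2 + M) * this
  rw [← sum_fiberwise_of_maps_to hmaps]
  calc _ ≤ ∑ k ∈ range (J.sup κ + 1), 9 * (2 + M) * Real.exp 1 / b.factorial *
        (((k : ℝ) + D) ^ (n + b) * Real.exp (-k)) := sum_le_sum fun k _ => hfib k
    _ ≤ 9 * (2 + M) * Real.exp 1 / b.factorial * (Real.exp (D + 1) * (n + b).factorial) := by
        rw [← mul_sum]
        gcongr
        exact sum_pow_mul_exp_neg_le _ _ _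
    _ = _ := by ring
end

section
/- There are absolute constants B ≥ 0 and K > 0 such that for all integers a ≥ 1 and all reals 2 ≤ m ≤ M, Σ_{m ≤ j ≤ M, ω(j) = a} 1 / log²(1 + j/m) ≤ K · M · (log log M + B)^{a−1} / ((a−1)! · log M · log²(1 + M/m)), where the sum is over integers j. -/
open Finset

theorem sum_le_sum_of_injOn {ι κ : Type*} [DecidableEq κ] {s : Finset ι} {t : Finset κ}
    {f : ι → ℝ} {g : κ → ℝ} (i : ι → κ) (hi : ∀ x ∈ s, i x ∈ t) (hinj : Set.InjOn i s)
    (hfg : ∀ x ∈ s, f x ≤ g (i x)) (hg : ∀ y ∈ t, 0 ≤ g y) :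
    ∑ x ∈ s, f x ≤ ∑ y ∈ t, g y := by
  calc ∑ x ∈ s, f x ≤ ∑ x ∈ s, g (i x) := sum_le_sum hfg
    _ = ∑ y ∈ s.image i, g y := (sum_image hinj).symm
    _ ≤ ∑ y ∈ t, g y :=
      sum_le_sum_of_subset_of_nonneg (image_subset_iff.2 hi) fun y hy _ => hg y hy

/-- Removing one exact prime power factor from an integer lowers the number of distinct prime
factors by one, and the integer is determined by the two factors. -/
theorem sum_sum_primeFactors_le (g h : ℕ → ℝ) (hg : ∀ n, 0 ≤ g n) (hh : ∀ n, 0 ≤ h n) (N k : ℕ) :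
    ∑ n ∈ Icc 1 N with n.primeFactors.card = k + 1, ∑ p ∈ n.primeFactors,
        g (p ^ n.factorization p) * h (n / p ^ n.factorization p) ≤
      ∑ m ∈ Icc 1 N with m.primeFactors.card = k,
        h m * ∑ q ∈ Icc 1 (N / m) with IsPrimePow q, g q := by
  simp_rw [mul_sum]
  rw [sum_sigma', sum_sigma']
  refine sum_le_sum_of_injOn
    (fun x => ⟨x.1 / x.2 ^ x.1.factorization x.2, x.2 ^ x.1.factorization x.2⟩) ?_ ?_ ?_ ?_
  · rintro ⟨n, p⟩ hx
    simp only [mem_sigma, mem_filter, mem_Icc, Nat.mem_primeFactors] at hx ⊢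
    obtain ⟨⟨⟨hn1, hnN⟩, hcard⟩, hp, hpn, hn0⟩ := hx
    have hpos : 0 < n / p ^ n.factorization p := Nat.ordCompl_pos p hn0
    refine ⟨⟨⟨hpos, (Nat.ordCompl_le n p).trans hnN⟩, ?_⟩,
      ⟨Nat.ordProj_pos n p, ?_⟩, ?_⟩
    · rw [← Nat.support_factorization, Nat.factorization_ordCompl, Finsupp.support_erase,
        Nat.support_factorization, card_erase_of_mem (Nat.mem_primeFactors.2 ⟨hp, hpn, hn0⟩),
        hcard, Nat.add_sub_cancel]
    · rw [Nat.le_div_iff_mul_le hpos, Nat.ordProj_mul_ordCompl_eq_self]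
      exact hnN
    · exact hp.isPrimePow.pow (hp.factorization_pos_of_dvd hn0 hpn).ne'
  · rintro ⟨n, p⟩ hx ⟨n', p'⟩ hx' heq
    simp only [coe_sigma, Set.mem_sigma_iff, mem_coe, mem_filter, mem_Icc,
      Nat.mem_primeFactors] at hx hx'
    simp only [Sigma.mk.injEq, heq_eq_eq] at heq
    have hn : n = n' := by
      rw [← Nat.ordProj_mul_ordCompl_eq_self n p, heq.1, heq.2,
        Nat.ordProj_mul_ordCompl_eq_self]
    have hp : p = p' := by
      have h := congrArg Nat.minFac heq.2
      rwa [hx.2.1.pow_minFac (hx.2.1.factorization_pos_of_dvd hx.2.2.2 hx.2.2.1).ne',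
        hx'.2.1.pow_minFac (hx'.2.1.factorization_pos_of_dvd hx'.2.2.2 hx'.2.2.1).ne'] at h
    rw [hn, hp]
  · rintro ⟨n, p⟩ -
    exact (mul_comm _ _).le
  · rintro ⟨m, q⟩ -
    exact mul_nonneg (hh _) (hg _)

/-- The reciprocals of the integers with `k` distinct prime factors are bounded by the `k`-th
divided power of the sum of the reciprocals of prime powers. -/
theorem sum_inv_card_primeFactors_le (N k : ℕ) :
    ∑ n ∈ Icc 1 N with n.primeFactors.card = k, (n : ℝ)⁻¹ ≤
      (∑ q ∈ Icc 1 N with IsPrimePow q, (q : ℝ)⁻¹) ^ k / k.factorial := by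
  set S := ∑ q ∈ Icc 1 N with IsPrimePow q, (q : ℝ)⁻¹
  have hS : 0 ≤ S := sum_nonneg fun q _ => by positivity
  induction k with
  | zero =>
    simp only [pow_zero, Nat.factorial_zero, Nat.cast_one, div_one]
    calc ∑ n ∈ Icc 1 N with n.primeFactors.card = 0, (n : ℝ)⁻¹
        ≤ ∑ n ∈ ({1} : Finset ℕ), (n : ℝ)⁻¹ := by
          refine sum_le_sum_of_subset_of_nonneg ?_ fun _ _ _ => by positivity
          intro n hn
          simp only [mem_filter, mem_Icc, card_eq_zero, Nat.primeFactors_eq_empty] at hn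
          simp only [mem_singleton]
          omega
      _ = 1 := by simp
  | succ k ih =>
    have key := sum_sum_primeFactors_le (fun n => (n : ℝ)⁻¹) (fun n => (n : ℝ)⁻¹)
      (fun n => by positivity) (fun n => by positivity) N k
    have hl : ∑ n ∈ Icc 1 N with n.primeFactors.card = k + 1, ∑ p ∈ n.primeFactors,
        ((p ^ n.factorization p : ℕ) : ℝ)⁻¹ * ((n / p ^ n.factorization p : ℕ) : ℝ)⁻¹ =
        (k + 1) * ∑ n ∈ Icc 1 N with n.primeFactors.card = k + 1, (n : ℝ)⁻¹ := by
      rw [mul_sum]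
      refine sum_congr rfl fun n hn => ?_
      rw [sum_congr rfl (g := fun _ => (n : ℝ)⁻¹), sum_const, (mem_filter.1 hn).2, nsmul_eq_mul]
      · push_cast
        ring
      · intro p _
        rw [← mul_inv, ← Nat.cast_mul, Nat.ordProj_mul_ordCompl_eq_self]
    have hr : ∑ m ∈ Icc 1 N with m.primeFactors.card = k,
        (m : ℝ)⁻¹ * ∑ q ∈ Icc 1 (N / m) with IsPrimePow q, (q : ℝ)⁻¹ ≤
        (∑ m ∈ Icc 1 N with m.primeFactors.card = k, (m : ℝ)⁻¹) * S := by
      rw [sum_mul]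
      refine sum_le_sum fun m _ => ?_
      gcongr
      refine sum_le_sum_of_subset_of_nonneg ?_ fun _ _ _ => by positivity
      gcongr
      exact Nat.div_le_self N m
    rw [hl] at key
    rw [Nat.factorial_succ, le_div_iff₀ (by positivity)]
    push_cast
    have h2 := (le_div_iff₀ (by positivity)).1 ih
    calc _ = ((k + 1) * ∑ n ∈ Icc 1 N with n.primeFactors.card = k + 1, (n : ℝ)⁻¹)
            * k.factorial := by ring
      _ ≤ ((∑ m ∈ Icc 1 N with m.primeFactors.card = k, (m : ℝ)⁻¹) * S) * k.factorial := by
          exact mul_le_mul_of_nonneg_right (key.trans hr) (by positivity)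
      _ = ((∑ m ∈ Icc 1 N with m.primeFactors.card = k, (m : ℝ)⁻¹) * k.factorial) * S := by ring
      _ ≤ S ^ k * S := by gcongr
      _ = S ^ (k + 1) := by ring

/-- Abel summation bound against an antitone nonnegative weight. -/
theorem sum_mul_le_of_antitone {a f : ℕ → ℝ} {C : ℝ}
    (ha : ∀ n, ∑ i ∈ Icc 1 n, a i ≤ C * n) (hf : ∀ n, 1 ≤ n → f (n + 1) ≤ f n)
    (hf0 : ∀ n, 0 ≤ f n) (N : ℕ) :
    ∑ i ∈ Icc 1 N, a i * f i ≤ C * ∑ i ∈ Icc 1 N, f i := by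
  suffices h : ∑ i ∈ Icc 1 N, a i * f i ≤
      C * ∑ i ∈ Icc 1 N, f i + f N * (∑ i ∈ Icc 1 N, a i - C * N) by
    nlinarith [mul_nonneg (hf0 N) (sub_nonneg.2 (ha N))]
  induction N with
  | zero => simp
  | succ n ih =>
    rw [sum_Icc_succ_top (by omega), sum_Icc_succ_top (by omega), sum_Icc_succ_top (by omega)]
    push_cast
    have : f n * (∑ i ∈ Icc 1 n, a i - C * n) ≤ f (n + 1) * (∑ i ∈ Icc 1 n, a i - C * n) := by
      rcases Nat.eq_zero_or_pos n with rfl | hn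
      · simp
      · nlinarith [mul_nonneg (sub_nonneg.2 (hf n hn)) (sub_nonneg.2 (ha n))]
    linarith

/-- Chebyshev's bound for the logarithms of prime powers. -/
theorem exists_sum_log_isPrimePow_le :
    ∃ C > (0 : ℝ), ∀ n : ℕ, ∑ q ∈ Icc 1 n with IsPrimePow q, Real.log q ≤ C * n := by
  obtain ⟨C₀, hC₀⟩ := Chebyshev.psi_sub_theta_le_mul_sqrt
  refine ⟨Real.log 4 + |C₀| * 2 / Real.log 2, by positivity, fun n => ?_⟩
  rcases Nat.eq_zero_or_pos n with rfl | hn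
  · simp
  have hn1 : (1 : ℝ) ≤ n := by exact_mod_cast hn
  have hlog2 : 0 < Real.log 2 := Real.log_pos (by norm_num)
  have hlogn : 0 ≤ Real.log n := Real.log_nonneg hn1
  have h1 : ∑ q ∈ Icc 1 n with IsPrimePow q, Real.log q ≤
      Chebyshev.theta n + Real.log n / Real.log 2 * (Chebyshev.psi n - Chebyshev.theta n) := by
    rw [Chebyshev.psi_sub_theta_eq_sum_not_prime, Chebyshev.theta, Nat.floor_natCast, mul_sum,
      ← Icc_add_one_left_eq_Ioc, zero_add, sum_filter, sum_filter, sum_filter, ← sum_add_distrib]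
    refine sum_le_sum fun q hq => ?_
    rw [mem_Icc] at hq
    by_cases hp : q.Prime
    · simp [hp, hp.isPrimePow]
    · simp only [hp, not_false_eq_true, if_true, if_false, zero_add]
      rw [ArithmeticFunction.vonMangoldt_apply]
      split_ifs with hpp
      · have h2 : Real.log 2 ≤ Real.log q.minFac := by
          apply Real.log_le_log (by norm_num)
          exact_mod_cast (Nat.minFac_prime hpp.ne_one).two_le
        have h3 : Real.log q ≤ Real.log n :=
          Real.log_le_log (by exact_mod_cast hq.1) (by exact_mod_cast hq.2)
        rw [div_mul_eq_mul_div, le_div_iff₀ hlog2]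
        gcongr
      · simp
  have h2 : Real.log n ≤ 2 * √n := by
    have := Real.log_le_rpow_div (x := n) (ε := 1 / 2) (by positivity) (by norm_num)
    rw [← Real.sqrt_eq_rpow] at this
    linarith
  calc _ ≤ _ := h1
    _ ≤ Real.log 4 * n + (2 * √n) / Real.log 2 * (|C₀| * √n) := by
      gcongr
      · exact Chebyshev.theta_le_log4_mul_x (by positivity)
      · exact sub_nonneg.2 (Chebyshev.theta_le_psi _)
      · exact (hC₀ n).trans (by gcongr; exact le_abs_self _)
    _ = Real.log 4 * n + |C₀| * 2 / Real.log 2 * (√n * √n) := by ring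
    _ = _ := by rw [Real.mul_self_sqrt (by positivity)]; ring

theorem exists_sum_isPrimePow_mul_le : ∃ C > (0 : ℝ), ∀ f : ℕ → ℝ,
    (∀ n, 1 ≤ n → f (n + 1) ≤ f n) → (∀ n, 0 ≤ f n) → ∀ N : ℕ,
    ∑ q ∈ Icc 1 N with IsPrimePow q, Real.log q * f q ≤ C * ∑ i ∈ Icc 1 N, f i := by
  obtain ⟨C, hC, h⟩ := exists_sum_log_isPrimePow_le
  refine ⟨C, hC, fun f hf hf0 N => ?_⟩
  have := sum_mul_le_of_antitone (a := fun q => if IsPrimePow q then Real.log q else 0) (C := C)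
    (fun n => by rw [← sum_filter]; exact h n) hf hf0 N
  rw [sum_filter]
  simpa only [ite_mul, zero_mul] using this

theorem sum_rpow_neg_three_quarters_le (N : ℕ) :
    ∑ i ∈ Icc 1 N, (i : ℝ) ^ (-(3 / 4) : ℝ) ≤ 4 * (N : ℝ) ^ (1 / 4 : ℝ) := by
  induction N with
  | zero => simp
  | succ n ih =>
    rw [sum_Icc_succ_top (by omega)]
    have hpos : (0 : ℝ) < n + 1 := by positivity
    have hb := rpow_one_add_le_one_add_mul_self (s := -(1 / ((n : ℝ) + 1)))
      (by rw [neg_le_neg_iff, div_le_one hpos]; linarith) (p := 1 / 4) (by norm_num) (by norm_num)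
    have h1 : (n : ℝ) ^ (1 / 4 : ℝ) =
        ((n : ℝ) + 1) ^ (1 / 4 : ℝ) * (1 + -(1 / ((n : ℝ) + 1))) ^ (1 / 4 : ℝ) := by
      rw [← Real.mul_rpow hpos.le]
      · congr 1
        field_simp
        ring
      · rw [← sub_eq_add_neg, sub_nonneg, div_le_one hpos]; linarith
    have h2 : ((n : ℝ) + 1) ^ (-(3 / 4) : ℝ) =
        ((n : ℝ) + 1) ^ (1 / 4 : ℝ) * (1 / ((n : ℝ) + 1)) := by
      rw [one_div ((n : ℝ) + 1), ← Real.rpow_neg_one, ← Real.rpow_add hpos]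
      norm_num
    have h3 : 0 ≤ ((n : ℝ) + 1) ^ (1 / 4 : ℝ) := by positivity
    push_cast
    rw [h1] at ih
    rw [h2]
    nlinarith [mul_le_mul_of_nonneg_left hb h3]

theorem sum_rpow_neg_one_add_le {ε : ℝ} (hε : 0 < ε) (N : ℕ) :
    ∑ i ∈ Icc 1 (N + 1), (i : ℝ) ^ (-(1 + ε)) ≤ 1 + (1 - ((N : ℝ) + 1) ^ (-ε)) / ε := by
  induction N with
  | zero => simp
  | succ n ih =>
    rw [sum_Icc_succ_top (by omega)]
    push_cast
    have hpos : (0 : ℝ) < n + 1 := by positivity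
    have hpos' : (0 : ℝ) < n + 1 + 1 := by positivity
    have h1 : ((n : ℝ) + 1 + 1) ^ (-(1 + ε)) =
        ((n : ℝ) + 1 + 1) ^ (-ε) * (1 / ((n : ℝ) + 1 + 1)) := by
      rw [one_div ((n : ℝ) + 1 + 1), ← Real.rpow_neg_one, ← Real.rpow_add hpos']
      congr 1
      ring
    have h2 : ((n : ℝ) + 1 + 1) ^ (-ε) * (1 + ε * (1 / ((n : ℝ) + 1 + 1))) ≤
        ((n : ℝ) + 1) ^ (-ε) := by
      have h3 : ((n : ℝ) + 1) ^ (-ε) = ((n : ℝ) + 1 + 1) ^ (-ε) *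
          Real.exp (ε * (Real.log ((n : ℝ) + 1 + 1) - Real.log ((n : ℝ) + 1))) := by
        rw [Real.rpow_def_of_pos hpos, Real.rpow_def_of_pos hpos', ← Real.exp_add]
        congr 1
        ring
      rw [h3]
      gcongr
      have h4 : 1 / ((n : ℝ) + 1 + 1) ≤
          Real.log ((n : ℝ) + 1 + 1) - Real.log ((n : ℝ) + 1) := by
        have := Real.log_le_sub_one_of_pos (div_pos hpos hpos')
        rw [Real.log_div hpos.ne' hpos'.ne'] at this
        have h5 : ((n : ℝ) + 1) / (n + 1 + 1) - 1 = -(1 / ((n : ℝ) + 1 + 1)) := by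
          field_simp
          ring
        linarith
      have h6 := Real.add_one_le_exp
        (ε * (Real.log ((n : ℝ) + 1 + 1) - Real.log ((n : ℝ) + 1)))
      have h7 := mul_le_mul_of_nonneg_left h4 hε.le
      linarith
    rw [h1]
    have h8 : ((n : ℝ) + 1 + 1) ^ (-ε) * (1 / ((n : ℝ) + 1 + 1)) ≤
        (((n : ℝ) + 1) ^ (-ε) - ((n : ℝ) + 1 + 1) ^ (-ε)) / ε := by
      rw [le_div_iff₀ hε]
      linarith
    have h9 : 1 + (1 - ((n : ℝ) + 1 + 1) ^ (-ε)) / ε = 1 + (1 - ((n : ℝ) + 1) ^ (-ε)) / ε +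
        (((n : ℝ) + 1) ^ (-ε) - ((n : ℝ) + 1 + 1) ^ (-ε)) / ε := by ring
    linarith

theorem tsum_rpow_neg_one_add_le {ε : ℝ} (hε : 0 < ε) :
    ∑' n : ℕ, (n : ℝ) ^ (-(1 + ε)) ≤ 1 + 1 / ε := by
  refine Real.tsum_le_of_sum_range_le (fun n => by positivity) fun n => ?_
  calc ∑ i ∈ range n, (i : ℝ) ^ (-(1 + ε))
      ≤ ∑ i ∈ insert 0 (Icc 1 (n + 1)), (i : ℝ) ^ (-(1 + ε)) := by
        refine sum_le_sum_of_subset_of_nonneg ?_ fun _ _ _ => by positivity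
        intro i hi
        simp only [mem_range, mem_insert, mem_Icc] at hi ⊢
        omega
    _ = ∑ i ∈ Icc 1 (n + 1), (i : ℝ) ^ (-(1 + ε)) := by
        rw [sum_insert (by simp), Nat.cast_zero, Real.zero_rpow (by linarith), zero_add]
    _ ≤ 1 + (1 - ((n : ℝ) + 1) ^ (-ε)) / ε := sum_rpow_neg_one_add_le hε n
    _ ≤ 1 + 1 / ε := by
        gcongr
        have : 0 ≤ ((n : ℝ) + 1) ^ (-ε) := by positivity
        linarith

theorem sum_primesBelow_rpow_le {ε : ℝ} (hε : 0 < ε) (N : ℕ) :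
    ∑ p ∈ N.primesBelow, (p : ℝ) ^ (-(1 + ε)) ≤ Real.log (1 + 1 / ε) := by
  let f : ℕ →* ℝ :=
    { toFun := fun n => (n : ℝ) ^ (-(1 + ε))
      map_one' := by simp
      map_mul' := fun m n => by
        rw [Nat.cast_mul, Real.mul_rpow (by positivity) (by positivity)] }
  have hsum : Summable f := Real.summable_nat_rpow.2 (by linarith)
  have hf0 : ∀ n, 0 ≤ f n := fun n => Real.rpow_nonneg (Nat.cast_nonneg n) _
  have key : ∏ p ∈ N.primesBelow, (1 - f p)⁻¹ ≤ 1 + 1 / ε := by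
    rw [EulerProduct.prod_primesBelow_geometric_eq_tsum_smoothNumbers hsum]
    exact (Summable.tsum_subtype_le f _ hf0 hsum).trans (tsum_rpow_neg_one_add_le hε)
  rw [Real.le_log_iff_exp_le (by positivity), Real.exp_sum]
  refine (prod_le_prod (fun _ _ => (Real.exp_pos _).le) fun p hp => ?_).trans key
  have hp1 : (1 : ℝ) < p := by exact_mod_cast (Nat.prime_of_mem_primesBelow hp).one_lt
  have hfp : f p < 1 := Real.rpow_lt_one_of_one_lt_of_neg hp1 (by linarith)
  have := Real.one_sub_le_exp_neg (f p)
  rw [Real.exp_neg] at this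
  exact (le_inv_comm₀ (by linarith) (Real.exp_pos _)).1 this

/-- The upper bound in Mertens' second theorem. -/
theorem exists_sum_primesBelow_inv_le : ∃ B : ℝ, ∀ N : ℕ, 2 ≤ N →
    ∑ p ∈ (N + 1).primesBelow, (p : ℝ)⁻¹ ≤ Real.log (Real.log N) + B := by
  obtain ⟨C, hC, h⟩ := exists_sum_isPrimePow_mul_le
  refine ⟨1 / Real.log 2 + C * (1 / Real.log 2 + 1), fun N hN => ?_⟩
  have hlog2 : 0 < Real.log 2 := Real.log_pos (by norm_num)
  have hL2 : Real.log 2 ≤ Real.log N := Real.log_le_log (by norm_num) (by exact_mod_cast hN)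
  have hL : 0 < Real.log N := hlog2.trans_le hL2
  have hinv : 1 / Real.log N ≤ 1 / Real.log 2 := by gcongr
  have hlogp : ∑ p ∈ (N + 1).primesBelow, Real.log p * (p : ℝ)⁻¹ ≤ C * (1 + Real.log N) := by
    calc ∑ p ∈ (N + 1).primesBelow, Real.log p * (p : ℝ)⁻¹
        ≤ ∑ q ∈ Icc 1 N with IsPrimePow q, Real.log q * (q : ℝ)⁻¹ := by
          refine sum_le_sum_of_subset_of_nonneg ?_ fun q hq _ => by positivity
          intro p hp
          have hp' := Nat.prime_of_mem_primesBelow hp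
          have := Nat.lt_of_mem_primesBelow hp
          rw [mem_filter, mem_Icc]
          exact ⟨⟨hp'.one_le, by omega⟩, hp'.isPrimePow⟩
      _ ≤ C * ∑ i ∈ Icc 1 N, (i : ℝ)⁻¹ := by
          refine h (fun n => (n : ℝ)⁻¹) (fun n hn => ?_) (fun n => by positivity) N
          have : (0 : ℝ) < n := by exact_mod_cast hn
          gcongr
          linarith
      _ ≤ C * (1 + Real.log N) := by
          gcongr
          have := harmonic_le_one_add_log N
          rw [harmonic_eq_sum_Icc] at this
          push_cast at this
          exact this
  have hs := sum_primesBelow_rpow_le (ε := 1 / Real.log N) (by positivity) (N + 1)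
  rw [one_div_one_div] at hs
  have hlog : Real.log (1 + Real.log N) ≤ Real.log (Real.log N) + 1 / Real.log 2 := by
    have : 1 + Real.log N = Real.log N * (1 + 1 / Real.log N) := by field_simp; ring
    rw [this, Real.log_mul hL.ne' (by positivity)]
    have := Real.log_le_sub_one_of_pos (x := 1 + 1 / Real.log N) (by positivity)
    linarith
  have hterm : ∑ p ∈ (N + 1).primesBelow, (p : ℝ)⁻¹ ≤
      ∑ p ∈ (N + 1).primesBelow, (p : ℝ) ^ (-(1 + 1 / Real.log N)) +
      1 / Real.log N * ∑ p ∈ (N + 1).primesBelow, Real.log p * (p : ℝ)⁻¹ := by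
    rw [mul_sum, ← sum_add_distrib]
    refine sum_le_sum fun p hp => ?_
    have hp0 : (0 : ℝ) < p := by exact_mod_cast (Nat.prime_of_mem_primesBelow hp).pos
    have h1 : (p : ℝ) ^ (-(1 + 1 / Real.log N)) =
        (p : ℝ)⁻¹ * Real.exp (-(1 / Real.log N * Real.log p)) := by
      rw [neg_add, Real.rpow_add hp0, Real.rpow_neg_one, Real.rpow_def_of_pos hp0]
      congr 2
      ring
    rw [h1]
    have h2 := mul_le_mul_of_nonneg_left
      (Real.one_sub_le_exp_neg (1 / Real.log N * Real.log p)) (inv_nonneg.2 hp0.le)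
    linarith
  have h3 : 1 / Real.log N * ∑ p ∈ (N + 1).primesBelow, Real.log p * (p : ℝ)⁻¹ ≤
      C * (1 / Real.log 2 + 1) := by
    calc _ ≤ 1 / Real.log N * (C * (1 + Real.log N)) := by gcongr
      _ = C * (1 / Real.log N + 1) := by field_simp
      _ ≤ _ := by gcongr
  linarith

theorem exists_sum_isPrimePow_inv_le : ∃ B ≥ (0 : ℝ), ∀ N : ℕ, 2 ≤ N →
    ∑ q ∈ Icc 1 N with IsPrimePow q, (q : ℝ)⁻¹ ≤ Real.log (Real.log N) + B := by
  obtain ⟨B, hB⟩ := exists_sum_primesBelow_inv_le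
  have hsum := ArithmeticFunction.vonMangoldt.summable_residueClass_non_primes_div (q := 1) 0
  set F : ℕ → ℝ := fun n =>
    (if n.Prime then 0 else ArithmeticFunction.vonMangoldt.residueClass (0 : ZMod 1) n) / n with hF
  have hF0 : ∀ n, 0 ≤ F n := fun n => by
    simp only [hF]
    have := ArithmeticFunction.vonMangoldt.residueClass_nonneg (0 : ZMod 1) n
    positivity
  have hlog2 : 0 < Real.log 2 := Real.log_pos (by norm_num)
  refine ⟨|B + (∑' n, F n) / Real.log 2|, abs_nonneg _, fun N hN => ?_⟩
  have h1 : ∑ q ∈ Icc 1 N with IsPrimePow q, (q : ℝ)⁻¹ ≤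
      ∑ p ∈ (N + 1).primesBelow, (p : ℝ)⁻¹ + ∑ q ∈ Icc 1 N, F q / Real.log 2 := by
    have hprimes : (N + 1).primesBelow = {p ∈ Icc 1 N | p.Prime} := by
      ext p
      simp only [Nat.mem_primesBelow, mem_filter, mem_Icc]
      exact ⟨fun h => ⟨⟨h.2.one_le, by omega⟩, h.2⟩, fun h => ⟨by omega, h.2⟩⟩
    rw [hprimes, sum_filter, sum_filter, ← sum_add_distrib]
    refine sum_le_sum fun q _ => ?_
    have hq0 := div_nonneg (hF0 q) hlog2.le
    by_cases hp : q.Prime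
    · simpa [hp, hp.isPrimePow] using hq0
    · split_ifs with hpp
      · have h2 : Real.log 2 ≤ Real.log q.minFac := by
          apply Real.log_le_log (by norm_num)
          exact_mod_cast (Nat.minFac_prime hpp.ne_one).two_le
        have hres : ArithmeticFunction.vonMangoldt.residueClass (0 : ZMod 1) q =
            Real.log q.minFac := by
          rw [ArithmeticFunction.vonMangoldt.residueClass, Set.indicator_of_mem,
            ArithmeticFunction.vonMangoldt_apply, if_pos hpp]
          exact Subsingleton.elim _ _
        simp only [hF, hp, if_false, hres, zero_add]
        rw [div_right_comm, inv_eq_one_div]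
        gcongr
        rwa [one_le_div hlog2]
      · simpa using hq0
  have h2 : ∑ q ∈ Icc 1 N, F q / Real.log 2 ≤ (∑' n, F n) / Real.log 2 := by
    rw [← sum_div]
    gcongr
    exact hsum.sum_le_tsum _ fun n _ => hF0 n
  linarith [hB N hN, le_abs_self (B + (∑' n, F n) / Real.log 2)]

theorem exists_sum_log_mul_rpow_le : ∃ C > (0 : ℝ), ∀ N k : ℕ,
    ∑ n ∈ Icc 1 N with n.primeFactors.card = k + 1, Real.log n * (n : ℝ) ^ (-(3 / 4) : ℝ) ≤
      C * (N : ℝ) ^ (1 / 4 : ℝ) * ∑ m ∈ Icc 1 N with m.primeFactors.card = k, (m : ℝ)⁻¹ := by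
  obtain ⟨C, hC, h⟩ := exists_sum_isPrimePow_mul_le
  refine ⟨C * 4, by positivity, fun N k => ?_⟩
  have key := sum_sum_primeFactors_le (fun q => Real.log q * (q : ℝ) ^ (-(3 / 4) : ℝ))
    (fun m => (m : ℝ) ^ (-(3 / 4) : ℝ)) (fun n => by positivity) (fun n => by positivity) N k
  calc _ = _ := sum_congr rfl fun n hn => ?_
    _ ≤ _ := key
    _ ≤ _ := ?_
  · rw [Real.log_nat_eq_sum_factorization, Finsupp.sum, Nat.support_factorization, sum_mul]
    refine sum_congr rfl fun p _ => ?_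
    rw [mul_assoc (Real.log _), ← Real.mul_rpow (by positivity) (by positivity), ← Nat.cast_mul,
      Nat.ordProj_mul_ordCompl_eq_self, Nat.cast_pow, Real.log_pow]
  · rw [mul_sum]
    refine sum_le_sum fun m hm => ?_
    have hm0 : (0 : ℝ) < m := by
      rw [mem_filter, mem_Icc] at hm
      exact_mod_cast hm.1.1
    calc (m : ℝ) ^ (-(3 / 4) : ℝ) *
          ∑ q ∈ Icc 1 (N / m) with IsPrimePow q, Real.log q * (q : ℝ) ^ (-(3 / 4) : ℝ)
        ≤ (m : ℝ) ^ (-(3 / 4) : ℝ) * (C * (4 * ((N : ℝ) / m) ^ (1 / 4 : ℝ))) := by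
          gcongr
          refine (h (fun q => (q : ℝ) ^ (-(3 / 4) : ℝ)) (fun n hn => ?_)
            (fun n => by positivity) _).trans ?_
          · have : (0 : ℝ) < n := by exact_mod_cast hn
            exact Real.rpow_le_rpow_of_nonpos this (by push_cast; linarith) (by norm_num)
          · gcongr
            refine (sum_rpow_neg_three_quarters_le _).trans ?_
            gcongr
            exact Nat.cast_div_le
      _ = C * 4 * (N : ℝ) ^ (1 / 4 : ℝ) *
          ((m : ℝ) ^ (-(3 / 4) : ℝ) * (m : ℝ) ^ (-(1 / 4) : ℝ)) := by
          rw [Real.div_rpow (by positivity) hm0.le, Real.rpow_neg hm0.le (1 / 4)]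
          ring
      _ = C * 4 * (N : ℝ) ^ (1 / 4 : ℝ) * (m : ℝ)⁻¹ := by
          rw [← Real.rpow_add hm0, ← Real.rpow_neg_one]
          norm_num

theorem log_add_le_mul_rpow {u y : ℝ} (hu : 1 ≤ u) (hy : Real.log 2 ≤ y) :
    Real.log u + y ≤ (1 + 4 / Real.log 2) * u ^ (1 / 4 : ℝ) * y := by
  have hlog2 : 0 < Real.log 2 := Real.log_pos (by norm_num)
  have hv : 1 ≤ u ^ (1 / 4 : ℝ) := Real.one_le_rpow hu (by norm_num)
  have h1 := Real.log_le_rpow_div (x := u) (ε := 1 / 4) (by linarith) (by norm_num)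
  have h2 : 1 ≤ y / Real.log 2 := (one_le_div hlog2).2 hy
  have h3 : y ≤ u ^ (1 / 4 : ℝ) * y := le_mul_of_one_le_left (hlog2.le.trans hy) hv
  have h4 : 4 * u ^ (1 / 4 : ℝ) ≤ 4 * u ^ (1 / 4 : ℝ) * (y / Real.log 2) :=
    le_mul_of_one_le_right (by positivity) h2
  calc Real.log u + y ≤ 4 * u ^ (1 / 4 : ℝ) * (y / Real.log 2) + u ^ (1 / 4 : ℝ) * y := by
        linarith
    _ = _ := by ring

theorem one_div_log_sq_le {m M j : ℝ} (hm : 2 ≤ m) (hmj : m ≤ j) (hjM : j ≤ M) :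
    1 / Real.log (1 + j / m) ^ 2 ≤
      (1 + 4 / Real.log 2) ^ 3 * M ^ (3 / 4 : ℝ) / (Real.log M * Real.log (1 + M / m) ^ 2) *
        (Real.log j * j ^ (-(3 / 4) : ℝ)) := by
  set c : ℝ := 1 + 4 / Real.log 2
  have hlog2 : 0 < Real.log 2 := Real.log_pos (by norm_num)
  have hm0 : 0 < m := by linarith
  have hj0 : 0 < j := by linarith
  have hM0 : 0 < M := by linarith
  have hu : 1 ≤ M / j := (one_le_div hj0).2 hjM
  have ht : 1 ≤ j / m := (one_le_div hm0).2 hmj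
  have hlj : Real.log 2 ≤ Real.log j := Real.log_le_log (by norm_num) (by linarith)
  have hlM : 0 < Real.log M := Real.log_pos (by linarith)
  have hljm : Real.log 2 ≤ Real.log (1 + j / m) := Real.log_le_log (by norm_num) (by linarith)
  have hlMm : 0 < Real.log (1 + M / m) := Real.log_pos (by
    have : 0 < M / m := by positivity
    linarith)
  have h1 : Real.log M ≤ c * (M / j) ^ (1 / 4 : ℝ) * Real.log j := by
    refine le_trans (le_of_eq ?_) (log_add_le_mul_rpow hu hlj)
    rw [Real.log_div hM0.ne' hj0.ne']
    ring
  have h2 : Real.log (1 + M / m) ≤ c * (M / j) ^ (1 / 4 : ℝ) * Real.log (1 + j / m) := by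
    refine le_trans ?_ (log_add_le_mul_rpow hu hljm)
    rw [← Real.log_mul (by positivity) (by positivity)]
    refine Real.log_le_log (by positivity) ?_
    have : M / j * (1 + j / m) = M / j + M / m := by field_simp
    rw [this]
    linarith
  have h3 : ((M / j) ^ (1 / 4 : ℝ)) ^ 3 = M ^ (3 / 4 : ℝ) * j ^ (-(3 / 4) : ℝ) := by
    rw [← Real.rpow_natCast, ← Real.rpow_mul (by positivity),
      Real.div_rpow hM0.le hj0.le, Real.rpow_neg hj0.le, div_eq_mul_inv]
    norm_num
  have hl : 0 < Real.log (1 + j / m) := hlog2.trans_le hljm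
  rw [div_mul_eq_mul_div, div_le_div_iff₀ (by positivity) (by positivity), one_mul]
  calc Real.log M * Real.log (1 + M / m) ^ 2
      ≤ (c * (M / j) ^ (1 / 4 : ℝ) * Real.log j) *
        (c * (M / j) ^ (1 / 4 : ℝ) * Real.log (1 + j / m)) ^ 2 := by
        have := hlM.le.trans h1
        gcongr
    _ = c ^ 3 * ((M / j) ^ (1 / 4 : ℝ)) ^ 3 * Real.log j * Real.log (1 + j / m) ^ 2 := by ring
    _ = _ := by rw [h3]; ring

theorem stmt_12 :
    ∃ B ≥ (0 : ℝ), ∃ K > (0 : ℝ),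
      ∀ a : ℕ, 1 ≤ a → ∀ m M : ℝ, 2 ≤ m → m ≤ M →
        (∑ j ∈ (Finset.Icc 1 ⌊M⌋₊).filter
            (fun j : ℕ => m ≤ (j : ℝ) ∧ j.primeFactors.card = a),
          1 / Real.log (1 + (j : ℝ) / m) ^ 2)
        ≤ K * M * (Real.log (Real.log M) + B) ^ (a - 1) /
            (((a - 1).factorial : ℝ) * Real.log M * Real.log (1 + M / m) ^ 2) := by
  obtain ⟨B, hB0, hB⟩ := exists_sum_isPrimePow_inv_le
  obtain ⟨C, hC, hCle⟩ := exists_sum_log_mul_rpow_le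
  have hlog2 : 0 < Real.log 2 := Real.log_pos (by norm_num)
  refine ⟨B, hB0, (1 + 4 / Real.log 2) ^ 3 * C, by positivity, fun a ha m M hm hmM => ?_⟩
  obtain ⟨k, rfl⟩ := Nat.exists_eq_add_of_le' ha
  rw [Nat.add_sub_cancel]
  have hM0 : 0 < M := by linarith
  have hN2 : 2 ≤ ⌊M⌋₊ := Nat.le_floor (by push_cast; linarith)
  have hN2' : (2 : ℝ) ≤ ⌊M⌋₊ := by exact_mod_cast hN2
  have hNM : (⌊M⌋₊ : ℝ) ≤ M := Nat.floor_le hM0.le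
  have hlM : 0 < Real.log M := Real.log_pos (by linarith)
  have hlMm : 0 < Real.log (1 + M / m) := Real.log_pos (by
    have : 0 < M / m := by positivity
    linarith)
  have hS : (∑ q ∈ Icc 1 ⌊M⌋₊ with IsPrimePow q, (q : ℝ)⁻¹) ≤ Real.log (Real.log M) + B := by
    refine (hB _ hN2).trans ?_
    have : 0 < Real.log (⌊M⌋₊ : ℝ) := Real.log_pos (by linarith)
    gcongr
  set A := (1 + 4 / Real.log 2) ^ 3 * M ^ (3 / 4 : ℝ) / (Real.log M * Real.log (1 + M / m) ^ 2)
    with hA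
  have hA0 : 0 ≤ A := by positivity
  calc _ ≤ ∑ j ∈ (Icc 1 ⌊M⌋₊).filter (fun j : ℕ => m ≤ (j : ℝ) ∧ j.primeFactors.card = k + 1),
        A * (Real.log j * (j : ℝ) ^ (-(3 / 4) : ℝ)) := by
        refine sum_le_sum fun j hj => ?_
        rw [mem_filter, mem_Icc] at hj
        exact one_div_log_sq_le hm hj.2.1 ((Nat.cast_le.2 hj.1.2).trans hNM)
    _ ≤ ∑ j ∈ Icc 1 ⌊M⌋₊ with j.primeFactors.card = k + 1,
        A * (Real.log j * (j : ℝ) ^ (-(3 / 4) : ℝ)) := by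
        refine sum_le_sum_of_subset_of_nonneg ?_ fun _ _ _ => by positivity
        exact monotone_filter_right _ fun _ _ h => h.2
    _ ≤ A * (C * M ^ (1 / 4 : ℝ) * ((Real.log (Real.log M) + B) ^ k / k.factorial)) := by
        rw [← mul_sum]
        gcongr
        refine (hCle _ _).trans ?_
        gcongr
        refine (sum_inv_card_primeFactors_le _ k).trans ?_
        have : 0 ≤ ∑ q ∈ Icc 1 ⌊M⌋₊ with IsPrimePow q, (q : ℝ)⁻¹ :=
          sum_nonneg fun _ _ => by positivity
        gcongr
    _ = (1 + 4 / Real.log 2) ^ 3 * C * (M ^ (3 / 4 : ℝ) * M ^ (1 / 4 : ℝ)) *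
        (Real.log (Real.log M) + B) ^ k /
          (k.factorial * Real.log M * Real.log (1 + M / m) ^ 2) := by
        rw [hA]
        field_simp
    _ = _ := by
        rw [← Real.rpow_add hM0]
        norm_num
end
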